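/- Let k ≥ 5 and let d_1, …, d_{k−2} be positive integers with d_1 − d_2 ≥ 4 and d_{i−2} − d_{i−1} ≥ i for 4 ≤ i ≤ k, and set d_{k−1} = 1. Put n = Σ_{i=1}^{k−2}(2^{d_i} − 1) and, for 5 ≤ r ≤ k, put n_r = Σ_{i=1}^{r−2}(2^{d_i − d_{r−1}} − 1) − 1. Then dim_{F_2}(QP_k)_n = Π_{i=1}^{k}(2^i − 1) + Σ_{r=5}^{k} (Π_{i=r+1}^{k}(2^i − 1)) · dim_{F_2} Ker((Sq̃^0_*)_{n_r}), where (Sq̃^0_*)_{n_r} : (QP_r)_{2n_r + r} → (QP_r)_{n_r} denotes Kameko's homomorphism in degree 2n_r + r and, by convention, Π_{i=r+1}^{k}(2^i − 1) = 1 when r = k. -/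

import Mathlib

set_option synthInstance.maxHeartbeats 1000000
set_option maxHeartbeats 2000000

open MvPolynomial

/-- The total Steenrod square on `P_k = F_2[x_1,…,x_k]`, the algebra map with
`Sq(x_j) = x_j + x_j^2`. -/
noncomputable def SqTotal (k : ℕ) :
    MvPolynomial (Fin k) (ZMod 2) →ₐ[ZMod 2] MvPolynomial (Fin k) (ZMod 2) :=
  aeval fun j => X j + X j ^ 2

/-- The Steenrod square `Sq^i : P_k → P_k`, sending a homogeneous polynomial `f` of
degree `d` to the degree-`d + i` homogeneous component of `Sq(f)`, extended additively. -/
noncomputable def SqOp (k i : ℕ) (f : MvPolynomial (Fin k) (ZMod 2)) :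
    MvPolynomial (Fin k) (ZMod 2) :=
  ∑ d ∈ Finset.range (f.totalDegree + 1),
    homogeneousComponent (d + i) (SqTotal k (homogeneousComponent d f))

/-- The space of hit polynomials: finite sums of `Sq^i (f_i)` with `i > 0`. -/
noncomputable def hitSubmodule (k : ℕ) :
    Submodule (ZMod 2) (MvPolynomial (Fin k) (ZMod 2)) :=
  Submodule.span (ZMod 2) {g | ∃ i f, 0 < i ∧ g = SqOp k i f}

/-- A polynomial is hit if it is a finite sum of `Sq^i (f_i)` with `i > 0`. -/
def IsHit (k : ℕ) (f : MvPolynomial (Fin k) (ZMod 2)) : Prop := f ∈ hitSubmodule k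

/-- `(QP_k)_n`: the space of homogeneous polynomials of degree `n` modulo hit polynomials. -/
abbrev QP (k n : ℕ) :=
  ↥(homogeneousSubmodule (Fin k) (ZMod 2) n) ⧸
    ((hitSubmodule k).comap (homogeneousSubmodule (Fin k) (ZMod 2) n).subtype)

/-- Kameko's map `Sq̃ : P_k → P_k`, defined on monomials by `Sq̃(x) = y` if
`x = x_1 x_2 ⋯ x_k · y^2` for a monomial `y`, and `Sq̃(x) = 0` otherwise,
extended linearly. -/
noncomputable def kamekoFun (k : ℕ) (f : MvPolynomial (Fin k) (ZMod 2)) :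
    MvPolynomial (Fin k) (ZMod 2) :=
  ∑ a ∈ f.support,
    if ∀ j, Odd (a j) then
      monomial (Finsupp.mapRange (fun t => (t - 1) / 2) (by norm_num) a) (f.coeff a)
    else 0

/-- The linear dual of the polynomial algebra `P_k`. -/
abbrev PolyDual (k : ℕ) := MvPolynomial (Fin k) (ZMod 2) →ₗ[ZMod 2] ZMod 2

/-- The product of the variables indexed by `T`. -/
noncomputable def varProd {k : ℕ} (T : Finset (Fin k)) : MvPolynomial (Fin k) (ZMod 2) :=
  ∏ i ∈ T, X i

/-- A functional is supported in degree `n` if it kills all monomials of other degrees. -/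
def PolyDual.HasDegree {k : ℕ} (f : PolyDual k) (n : ℕ) : Prop :=
  ∀ a : Fin k →₀ ℕ, a.degree ≠ n → f (monomial a 1) = 0

/-- The functional `y ↦ f (x_T y ^ 2)`. -/
noncomputable def psi {k : ℕ} (T : Finset (Fin k)) : PolyDual k →ₗ[ZMod 2] PolyDual k :=
  LinearMap.lcomp (ZMod 2) (ZMod 2)
    ((LinearMap.mulLeft (ZMod 2) (varProd T)).comp
      (expand 2 : MvPolynomial (Fin k) (ZMod 2) →ₐ[ZMod 2] _).toLinearMap)

/-- The functional `y ↦ f (x_i y)`. -/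
noncomputable def der {k : ℕ} (i : Fin k) : PolyDual k →ₗ[ZMod 2] PolyDual k :=
  LinearMap.lcomp (ZMod 2) (ZMod 2) (LinearMap.mulLeft (ZMod 2) (X i))

/-- The functionals of degree `n` invariant under the total Steenrod square. -/
noncomputable def invDual (k n : ℕ) : Submodule (ZMod 2) (PolyDual k) where
  carrier := {f | (∀ z, f (SqTotal k z) = f z) ∧ f.HasDegree n}
  zero_mem' := ⟨fun _ => rfl, fun _ _ => rfl⟩
  add_mem' := fun {f g} hf hg => ⟨fun z => by simp [hf.1 z, hg.1 z],
    fun a ha => by simp [hf.2 a ha, hg.2 a ha]⟩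
  smul_mem' := fun c f hf => ⟨fun z => by simp [hf.1 z], fun a ha => by simp [hf.2 a ha]⟩

section Basic

variable {k : ℕ}

theorem psi_apply (T : Finset (Fin k)) (f : PolyDual k) (y : MvPolynomial (Fin k) (ZMod 2)) :
    psi T f y = f (varProd T * y ^ 2) := by
  simp [psi, expand_zmod]

theorem der_apply (i : Fin k) (f : PolyDual k) (y : MvPolynomial (Fin k) (ZMod 2)) :
    der i f y = f (X i * y) := by
  simp [der]

theorem der_comm (i j : Fin k) (f : PolyDual k) : der i (der j f) = der j (der i f) := by
  ext1 a
  ext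
  simp only [LinearMap.coe_comp, Function.comp_apply, der_apply]
  rw [mul_left_comm]

theorem invDual_sq {n : ℕ} {f : PolyDual k} (hf : f ∈ invDual k n)
    (z : MvPolynomial (Fin k) (ZMod 2)) : f (SqTotal k z) = f z := hf.1 z

theorem invDual_degree {n : ℕ} {f : PolyDual k} (hf : f ∈ invDual k n) : f.HasDegree n := hf.2

theorem sqTotal_X (i : Fin k) : SqTotal k (X i) = X i + X i ^ 2 := by
  simp [SqTotal]

theorem expMul_induction {M : (Fin k →₀ ℕ) → Prop} (h0 : M 0)
    (hs : ∀ i a, M a → M (Finsupp.single i 1 + a)) (a : Fin k →₀ ℕ) : M a := by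
  induction a using Finsupp.induction with
  | zero => exact h0
  | single_add i b f _ _ ih =>
    induction b with
    | zero => simpa using ih
    | succ n ihn =>
      by_cases hn : n = 0
      · subst hn; simpa using hs i f ih
      · have h1 := hs i _ (ihn hn)
        rw [← add_assoc, ← Finsupp.single_add, add_comm 1 n] at h1
        exact h1

theorem monomial_single_add (i : Fin k) (a : Fin k →₀ ℕ) :
    (monomial (Finsupp.single i 1 + a) 1 : MvPolynomial (Fin k) (ZMod 2)) =
      X i * monomial a 1 := by
  rw [X, monomial_mul, one_mul]

theorem PolyDual.ext_monomial {f g : PolyDual k}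
    (h : ∀ a, f (monomial a 1) = g (monomial a 1)) : f = g := by
  ext1 a
  ext
  exact h a

theorem monomial_eq_varProd_mul_sq (a : Fin k →₀ ℕ) :
    (monomial a 1 : MvPolynomial (Fin k) (ZMod 2)) =
      varProd (Finset.univ.filter fun i => Odd (a i)) *
        (monomial (Finsupp.mapRange (fun t => t / 2) (by norm_num) a) 1) ^ 2 := by
  rw [monomial_eq, monomial_eq, Finsupp.prod_fintype _ _ (by simp),
    Finsupp.prod_fintype _ _ (by simp), varProd, Finset.prod_filter]
  simp only [C_1, one_mul, ← Finset.prod_pow, ← Finset.prod_mul_distrib, Finsupp.mapRange_apply]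
  refine Finset.prod_congr rfl fun i _ => ?_
  split_ifs with h
  · obtain ⟨b, hb⟩ := h
    rw [← pow_mul, ← pow_succ']
    congr 1; omega
  · rw [Nat.not_odd_iff_even] at h
    obtain ⟨b, hb⟩ := h
    rw [← pow_mul, one_mul]
    congr 1; omega

theorem PolyDual.ext_psi {f g : PolyDual k} (h : ∀ T, psi T f = psi T g) : f = g := by
  refine PolyDual.ext_monomial fun a => ?_
  rw [monomial_eq_varProd_mul_sq, ← psi_apply, ← psi_apply, h]

theorem PolyDual.HasDegree.apply_eq_zero {f : PolyDual k} {n e : ℕ} (hf : f.HasDegree n)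
    {y : MvPolynomial (Fin k) (ZMod 2)} (hy : y.IsHomogeneous e) (he : e ≠ n) : f y = 0 := by
  rw [y.as_sum, map_sum]
  refine Finset.sum_eq_zero fun a ha => ?_
  have h1 : a.degree = e := by
    rw [Finsupp.degree_eq_weight_one]; exact hy (mem_support_iff.mp ha)
  have h2 : (monomial a (coeff a y) : MvPolynomial (Fin k) (ZMod 2)) =
      coeff a y • monomial a 1 := by rw [smul_monomial]; simp
  rw [h2, map_smul, hf a (h1 ▸ he), smul_zero]

theorem varProd_isHomogeneous (T : Finset (Fin k)) : (varProd T).IsHomogeneous T.card := by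
  have := IsHomogeneous.prod T (fun i : Fin k => (X i : MvPolynomial (Fin k) (ZMod 2)))
    (fun _ => 1) (fun i _ => isHomogeneous_X _ i)
  simpa [varProd] using this

theorem isHomogeneous_monomial_degree (a : Fin k →₀ ℕ) :
    (monomial a 1 : MvPolynomial (Fin k) (ZMod 2)).IsHomogeneous a.degree :=
  isHomogeneous_monomial 1 rfl

theorem PolyDual.HasDegree.psi {f : PolyDual k} {n m : ℕ} (hf : f.HasDegree n)
    {T : Finset (Fin k)} (h : ∀ e, n = T.card + 2 * e → e = m) : (psi T f).HasDegree m := by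
  intro a ha
  rw [psi_apply]
  refine hf.apply_eq_zero
    ((varProd_isHomogeneous T).mul ((isHomogeneous_monomial_degree a).pow 2)) ?_
  intro h'
  exact ha (h _ (by rw [← h']; ring))

theorem PolyDual.HasDegree.psi_eq_zero {f : PolyDual k} {n : ℕ} (hf : f.HasDegree n)
    {T : Finset (Fin k)} (h : ∀ e, n ≠ T.card + 2 * e) : _root_.psi T f = 0 := by
  refine PolyDual.ext_monomial fun a => ?_
  rw [psi_apply]
  refine hf.apply_eq_zero
    ((varProd_isHomogeneous T).mul ((isHomogeneous_monomial_degree a).pow 2)) ?_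
  intro h'
  exact h a.degree (by rw [← h']; ring)

theorem PolyDual.HasDegree.der {f : PolyDual k} {n : ℕ} (hf : f.HasDegree n) (i : Fin k) :
    (der i f).HasDegree (n - 1) := by
  intro a ha
  rw [der_apply]
  refine hf.apply_eq_zero ((isHomogeneous_X _ i).mul (isHomogeneous_monomial_degree a)) ?_
  omega

theorem PolyDual.HasDegree.add {f g : PolyDual k} {n : ℕ} (hf : f.HasDegree n)
    (hg : g.HasDegree n) : (f + g).HasDegree n := fun a ha => by simp [hf a ha, hg a ha]

theorem PolyDual.HasDegree.sum {ι : Type*} {s : Finset ι} {f : ι → PolyDual k} {n : ℕ}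
    (hf : ∀ i ∈ s, (f i).HasDegree n) : (∑ i ∈ s, f i).HasDegree n := fun a ha => by
  rw [LinearMap.sum_apply]; exact Finset.sum_eq_zero fun i hi => hf i hi a ha

theorem apply_sqTotal_X_mul (p : PolyDual k) (i : Fin k) (z : MvPolynomial (Fin k) (ZMod 2)) :
    p (SqTotal k (X i * z)) =
      der i p (SqTotal k z) + der i (der i p) (SqTotal k z) := by
  rw [map_mul, sqTotal_X, der_apply, der_apply, der_apply, ← map_add]
  congr 1; ring

theorem apply_sqTotal_monomial_of_vanish_above (a : Fin k →₀ ℕ) :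
    ∀ p : PolyDual k, (∀ b : Fin k →₀ ℕ, a.degree < b.degree → p (monomial b 1) = 0) →
      p (SqTotal k (monomial a 1)) = p (monomial a 1) := by
  induction a using expMul_induction with
  | h0 => intro p _; simp
  | hs i a ih =>
    intro p hp
    have h1 : ∀ b : Fin k →₀ ℕ, a.degree < b.degree → der i p (monomial b 1) = 0 := by
      intro b hb
      rw [der_apply, ← monomial_single_add]
      apply hp; simpa using hb
    have h2 : ∀ b : Fin k →₀ ℕ, a.degree ≤ b.degree → der i (der i p) (monomial b 1) = 0 := by
      intro b hb
      rw [der_apply, ← monomial_single_add]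
      apply h1; simp; omega
    rw [monomial_single_add, apply_sqTotal_X_mul, ih _ h1, ih _ fun b hb => h2 b hb.le,
      h2 a le_rfl, add_zero, der_apply]

theorem apply_sqTotal_monomial_of_vanish_below (a : Fin k →₀ ℕ) :
    ∀ p : PolyDual k, (∀ b : Fin k →₀ ℕ, b.degree < 2 * a.degree → p (monomial b 1) = 0) →
      p (SqTotal k (monomial a 1)) = p ((monomial a 1) ^ 2) := by
  induction a using expMul_induction with
  | h0 => intro p _; simp
  | hs i a ih =>
    intro p hp
    have h1 : ∀ b : Fin k →₀ ℕ, b.degree < 2 * a.degree + 1 → der i p (monomial b 1) = 0 := by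
      intro b hb
      rw [der_apply, ← monomial_single_add]
      apply hp; simp; omega
    have h2 : ∀ b : Fin k →₀ ℕ, b.degree < 2 * a.degree →
        der i (der i p) (monomial b 1) = 0 := by
      intro b hb
      rw [der_apply, ← monomial_single_add]
      apply h1; simp; omega
    rw [monomial_single_add, apply_sqTotal_X_mul, ih _ h2,
      ih _ fun b hb => h1 b (by omega)]
    have h3 : der i p ((monomial a 1) ^ 2) = 0 := by
      rw [monomial_pow, one_pow]; apply h1; simp
    rw [h3, zero_add, der_apply, der_apply]
    congr 1; ring

theorem PolyDual.HasDegree.eq_zero_of_sqTotal {p : PolyDual k} {n : ℕ} (hp : p.HasDegree n)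
    (h : ∀ y, p (SqTotal k y) = 0) : p = 0 := by
  refine PolyDual.ext_monomial fun a => ?_
  by_cases ha : a.degree = n
  · rw [← apply_sqTotal_monomial_of_vanish_above a p, h]
    · rfl
    · intro b hb; exact hp b (by omega)
  · rw [hp a ha]; rfl

theorem sqTotal_varProd (T : Finset (Fin k)) (y : MvPolynomial (Fin k) (ZMod 2)) :
    SqTotal k (varProd T * y ^ 2) =
      ∑ U ∈ T.powerset, varProd (T \ U) * (varProd U * SqTotal k y) ^ 2 := by
  rw [map_mul, map_pow, varProd, map_prod]
  simp only [sqTotal_X]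
  simp_rw [add_comm (X _ : MvPolynomial (Fin k) (ZMod 2))]
  rw [Finset.prod_add, Finset.sum_mul]
  refine Finset.sum_congr rfl fun U _ => ?_
  rw [Finset.prod_pow, varProd, varProd]
  ring

theorem psi_star {n : ℕ} {f : PolyDual k} (hf : f ∈ invDual k n) (T : Finset (Fin k))
    (y : MvPolynomial (Fin k) (ZMod 2)) :
    ∑ U ∈ T.powerset, psi (T \ U) f (varProd U * SqTotal k y) = psi T f y := by
  rw [psi_apply, ← invDual_sq hf, sqTotal_varProd, map_sum]
  simp_rw [psi_apply]

end Basic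

/-- Kameko's map as a linear endomorphism of `P_k`. -/
noncomputable def kameko (k : ℕ) :
    MvPolynomial (Fin k) (ZMod 2) →ₗ[ZMod 2] MvPolynomial (Fin k) (ZMod 2) :=
  (basisMonomials (Fin k) (ZMod 2)).constr (ZMod 2) fun a =>
    if ∀ j, Odd (a j) then
      monomial (Finsupp.mapRange (fun t => (t - 1) / 2) (by norm_num) a) 1
    else 0

section Kameko

variable {k : ℕ}

theorem kameko_monomial (a : Fin k →₀ ℕ) : kameko k (monomial a 1) =
    if ∀ j, Odd (a j) then
      monomial (Finsupp.mapRange (fun t => (t - 1) / 2) (by norm_num) a) 1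
    else 0 := by
  have h : (monomial a 1 : MvPolynomial (Fin k) (ZMod 2)) = basisMonomials (Fin k) (ZMod 2) a := by
    rw [coe_basisMonomials]
  rw [kameko, h, Module.Basis.constr_basis]

theorem kamekoFun_eq (f : MvPolynomial (Fin k) (ZMod 2)) : kamekoFun k f = kameko k f := by
  conv_rhs => rw [f.as_sum, map_sum]
  refine Finset.sum_congr rfl fun a _ => ?_
  have h2 : (monomial a (coeff a f) : MvPolynomial (Fin k) (ZMod 2)) =
      coeff a f • monomial a 1 := by rw [smul_monomial]; simp
  rw [h2, map_smul, kameko_monomial]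
  split_ifs
  · rw [smul_monomial]; simp
  · simp

theorem linearMap_ext_monomial {M : Type*} [AddCommGroup M] [Module (ZMod 2) M]
    {f g : MvPolynomial (Fin k) (ZMod 2) →ₗ[ZMod 2] M}
    (h : ∀ a, f (monomial a 1) = g (monomial a 1)) : f = g := by
  ext1 a
  ext
  exact h a

theorem linearMap_ext_varProd {M : Type*} [AddCommGroup M] [Module (ZMod 2) M]
    {f g : MvPolynomial (Fin k) (ZMod 2) →ₗ[ZMod 2] M}
    (h : ∀ T y, f (varProd T * y ^ 2) = g (varProd T * y ^ 2)) : f = g := by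
  refine linearMap_ext_monomial fun a => ?_
  rw [monomial_eq_varProd_mul_sq, h]

theorem varProd_mul_monomial_sq (T : Finset (Fin k)) (a : Fin k →₀ ℕ) :
    (varProd T * (monomial a 1) ^ 2 : MvPolynomial (Fin k) (ZMod 2)) =
      monomial (∑ i ∈ T, Finsupp.single i 1 + 2 • a) 1 := by
  rw [varProd, monomial_pow, one_pow]
  simp only [X]
  rw [← monomial_sum_one, monomial_mul, one_mul]

theorem kameko_varProd_mul_sq (T : Finset (Fin k)) (y : MvPolynomial (Fin k) (ZMod 2)) :
    kameko k (varProd T * y ^ 2) = if T = Finset.univ then y else 0 := by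
  have key : (kameko k).comp ((LinearMap.mulLeft (ZMod 2) (varProd T)).comp
      (expand 2 : MvPolynomial (Fin k) (ZMod 2) →ₐ[ZMod 2] _).toLinearMap) =
      if T = Finset.univ then LinearMap.id else 0 := by
    refine linearMap_ext_monomial fun a => ?_
    rw [LinearMap.comp_apply, LinearMap.comp_apply, AlgHom.toLinearMap_apply,
      LinearMap.mulLeft_apply, expand_zmod, varProd_mul_monomial_sq, kameko_monomial]
    have h0 : ∀ j, (∑ i ∈ T, Finsupp.single i 1 + 2 • a : Fin k →₀ ℕ) j =
        (if j ∈ T then 1 else 0) + 2 * a j := by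
      intro j
      simp [Finsupp.single_apply]
    by_cases hT : T = Finset.univ
    · subst hT
      rw [if_pos, if_pos rfl]
      · rw [LinearMap.id_apply]
        refine congrArg (fun b => monomial b 1) (Finsupp.ext fun j => ?_)
        rw [Finsupp.mapRange_apply, h0]
        simp
      · intro j; rw [h0]; simp [parity_simps]
    · rw [if_neg, if_neg hT]
      · rfl
      · intro h
        apply hT
        refine Finset.eq_univ_iff_forall.mpr fun j => ?_
        by_contra hj
        have := h j
        rw [h0, if_neg hj] at this
        rw [zero_add] at this
        exact Nat.not_odd_iff_even.mpr (even_two_mul _) this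
  have := LinearMap.congr_fun key y
  simp only [LinearMap.comp_apply, AlgHom.toLinearMap_apply, expand_zmod,
    LinearMap.mulLeft_apply] at this
  rw [this]
  split_ifs <;> rfl

theorem kameko_mul_sq (w z : MvPolynomial (Fin k) (ZMod 2)) :
    kameko k (w * z ^ 2) = kameko k w * z := by
  have key : (kameko k).comp (LinearMap.mulRight (ZMod 2) (z ^ 2)) =
      (LinearMap.mulRight (ZMod 2) z).comp (kameko k) := by
    refine linearMap_ext_varProd fun T y => ?_
    simp only [LinearMap.comp_apply, LinearMap.mulRight_apply]
    rw [mul_assoc, ← mul_pow, kameko_varProd_mul_sq, kameko_varProd_mul_sq]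
    split_ifs <;> simp
  exact LinearMap.congr_fun key w

theorem kameko_sqTotal (z : MvPolynomial (Fin k) (ZMod 2)) :
    kameko k (SqTotal k z) = SqTotal k (kameko k z) := by
  have key : (kameko k).comp (SqTotal k).toLinearMap =
      (SqTotal k).toLinearMap.comp (kameko k) := by
    refine linearMap_ext_varProd fun T y => ?_
    simp only [LinearMap.comp_apply, AlgHom.toLinearMap_apply]
    rw [sqTotal_varProd, map_sum, kameko_varProd_mul_sq]
    simp_rw [kameko_varProd_mul_sq]
    rw [Finset.sum_eq_single ∅]
    · simp only [Finset.sdiff_empty, varProd, Finset.prod_empty, one_mul]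
      split_ifs <;> simp
    · intro U hU hne
      rw [if_neg]
      intro h
      apply hne
      rw [Finset.mem_powerset] at hU
      rw [Finset.eq_empty_iff_forall_notMem]
      intro x hx
      have h1 := Finset.mem_univ x
      rw [← h] at h1
      exact (Finset.mem_sdiff.mp h1).2 hx
    · simp
  exact LinearMap.congr_fun key z

theorem psi_comp_kameko (T : Finset (Fin k)) (h : PolyDual k) :
    psi T (h.comp (kameko k)) = if T = Finset.univ then h else 0 := by
  refine LinearMap.ext fun y => ?_
  rw [psi_apply, LinearMap.comp_apply, kameko_varProd_mul_sq]
  split_ifs <;> simp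

theorem comp_kameko_mem {n : ℕ} {h : PolyDual k} (hh : h ∈ invDual k n) :
    h.comp (kameko k) ∈ invDual k (2 * n + k) := by
  refine ⟨fun z => ?_, fun a ha => ?_⟩
  · simp only [LinearMap.comp_apply, kameko_sqTotal, invDual_sq hh]
  · have h1 := monomial_eq_varProd_mul_sq a
    have h2 := isHomogeneous_monomial_degree a
    rw [LinearMap.comp_apply, h1, kameko_varProd_mul_sq]
    split_ifs with h
    · apply invDual_degree hh
      intro h3
      apply ha
      rw [h1, h] at h2
      have h4 := (varProd_isHomogeneous (Finset.univ : Finset (Fin k))).mul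
        ((isHomogeneous_monomial_degree
          (Finsupp.mapRange (fun t => t / 2) (by norm_num) a)).pow 2)
      rw [h3] at h4
      have := h2.inj_right h4 ?_
      · rw [this]; simp; ring
      · rw [varProd_mul_monomial_sq]
        simp
    · simp

theorem eq_comp_kameko {f : PolyDual k} (h : ∀ T, T ≠ Finset.univ → psi T f = 0) :
    f = (psi Finset.univ f).comp (kameko k) := by
  refine PolyDual.ext_psi fun T => ?_
  rw [psi_comp_kameko]
  split_ifs with hT
  · rw [hT]
  · exact h T hT

theorem psi_mem {n m : ℕ} {f : PolyDual k} (hf : f ∈ invDual k n) {T : Finset (Fin k)}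
    (hm : ∀ e, n = T.card + 2 * e → e = m) (h : ∀ U, U ⊂ T → psi U f = 0) :
    psi T f ∈ invDual k m := by
  refine ⟨fun y => ?_, (invDual_degree hf).psi hm⟩
  rw [← psi_star hf T y, Finset.sum_eq_single ∅]
  · simp [varProd]
  · intro U hU hne
    rw [h (T \ U), LinearMap.zero_apply]
    exact Finset.sdiff_ssubset (Finset.mem_powerset.mp hU) (Finset.nonempty_iff_ne_empty.mpr hne)
  · simp

end Kameko

section Duality

variable {k : ℕ}

theorem PolyDual.HasDegree.apply_homogeneousComponent {f : PolyDual k} {n : ℕ}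
    (hf : f.HasDegree n) (z : MvPolynomial (Fin k) (ZMod 2)) :
    f (homogeneousComponent n z) = f z := by
  conv_rhs => rw [← sum_homogeneousComponent z, map_sum]
  by_cases h : n ∈ Finset.range (z.totalDegree + 1)
  · rw [Finset.sum_eq_single_of_mem n h]
    intro b _ hb
    exact hf.apply_eq_zero (homogeneousComponent_isHomogeneous b z) hb
  · rw [homogeneousComponent_eq_zero, map_zero, Finset.sum_eq_zero]
    · intro b hb
      refine hf.apply_eq_zero (homogeneousComponent_isHomogeneous b z) ?_
      rintro rfl; exact h hb
    · simp at h; omega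

theorem invDual_hit {n : ℕ} {f : PolyDual k} (hf : f ∈ invDual k n)
    {z : MvPolynomial (Fin k) (ZMod 2)} (hz : z ∈ hitSubmodule k) : f z = 0 := by
  have : hitSubmodule k ≤ LinearMap.ker f := by
    refine Submodule.span_le.mpr ?_
    rintro _ ⟨i, g, hi, rfl⟩
    rw [SetLike.mem_coe, LinearMap.mem_ker, SqOp, map_sum]
    refine Finset.sum_eq_zero fun e _ => ?_
    by_cases h : e + i = n
    · rw [h, (invDual_degree hf).apply_homogeneousComponent, invDual_sq hf]
      exact (invDual_degree hf).apply_eq_zero (homogeneousComponent_isHomogeneous e g) (by omega)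
    · exact (invDual_degree hf).apply_eq_zero (homogeneousComponent_isHomogeneous _ _) h
  exact this hz

/-- The pairing of invariant functionals with `QP`. -/
noncomputable def invDualToDual (k n : ℕ) :
    invDual k n →ₗ[ZMod 2] Module.Dual (ZMod 2) (QP k n) where
  toFun f := Submodule.liftQ _ (f.1.comp (homogeneousSubmodule (Fin k) (ZMod 2) n).subtype)
    fun z hz => invDual_hit f.2 hz
  map_add' f g := by
    ext x; rfl
  map_smul' c f := by
    ext x; rfl

theorem sqOp_of_isHomogeneous {e i : ℕ} {z : MvPolynomial (Fin k) (ZMod 2)}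
    (hz : z.IsHomogeneous e) :
    SqOp k i z = homogeneousComponent (e + i) (SqTotal k z) := by
  by_cases h0 : z = 0
  · simp [h0, SqOp]
  rw [SqOp, Finset.sum_eq_single_of_mem e]
  · rw [homogeneousComponent_of_mem hz, if_pos rfl]
  · simp [hz.totalDegree h0]
  · intro b _ hb
    rw [homogeneousComponent_of_mem hz, if_neg hb]; simp

theorem invDualToDual_bijective (k n : ℕ) : Function.Bijective (invDualToDual k n) := by
  constructor
  · rw [injective_iff_map_eq_zero]
    intro f hf
    apply Subtype.ext
    refine PolyDual.ext_monomial fun a => ?_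
    by_cases ha : a.degree = n
    · have := LinearMap.congr_fun hf (Submodule.Quotient.mk
        ⟨monomial a 1, ha ▸ isHomogeneous_monomial_degree a⟩)
      exact this
    · exact invDual_degree f.2 a ha
  · intro φ
    let f : PolyDual k := φ.comp ((Submodule.mkQ _).comp
      ((homogeneousComponent n).codRestrict (homogeneousSubmodule (Fin k) (ZMod 2) n)
        fun z => homogeneousComponent_isHomogeneous n z))
    have hf : ∀ z (hz : z ∈ homogeneousSubmodule (Fin k) (ZMod 2) n),
        f z = φ (Submodule.Quotient.mk ⟨z, hz⟩) := by
      intro z hz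
      have : (homogeneousComponent n).codRestrict (homogeneousSubmodule (Fin k) (ZMod 2) n)
        (fun z => homogeneousComponent_isHomogeneous n z) z = ⟨z, hz⟩ := by
        apply Subtype.ext
        exact homogeneousComponent_eq_self hz
      change φ (Submodule.Quotient.mk _) = _
      rw [this]
    have hc : ∀ z, f (homogeneousComponent n z) = f z := by
      intro z
      rw [hf _ (homogeneousComponent_isHomogeneous n z)]
      rfl
    have hdeg : f.HasDegree n := by
      intro a ha
      rw [← hc, homogeneousComponent_of_mem (isHomogeneous_monomial_degree a),
        if_neg (Ne.symm ha), map_zero]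
    have hsq : ∀ z, f (SqTotal k z) = f z := by
      have : f.comp (SqTotal k).toLinearMap = f := by
        refine PolyDual.ext_monomial fun a => ?_
        rw [LinearMap.comp_apply, AlgHom.toLinearMap_apply]
        rcases le_or_gt n a.degree with h | h
        · exact apply_sqTotal_monomial_of_vanish_above a f fun b hb => hdeg b (by omega)
        · rw [hdeg a h.ne, ← hc, hf _ (homogeneousComponent_isHomogeneous n _)]
          convert map_zero φ
          rw [Submodule.Quotient.mk_eq_zero]
          change homogeneousComponent n _ ∈ hitSubmodule k
          refine Submodule.subset_span ⟨n - a.degree, monomial a 1, by omega, ?_⟩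
          rw [sqOp_of_isHomogeneous (isHomogeneous_monomial_degree a)]
          congr 2; omega
      exact fun z => LinearMap.congr_fun this z
    refine ⟨⟨f, hsq, hdeg⟩, ?_⟩
    apply LinearMap.ext
    intro x
    obtain ⟨z, rfl⟩ := Submodule.Quotient.mk_surjective _ x
    exact hf z.1 z.2

instance (k n : ℕ) : Module.Finite (ZMod 2) (homogeneousSubmodule (Fin k) (ZMod 2) n) :=
  Module.Finite.iff_fg.mpr (homogeneousSubmodule_fg _ _ n)

instance invDual_finite (k n : ℕ) : Module.Finite (ZMod 2) (invDual k n) :=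
  Module.Finite.equiv (LinearEquiv.ofBijective _ (invDualToDual_bijective k n)).symm

theorem finrank_QP (k n : ℕ) :
    Module.finrank (ZMod 2) (QP k n) = Module.finrank (ZMod 2) (invDual k n) := by
  rw [(LinearEquiv.ofBijective _ (invDualToDual_bijective k n)).finrank_eq,
    Subspace.dual_finrank_eq]

theorem finrank_invDual_kameko (k n : ℕ) (L : QP k (2 * n + k) →ₗ[ZMod 2] QP k n)
    (hL : ∀ (f : homogeneousSubmodule (Fin k) (ZMod 2) (2 * n + k))
      (g : homogeneousSubmodule (Fin k) (ZMod 2) n),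
      (g : MvPolynomial (Fin k) (ZMod 2)) = kamekoFun k (f : MvPolynomial (Fin k) (ZMod 2)) →
      L (Submodule.Quotient.mk f) = Submodule.Quotient.mk g) :
    Module.finrank (ZMod 2) (invDual k (2 * n + k)) =
      Module.finrank (ZMod 2) (invDual k n) +
        Module.finrank (ZMod 2) (LinearMap.ker L) := by
  have hsurj : Function.Surjective L := by
    intro x
    obtain ⟨g, rfl⟩ := Submodule.Quotient.mk_surjective _ x
    have hmem : varProd Finset.univ * (g : MvPolynomial (Fin k) (ZMod 2)) ^ 2 ∈
        homogeneousSubmodule (Fin k) (ZMod 2) (2 * n + k) := by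
      have := (varProd_isHomogeneous (Finset.univ : Finset (Fin k))).mul
        ((show (g : MvPolynomial (Fin k) (ZMod 2)).IsHomogeneous n from g.2).pow 2)
      rw [Finset.card_univ, Fintype.card_fin] at this
      rw [mem_homogeneousSubmodule]
      convert this using 1; ring
    refine ⟨Submodule.Quotient.mk ⟨_, hmem⟩, hL _ _ ?_⟩
    rw [kamekoFun_eq, kameko_varProd_mul_sq, if_pos rfl]
  rw [← finrank_QP, ← finrank_QP, ← LinearMap.finrank_range_add_finrank_ker L,
    LinearMap.range_eq_top.mpr hsurj, finrank_top]

end Duality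

section Vanishing

variable {k : ℕ}

theorem sqTotal_sum_X_pow (i : Fin k) (R : ℕ) :
    SqTotal k (∑ r ∈ Finset.range R, X i ^ 2 ^ r) = X i + X i ^ 2 ^ R := by
  induction R with
  | zero => simp [CharTwo.add_self_eq_zero]
  | succ R ih =>
    rw [Finset.sum_range_succ, map_add, ih, map_pow, sqTotal_X, add_pow_char_pow, ← pow_mul,
      ← pow_succ']
    linear_combination CharTwo.add_self_eq_zero (X i ^ 2 ^ R : MvPolynomial (Fin k) (ZMod 2))

theorem PolyDual.HasDegree.apply_X_pow_mul {f : PolyDual k} {n N : ℕ} (hf : f.HasDegree n)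
    (hN : n < N) (i : Fin k) (q : MvPolynomial (Fin k) (ZMod 2)) : f (X i ^ N * q) = 0 := by
  have : f.comp (LinearMap.mulLeft (ZMod 2) (X i ^ N)) = 0 := by
    refine PolyDual.ext_monomial fun a => ?_
    rw [LinearMap.comp_apply, LinearMap.mulLeft_apply, LinearMap.zero_apply]
    refine hf.apply_eq_zero (((isHomogeneous_X _ i).pow N).mul
      (isHomogeneous_monomial_degree a)) ?_
    omega
  exact LinearMap.congr_fun this q

theorem PolyDual.HasDegree.apply_prod_add_pow {f : PolyDual k} {n N : ℕ} (hf : f.HasDegree n)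
    (hN : n < N) (T : Finset (Fin k)) : ∀ q : MvPolynomial (Fin k) (ZMod 2),
      f ((∏ i ∈ T, (X i + X i ^ N)) * q) = f (varProd T * q) := by
  classical
  induction T using Finset.induction_on with
  | empty => intro q; simp [varProd]
  | insert j T hj ih =>
    intro q
    rw [varProd, Finset.prod_insert hj, Finset.prod_insert hj,
      show (X j + X j ^ N) * (∏ i ∈ T, (X i + X i ^ N)) * q =
        (∏ i ∈ T, (X i + X i ^ N)) * (X j * q) + X j ^ N * ((∏ i ∈ T, (X i + X i ^ N)) * q) by
        ring, map_add, hf.apply_X_pow_mul hN, ih, add_zero, varProd]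
    congr 1; ring

/-- If `|T| + e` is not a sum of `|T|` powers of two, then `psi T` vanishes on invariant
functionals of degree `|T| + 2 * e`. -/
theorem psi_eq_zero_of_not_sum_pow {n e : ℕ} {f : PolyDual k} (hf : f ∈ invDual k n)
    (T : Finset (Fin k)) (hn : n = T.card + 2 * e)
    (hT : ∀ r : Fin k → ℕ, ∑ i ∈ T, 2 ^ r i ≠ T.card + e) : psi T f = 0 := by
  classical
  refine PolyDual.ext_monomial fun a => ?_
  rw [LinearMap.zero_apply]
  by_cases ha : a.degree = e
  swap
  · exact (invDual_degree hf).psi (m := e) (by omega) a ha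
  have h1 : f ((∏ i ∈ T, ∑ r ∈ Finset.range (n + 1), X i ^ 2 ^ r) * monomial a 1) = 0 := by
    rw [Finset.prod_sum, Finset.sum_mul, map_sum]
    refine Finset.sum_eq_zero fun p _ => ?_
    have h2 := IsHomogeneous.prod T.attach
      (fun i => (X i.1 ^ 2 ^ p i.1 i.2 : MvPolynomial (Fin k) (ZMod 2)))
      (fun i => 2 ^ p i.1 i.2) fun i _ => by simpa using (isHomogeneous_X _ i.1).pow _
    refine (invDual_degree hf).apply_eq_zero (h2.mul (isHomogeneous_monomial_degree a)) ?_
    have h3 := hT fun i => if h : i ∈ T then p i h else 0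
    rw [← Finset.sum_attach] at h3
    simp only [Finset.coe_mem, dite_true] at h3
    omega
  rw [← invDual_sq hf, map_mul, map_prod] at h1
  simp only [sqTotal_sum_X_pow] at h1
  rw [(invDual_degree hf).apply_prod_add_pow
    (lt_of_lt_of_le (Nat.lt_succ_self n) Nat.lt_two_pow_self.le)] at h1
  have h4 := apply_sqTotal_monomial_of_vanish_below a
    (f.comp (LinearMap.mulLeft (ZMod 2) (varProd T))) fun b hb =>
      (invDual_degree hf).apply_eq_zero
        ((varProd_isHomogeneous T).mul (isHomogeneous_monomial_degree b)) (by omega)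
  rw [psi_apply]
  exact h4.symm.trans h1

/-- Two invariant functionals with a common derivative in different directions. -/
theorem der_eq_of_der_eq {m : ℕ} {g h : PolyDual k} (hg : g ∈ invDual k m)
    (hh : h ∈ invDual k m) {j l : Fin k} (hjl : der j g = der l h) :
    der j (der j g) = der l (der j g) := by
  have key : ∀ (i : Fin k) (f : PolyDual k), f ∈ invDual k m → ∀ z,
      der i f (SqTotal k z) + der i (der i f) (SqTotal k z) = der i f z := by
    intro i f hf z
    rw [← apply_sqTotal_X_mul, invDual_sq hf, der_apply]
  have h1 : der j (der j g) + der l (der j g) = 0 := by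
    have hd : (der j (der j g) + der l (der j g)).HasDegree (m - 1 - 1) :=
      (((invDual_degree hg).der j).der j).add (((invDual_degree hg).der j).der l)
    refine hd.eq_zero_of_sqTotal fun y => ?_
    have e1 := key j g hg y
    have e2 := key l h hh y
    rw [← hjl] at e2
    rw [LinearMap.add_apply, CharTwo.add_eq_zero]
    exact add_left_cancel (e1.trans e2.symm)
  rwa [add_eq_zero_iff_eq_neg, ZModModule.neg_eq_self] at h1

/-- A functional whose behaviour on multiplication by variables factors through `π`. -/
theorem factor_of_mul {t : ℕ} {c : PolyDual k}
    (π : MvPolynomial (Fin k) (ZMod 2) →ₐ[ZMod 2] MvPolynomial (Fin t) (ZMod 2))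
    (ι : MvPolynomial (Fin t) (ZMod 2) →ₐ[ZMod 2] MvPolynomial (Fin k) (ZMod 2))
    (h : ∀ i w, c (X i * w) = c (ι (π (X i)) * w)) (z : MvPolynomial (Fin k) (ZMod 2)) :
    c z = c (ι (π z)) := by
  have key : ∀ a : Fin k →₀ ℕ, ∀ w, c (monomial a 1 * w) = c (ι (π (monomial a 1)) * w) := by
    intro a
    induction a using expMul_induction with
    | h0 => intro w; simp
    | hs i a ih =>
      intro w
      rw [monomial_single_add, mul_assoc, h, mul_left_comm, ih, map_mul π, map_mul ι]
      congr 1; ring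
  have : c = c.comp (ι.toLinearMap.comp π.toLinearMap) := by
    refine PolyDual.ext_monomial fun a => ?_
    simpa using key a 1
  exact LinearMap.congr_fun this z

end Vanishing

/-- The number of ones in the binary expansion. -/
def binaryWeight (n : ℕ) : ℕ := (Nat.digits 2 n).sum

/-- The degrees obtained from `m` by iterating `n ↦ 2n + c`. -/
def iterDeg (m c : ℕ) : ℕ → ℕ
  | 0 => m
  | d + 1 => 2 * iterDeg m c d + c

theorem iterDeg_add (m c d : ℕ) : iterDeg m c d + c = 2 ^ d * (m + c) := by
  induction d with
  | zero => simp [iterDeg]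
  | succ d ih => rw [iterDeg, pow_succ]; linarith

theorem binaryWeight_two_mul (n : ℕ) : binaryWeight (2 * n) = binaryWeight n := by
  rcases Nat.eq_zero_or_pos n with rfl | hn
  · rfl
  · rw [binaryWeight, Nat.digits_def' (by norm_num) (by omega)]
    simp [binaryWeight]

theorem binaryWeight_two_mul_add_one (n : ℕ) :
    binaryWeight (2 * n + 1) = binaryWeight n + 1 := by
  rw [binaryWeight, Nat.digits_def' (by norm_num) (by omega)]
  simp only [List.sum_cons, binaryWeight]
  rw [show (2 * n + 1) % 2 = 1 by omega, show (2 * n + 1) / 2 = n by omega, add_comm]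

theorem binaryWeight_add_one_le (n : ℕ) : binaryWeight (n + 1) ≤ binaryWeight n + 1 := by
  induction n using Nat.strong_induction_on with
  | _ n ih =>
    obtain ⟨a, rfl | rfl⟩ := Nat.even_or_odd' n
    · rw [binaryWeight_two_mul_add_one, binaryWeight_two_mul]
    · rw [show 2 * a + 1 + 1 = 2 * (a + 1) by ring, binaryWeight_two_mul,
        binaryWeight_two_mul_add_one]
      have := ih a (by omega)
      omega

theorem binaryWeight_add_two_pow_le (u : ℕ) :
    ∀ n, binaryWeight (n + 2 ^ u) ≤ binaryWeight n + 1 := by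
  induction u with
  | zero => exact binaryWeight_add_one_le
  | succ u ih =>
    intro n
    obtain ⟨a, rfl | rfl⟩ := Nat.even_or_odd' n
    · rw [show 2 * a + 2 ^ (u + 1) = 2 * (a + 2 ^ u) by ring, binaryWeight_two_mul,
        binaryWeight_two_mul]
      exact ih a
    · rw [show 2 * a + 1 + 2 ^ (u + 1) = 2 * (a + 2 ^ u) + 1 by ring,
        binaryWeight_two_mul_add_one, binaryWeight_two_mul_add_one]
      have := ih a
      omega

theorem binaryWeight_sum_two_pow_le {ι : Type*} (s : Finset ι) (r : ι → ℕ) :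
    binaryWeight (∑ i ∈ s, 2 ^ r i) ≤ s.card := by
  classical
  induction s using Finset.induction_on with
  | empty => simp [binaryWeight]
  | insert j s hj ih =>
    rw [Finset.sum_insert hj, Finset.card_insert_of_notMem hj, add_comm]
    exact (binaryWeight_add_two_pow_le _ _).trans (by omega)

theorem binaryWeight_two_pow_add (a : ℕ) :
    ∀ y, y < 2 ^ a → binaryWeight (2 ^ a + y) = binaryWeight y + 1 := by
  induction a with
  | zero => intro y hy; obtain rfl : y = 0 := by simpa using hy
            simp [binaryWeight]
  | succ a ih =>
    intro y hy
    rw [pow_succ] at hy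
    obtain ⟨b, rfl | rfl⟩ := Nat.even_or_odd' y
    · rw [show 2 ^ (a + 1) + 2 * b = 2 * (2 ^ a + b) by ring, binaryWeight_two_mul,
        binaryWeight_two_mul, ih b (by omega)]
    · rw [show 2 ^ (a + 1) + (2 * b + 1) = 2 * (2 ^ a + b) + 1 by ring,
        binaryWeight_two_mul_add_one, binaryWeight_two_mul_add_one, ih b (by omega)]

theorem binaryWeight_pos {n : ℕ} (hn : 0 < n) : 0 < binaryWeight n := by
  induction n using Nat.strong_induction_on with
  | _ n ih =>
    obtain ⟨a, rfl | rfl⟩ := Nat.even_or_odd' n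
    · rw [binaryWeight_two_mul]; exact ih a (by omega) (by omega)
    · rw [binaryWeight_two_mul_add_one]; omega

theorem binaryWeight_sum_two_pow_add {b ρ : ℕ} (hρ : ρ < 2 ^ b) (E : Finset ℕ)
    (hE : ∀ e ∈ E, b ≤ e) :
    binaryWeight (∑ e ∈ E, 2 ^ e + ρ) = E.card + binaryWeight ρ := by
  suffices h : binaryWeight (∑ e ∈ E, 2 ^ e + ρ) = E.card + binaryWeight ρ ∧
      ∀ a, b ≤ a → (∀ e ∈ E, e < a) → ∑ e ∈ E, 2 ^ e + ρ < 2 ^ a from h.1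
  induction E using Finset.induction_on_max with
  | empty =>
    refine ⟨by simp, fun a ha _ => ?_⟩
    simpa using hρ.trans_le (Nat.pow_le_pow_right (by norm_num) ha)
  | insert e s hs ih =>
    have he : e ∉ s := fun h => lt_irrefl _ (hs e h)
    obtain ⟨ih1, ih2⟩ := ih fun x hx => hE x (Finset.mem_insert_of_mem hx)
    have hlt := ih2 e (hE e (Finset.mem_insert_self _ _)) hs
    rw [Finset.sum_insert he, Finset.card_insert_of_notMem he, add_assoc]
    refine ⟨by rw [binaryWeight_two_pow_add _ _ hlt, ih1]; ring, fun a _ h => ?_⟩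
    have h1 : 2 ^ (e + 1) ≤ 2 ^ a :=
      Nat.pow_le_pow_right (by norm_num) (h e (Finset.mem_insert_self _ _))
    rw [pow_succ] at h1
    omega

section

variable {k : ℕ}

theorem psi_eq_zero_of_binaryWeight {n : ℕ} {f : PolyDual k} (hf : f ∈ invDual k n)
    (T : Finset (Fin k)) (hT : T.card < binaryWeight (n + T.card) ∨ Odd (n + T.card)) :
    psi T f = 0 := by
  by_cases h : ∃ e, n = T.card + 2 * e
  · obtain ⟨e, he⟩ := h
    rw [show n + T.card = 2 * (T.card + e) by omega, binaryWeight_two_mul] at hT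
    rcases hT with hT | hT
    · refine psi_eq_zero_of_not_sum_pow hf T he fun r hr => ?_
      have := binaryWeight_sum_two_pow_le T r
      rw [hr] at this
      omega
    · exact absurd (even_two_mul _) (Nat.not_even_iff_odd.mpr hT)
  · exact (invDual_degree hf).psi_eq_zero fun e he => h ⟨e, he⟩

theorem psi_eq_zero_of_sum_two_pow {m t s : ℕ} (hs : 1 ≤ s) (E : Finset ℕ)
    (hE : ∀ e ∈ E, 1 ≤ e ∧ t ≤ 2 ^ e) (hcard : E.card + 2 = t)
    (hm : m + t = ∑ e ∈ E, 2 ^ e + 2) {f : PolyDual k} (hf : f ∈ invDual k (iterDeg m t s))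
    (T : Finset (Fin k)) (hT : T.card < t) : psi T f = 0 := by
  apply psi_eq_zero_of_binaryWeight hf T
  have h1 := iterDeg_add m t s
  rw [hm, mul_add, Finset.mul_sum] at h1
  simp_rw [← pow_add] at h1
  have hsum : ∑ e ∈ E, 2 ^ (s + e) = ∑ e ∈ E.image (s + ·), 2 ^ e := by
    rw [Finset.sum_image]; simp
  have h2s : 2 ≤ 2 ^ s := by
    calc 2 = 2 ^ 1 := rfl
      _ ≤ 2 ^ s := Nat.pow_le_pow_right (by norm_num) hs
  obtain ⟨c, hc⟩ : ∃ c, T.card + c = t := ⟨t - T.card, by omega⟩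
  rcases (by omega : c = 1 ∨ c = 2 ∨ 3 ≤ c) with rfl | rfl | h3
  · right
    have : Even (∑ e ∈ E, 2 ^ (s + e) + 2 ^ s * 2) := by
      refine Even.add (Finset.even_sum _ fun e _ => ?_) (even_two.mul_left _)
      exact (Nat.even_pow.mpr ⟨even_two, by omega⟩)
    rw [← h1, ← hc, ← add_assoc] at this
    rw [hc] at this
    rw [Nat.even_add_one, Nat.not_even_iff_odd] at this
    exact this
  · left
    have h4 : iterDeg m t s + T.card = ∑ e ∈ E.image (s + ·), 2 ^ e + (2 ^ s * 2 - 2) := by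
      rw [← hsum]; omega
    rw [h4, binaryWeight_sum_two_pow_add (b := s + 1), Finset.card_image_of_injective]
    · have := binaryWeight_pos (n := 2 ^ s * 2 - 2) (by omega)
      omega
    · exact add_right_injective s
    · rw [pow_succ]; omega
    · intro e he
      obtain ⟨e', he', rfl⟩ := Finset.mem_image.mp he
      have := (hE e' he').1
      omega
  · left
    have hne : E.Nonempty := Finset.card_pos.mp (by omega)
    set e0 := E.min' hne with he0
    have hmem : e0 ∈ E := Finset.min'_mem E hne
    rw [← Finset.sum_erase_add E _ hmem] at h1
    have hsum' : ∑ e ∈ E.erase e0, 2 ^ (s + e) = ∑ e ∈ (E.erase e0).image (s + ·), 2 ^ e := by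
      rw [Finset.sum_image]; simp
    have h5 : 2 ^ s * t ≤ 2 ^ (s + e0) := by
      rw [pow_add]; exact Nat.mul_le_mul_left _ (hE e0 hmem).2
    have h6 : 2 * t ≤ 2 ^ s * t := Nat.mul_le_mul_right _ h2s
    have h7 : 2 ^ s * 2 ≤ 2 ^ (s + e0) := by
      rw [pow_add]; refine Nat.mul_le_mul_left _ ?_
      calc 2 = 2 ^ 1 := rfl
        _ ≤ 2 ^ e0 := Nat.pow_le_pow_right (by norm_num) (hE e0 hmem).1
    have h4 : iterDeg m t s + T.card =
        ∑ e ∈ (E.erase e0).image (s + ·), 2 ^ e + (2 ^ (s + e0) + 2 ^ s * 2 - c) := by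
      rw [← hsum']; omega
    rw [h4, binaryWeight_sum_two_pow_add (b := s + e0 + 1), Finset.card_image_of_injective,
      Finset.card_erase_of_mem hmem]
    · have := binaryWeight_pos (n := 2 ^ (s + e0) + 2 ^ s * 2 - c) (by omega)
      omega
    · exact add_right_injective s
    · rw [pow_succ]; omega
    · intro e he
      obtain ⟨e', he', rfl⟩ := Finset.mem_image.mp he
      rw [Finset.mem_erase] at he'
      have h8 := Finset.min'_le E e' he'.2
      rw [← he0] at h8
      have := he'.1
      change s + e0 + 1 ≤ s + e'
      omega

theorem psi_eq_zero_of_iterDeg_one {m s : ℕ} (hs : 1 ≤ s) {f : PolyDual k}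
    (hf : f ∈ invDual k (iterDeg m 1 s)) (T : Finset (Fin k)) (hT : T.card < 1) :
    psi T f = 0 := by
  apply psi_eq_zero_of_binaryWeight hf T
  right
  obtain ⟨s, rfl⟩ : ∃ s', s = s' + 1 := ⟨s - 1, by omega⟩
  rw [iterDeg]
  exact ⟨iterDeg m 1 s, by omega⟩

end

section Words

variable {I V : Type*} [AddCommGroup V] [Module (ZMod 2) V]

/-- The composite of the operators `ψ i` along a list of indices. -/
def opWord (ψ : I → V →ₗ[ZMod 2] V) : List I → V →ₗ[ZMod 2] V
  | [] => LinearMap.id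
  | i :: l => (ψ i).comp (opWord ψ l)

variable {ψ : I → V →ₗ[ZMod 2] V} {K : ℕ → Submodule (ZMod 2) V}

theorem opWord_nil (f : V) : opWord ψ [] f = f := rfl

theorem opWord_cons (i : I) (l : List I) (f : V) :
    opWord ψ (i :: l) f = ψ i (opWord ψ l f) := rfl

theorem opWord_append (l l' : List I) (f : V) :
    opWord ψ (l ++ l') f = opWord ψ l (opWord ψ l' f) := by
  induction l with
  | nil => rfl
  | cons i l ih => rw [List.cons_append, opWord_cons, ih, opWord_cons]

theorem opWord_mem (hmap : ∀ i d f, f ∈ K (d + 1) → ψ i f ∈ K d) (l : List I) :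
    ∀ {e : ℕ} {f : V}, f ∈ K (l.length + e) → opWord ψ l f ∈ K e := by
  induction l with
  | nil => intro e f hf; simpa [opWord_nil] using hf
  | cons i l ih =>
    intro e f hf
    refine hmap i e _ (ih ?_)
    rw [List.length_cons] at hf
    rwa [show l.length + (e + 1) = l.length + 1 + e by ring]

theorem opWord_perm (hmap : ∀ i d f, f ∈ K (d + 1) → ψ i f ∈ K d)
    (hcomm : ∀ i j d f, f ∈ K (d + 2) → ψ i (ψ j f) = ψ j (ψ i f)) {l l' : List I}
    (h : l.Perm l') : ∀ {e : ℕ} {f : V}, f ∈ K (l.length + e) → opWord ψ l f = opWord ψ l' f := by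
  induction h with
  | nil => intro e f _; rfl
  | @cons x l l' _ ih =>
    intro e f hf
    rw [opWord_cons, opWord_cons, ih (e := e + 1)]
    rw [List.length_cons] at hf
    rwa [show l.length + (e + 1) = l.length + 1 + e by ring]
  | swap x y l =>
    intro e f hf
    simp only [opWord_cons]
    refine hcomm _ _ e _ (opWord_mem hmap l ?_)
    simp only [List.length_cons] at hf
    rwa [show l.length + (e + 2) = l.length + 1 + 1 + e by ring]
  | trans h1 _ ih1 ih2 =>
    intro e f hf
    rw [ih1 hf, ih2 (e := e)]
    rwa [← h1.length_eq]

variable [DecidableEq I]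

theorem eq_normalForm {W : Type*} {F : List I → W} {D : ℕ}
    (hperm : ∀ l l' : List I, l.length = D → l.Perm l' → F l = F l')
    (hcub : ∀ i j (l : List I), l.length + 3 = D → F (i :: i :: j :: l) = F (i :: j :: j :: l))
    (x : I) (n : ℕ) : ∀ l : List I, l.length = D → D - l.count x = n → x ∈ l →
      F l = F (l.toFinset.toList ++ List.replicate (D - l.toFinset.card) x) := by
  induction n using Nat.strong_induction_on with
  | _ n ih =>
    intro l hl hn hx
    by_cases h : ∃ j, j ≠ x ∧ 2 ≤ l.count j
    · obtain ⟨j, hjx, hj⟩ := h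
      have h1 : j ∈ l := List.count_pos_iff.mp (by omega)
      have h2 : j ∈ l.erase j := by
        rw [← List.count_pos_iff, List.count_erase_self]; omega
      have h3 : x ∈ (l.erase j).erase j := by
        rw [List.mem_erase_of_ne hjx.symm, List.mem_erase_of_ne hjx.symm]; exact hx
      have hp : l.Perm (j :: j :: x :: (((l.erase j).erase j).erase x)) :=
        (List.perm_cons_erase h1).trans
          (((List.perm_cons_erase h2).trans ((List.perm_cons_erase h3).cons j)).cons j)
      set l3 := ((l.erase j).erase j).erase x
      have hlen := hp.length_eq
      simp only [List.length_cons] at hlen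
      have hS : (j :: x :: x :: l3).toFinset = l.toFinset := by
        rw [List.toFinset_eq_of_perm _ _ hp]
        ext y; simp
      have hcnt : (j :: x :: x :: l3).count x = l.count x + 1 := by
        rw [hp.count_eq]
        simp [hjx]
      have hle : (j :: x :: x :: l3).count x ≤ D := by
        have := List.count_le_length (a := x) (l := j :: x :: x :: l3)
        simp only [List.length_cons] at this
        omega
      rw [hperm l _ hl hp, hcub j x l3 (by omega), ← hS]
      refine ih (D - (j :: x :: x :: l3).count x) (by omega) _ ?_ rfl (by simp)
      simp; omega
    · push Not at h
      apply hperm l _ hl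
      rw [List.perm_iff_count]
      intro a
      have hc : ∀ j, j ≠ x → l.count j = if j ∈ l then 1 else 0 := by
        intro j hj
        split_ifs with hjl
        · have := List.count_pos_iff.mpr hjl
          have := h j hj
          omega
        · exact List.count_eq_zero.mpr hjl
      have hnod : l.toFinset.toList.count a = if a ∈ l then 1 else 0 := by
        split_ifs with hal
        · exact List.count_eq_one_of_mem (Finset.nodup_toList _) (by simpa using hal)
        · exact List.count_eq_zero.mpr (by simpa using hal)
      rw [List.count_append, hnod, List.count_replicate]
      by_cases hax : a = x
      · subst hax
        have h4 := List.sum_toFinset_count_eq_length l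
        have hmem : a ∈ l.toFinset := by simpa using hx
        rw [← Finset.add_sum_erase _ _ hmem] at h4
        have h5 : ∑ y ∈ l.toFinset.erase a, l.count y = (l.toFinset.erase a).card := by
          rw [Finset.card_eq_sum_ones]
          refine Finset.sum_congr rfl fun y hy => ?_
          rw [Finset.mem_erase, List.mem_toFinset] at hy
          rw [hc y hy.1, if_pos hy.2]
        rw [h5, Finset.card_erase_of_mem hmem] at h4
        have := Finset.card_pos.mpr ⟨a, hmem⟩
        rw [if_pos hx]
        simp only [beq_self_eq_true, if_true]
        have := List.count_pos_iff.mpr hx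
        omega
      · rw [hc a hax]
        simp [Ne.symm hax]

theorem exists_family {W : Type*} [Zero W] (F : List I → W) (D : ℕ)
    (hperm : ∀ l l' : List I, l.length = D → l.Perm l' → F l = F l')
    (hcub : ∀ i j (l : List I), l.length + 3 = D → F (i :: i :: j :: l) = F (i :: j :: j :: l)) :
    ∃ a : Finset I → W, (∀ l, l.length = D → F l = a l.toFinset) ∧
      ∀ S, (∀ l : List I, l.length = D → l.toFinset ≠ S) → a S = 0 := by
  classical
  refine ⟨fun S => if h : ∃ l : List I, l.length = D ∧ l.toFinset = S then F h.choose else 0,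
    fun l hl => ?_, fun S hS => ?_⟩
  · have h : ∃ l' : List I, l'.length = D ∧ l'.toFinset = l.toFinset := ⟨l, hl, rfl⟩
    simp only [dif_pos h]
    obtain ⟨h1, h2⟩ := h.choose_spec
    set l' := h.choose
    rcases l with _ | ⟨x, l⟩
    · have : l' = [] := by rw [← List.length_eq_zero_iff, h1, ← hl]; rfl
      rw [this]
    · have hx' : x ∈ l' := by
        rw [← List.mem_toFinset, h2]; simp
      rw [eq_normalForm hperm hcub x _ _ hl rfl (by simp),
        eq_normalForm hperm hcub x _ _ h1 rfl hx', h2]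
  · refine dif_neg ?_
    rintro ⟨l, hl, h⟩
    exact hS l hl h

theorem exists_list_toFinset {S : Finset I} (hS : S.Nonempty) {D : ℕ} (hD : S.card ≤ D) :
    ∃ l : List I, l.length = D ∧ l.toFinset = S := by
  obtain ⟨x, hx⟩ := hS
  refine ⟨S.toList ++ List.replicate (D - S.card) x, by simp; omega, ?_⟩
  ext y
  simp only [List.toFinset_append, Finset.toList_toFinset, Finset.mem_union, List.mem_toFinset,
    List.mem_replicate]
  constructor
  · rintro (h | ⟨_, rfl⟩) <;> assumption
  · exact Or.inl

variable [Fintype I]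

/-- The sum of a family over all supersets. -/
def upSum (a : Finset I → V) (v : Finset I) : V :=
  ∑ S ∈ Finset.univ.filter (v ⊆ ·), a S

theorem upSum_upSum (a : Finset I → V) (S : Finset I) : upSum (upSum a) S = a S := by
  unfold upSum
  have h1 : ∀ v T : Finset I, (T ∈ Finset.univ.filter (v ⊆ ·)) ↔ v ⊆ T := by simp
  rw [Finset.sum_comm' (t' := Finset.univ.filter (S ⊆ ·)) (s' := fun T => Finset.Icc S T)]
  · simp_rw [Finset.sum_const]
    rw [Finset.sum_eq_single_of_mem S (by simp)]
    · simp
    · intro T hT hne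
      have hST : S ⊆ T := by simpa using hT
      rw [Finset.card_Icc_finset hST]
      have : 0 < T.card - S.card := by
        have := Finset.card_lt_card (hST.ssubset_of_ne hne.symm)
        omega
      obtain ⟨b, hb⟩ : ∃ b, T.card - S.card = b + 1 := ⟨_, (Nat.succ_pred_eq_of_pos this).symm⟩
      rw [hb, pow_succ, mul_comm, mul_nsmul, two_nsmul, ZModModule.add_self]
      simp
  · intro v T
    simp only [Finset.mem_filter, Finset.mem_univ, true_and, Finset.mem_Icc]
    exact ⟨fun ⟨h1, h2⟩ => ⟨⟨h1, h2⟩, h1.trans h2⟩, fun ⟨h, _⟩ => h⟩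

theorem sum_insert_superset_eq_zero (a : Finset I → V) {v : Finset I} {i : I} (hi : i ∉ v) :
    ∑ S ∈ Finset.univ.filter (v ⊆ ·), a (insert i S) = 0 := by
  refine Finset.sum_involution (fun S _ => if i ∈ S then S.erase i else insert i S) ?_ ?_ ?_ ?_
  · intro S _
    split_ifs with h
    · rw [Finset.insert_erase h, Finset.insert_eq_of_mem h, ZModModule.add_self]
    · rw [Finset.insert_idem, ZModModule.add_self]
  · intro S _ _
    split_ifs with h
    · intro h'; rw [← h'] at h; simp at h
    · intro h'; apply h; rw [← h']; simp
  · intro S hS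
    simp only [Finset.mem_filter, Finset.mem_univ, true_and] at hS ⊢
    split_ifs with h
    · exact Finset.subset_erase.mpr ⟨hS, hi⟩
    · exact hS.trans (Finset.subset_insert _ _)
  · intro S _
    by_cases h : i ∈ S <;> simp [h]

theorem sum_insert_superset (a : Finset I → V) (D : I → V →ₗ[ZMod 2] V) (v : Finset I) :
    ∑ S ∈ Finset.univ.filter (v ⊆ ·), ∑ i, D i (a (insert i S)) =
      ∑ i ∈ v, D i (upSum a v) := by
  rw [Finset.sum_comm]
  simp_rw [← map_sum]
  rw [← Finset.sum_subset (Finset.subset_univ v)]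
  · refine Finset.sum_congr rfl fun i hi => ?_
    congr 1
    refine Finset.sum_congr rfl fun S hS => ?_
    rw [Finset.insert_eq_of_mem]
    simp only [Finset.mem_filter] at hS
    exact hS.2 hi
  · intro i _ hi
    rw [sum_insert_superset_eq_zero a hi, map_zero]

end Words

/-- The linear substitution sending `x_i` to the sum of the variables indexed by `s i`. -/
noncomputable def linSub {k t : ℕ} (s : Fin k → Finset (Fin t)) :
    MvPolynomial (Fin k) (ZMod 2) →ₐ[ZMod 2] MvPolynomial (Fin t) (ZMod 2) :=
  aeval fun i => ∑ j ∈ s i, X j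

section Substitution

variable {k t : ℕ}

theorem linSub_X (s : Fin k → Finset (Fin t)) (i : Fin k) :
    linSub s (X i) = ∑ j ∈ s i, X j := by
  simp [linSub]

theorem linSub_sqTotal (s : Fin k → Finset (Fin t)) (z : MvPolynomial (Fin k) (ZMod 2)) :
    linSub s (SqTotal k z) = SqTotal t (linSub s z) := by
  have : (linSub s).comp (SqTotal k) = (SqTotal t).comp (linSub s) := by
    refine algHom_ext fun i => ?_
    simp only [AlgHom.comp_apply]
    rw [sqTotal_X, map_add, map_pow, linSub_X, map_sum]
    simp only [sqTotal_X]
    rw [Finset.sum_add_distrib, CharTwo.sum_sq]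
  exact DFunLike.congr_fun this z

theorem linSub_monomial_isHomogeneous (s : Fin k → Finset (Fin t)) (a : Fin k →₀ ℕ) :
    (linSub s (monomial a 1)).IsHomogeneous a.degree := by
  induction a using expMul_induction with
  | h0 => simpa using isHomogeneous_one _ _
  | hs i a ih =>
    rw [monomial_single_add, map_mul, linSub_X, map_add, Finsupp.degree_single]
    exact (IsHomogeneous.sum _ _ _ fun j _ => isHomogeneous_X _ j).mul ih

theorem comp_linSub_mem {m : ℕ} {h : PolyDual t} (hh : h ∈ invDual t m)
    (s : Fin k → Finset (Fin t)) : h.comp (linSub s).toLinearMap ∈ invDual k m := by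
  refine ⟨fun z => ?_, fun a ha => ?_⟩
  · simp only [LinearMap.comp_apply, AlgHom.toLinearMap_apply, linSub_sqTotal, invDual_sq hh]
  · exact (invDual_degree hh).apply_eq_zero (linSub_monomial_isHomogeneous s a) ha

theorem psi_comp_kameko_linSub (T : Finset (Fin k)) (h : PolyDual t)
    (s : Fin k → Finset (Fin t)) (b : Prop) [Decidable b]
    (hb : kameko t (linSub s (varProd T)) = if b then 1 else 0) :
    psi T ((h.comp (kameko t)).comp (linSub s).toLinearMap) =
      if b then h.comp (linSub s).toLinearMap else 0 := by
  refine LinearMap.ext fun y => ?_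
  rw [psi_apply, LinearMap.comp_apply, LinearMap.comp_apply, AlgHom.toLinearMap_apply, map_mul,
    map_pow, kameko_mul_sq, hb]
  split_ifs <;> simp

theorem kameko_pow_comp_mem {n : ℕ} {h : PolyDual k} (hh : h ∈ invDual k n) (D : ℕ) :
    h.comp (kameko k ^ D) ∈ invDual k (iterDeg n k D) := by
  induction D with
  | zero => exact hh
  | succ D ih => exact comp_kameko_mem ih

theorem varProd_insert {T : Finset (Fin k)} {i : Fin k} (hi : i ∉ T) :
    X i * varProd T = varProd (insert i T) := by
  rw [varProd, varProd, Finset.prod_insert hi]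

theorem X_mul_varProd_of_mem {T : Finset (Fin k)} {i : Fin k} (hi : i ∈ T) :
    X i * varProd T = varProd (T.erase i) * X i ^ 2 := by
  rw [varProd, ← Finset.mul_prod_erase T _ hi, ← varProd]
  ring

theorem der_apply_varProd_of_mem {T : Finset (Fin k)} {i : Fin k} (hi : i ∈ T)
    (g : PolyDual k) (y : MvPolynomial (Fin k) (ZMod 2)) :
    der i g (varProd T * y ^ 2) = der i (psi (T.erase i) g) y := by
  rw [der_apply, der_apply, psi_apply, ← mul_assoc, X_mul_varProd_of_mem hi]
  congr 1; ring

theorem der_apply_varProd_of_notMem {T : Finset (Fin k)} {i : Fin k} (hi : i ∉ T)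
    (g : PolyDual k) (y : MvPolynomial (Fin k) (ZMod 2)) :
    der i g (varProd T * y ^ 2) = psi (insert i T) g y := by
  rw [der_apply, psi_apply, ← mul_assoc, varProd_insert hi]

/-- A closed family of functionals is a family of derivatives. -/
theorem exists_der_eq (b : Fin k → PolyDual k) (hb : ∀ i j, der i (b j) = der j (b i)) :
    ∃ A : PolyDual k, A 1 = 0 ∧ ∀ i, der i A = b i := by
  classical
  let A : PolyDual k := (basisMonomials (Fin k) (ZMod 2)).constr (ZMod 2) fun a =>
    if h : a.support.Nonempty then b h.choose (monomial (a - Finsupp.single h.choose 1) 1) else 0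
  have hA : ∀ a, A (monomial a 1) = if h : a.support.Nonempty then
      b h.choose (monomial (a - Finsupp.single h.choose 1) 1) else 0 := by
    intro a
    have h : (monomial a 1 : MvPolynomial (Fin k) (ZMod 2)) =
        basisMonomials (Fin k) (ZMod 2) a := by
      rw [coe_basisMonomials]
    rw [h]
    exact Module.Basis.constr_basis _ _ _ _
  refine ⟨A, ?_, fun l => PolyDual.ext_monomial fun a => ?_⟩
  · have := hA 0
    rw [dif_neg (by simp)] at this
    simpa using this
  · rw [der_apply, ← monomial_single_add, hA]
    have hne : (Finsupp.single l 1 + a).support.Nonempty :=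
      ⟨l, by rw [Finsupp.mem_support_iff]; simp⟩
    rw [dif_pos hne]
    have hmem := hne.choose_spec
    generalize hne.choose = i at hmem ⊢
    by_cases hil : i = l
    · rw [hil]
      congr 2
      ext j; simp
    · have hai : a i ≠ 0 := by
        rw [Finsupp.mem_support_iff, Finsupp.add_apply, Finsupp.single_apply,
          if_neg (Ne.symm hil)] at hmem
        simpa using hmem
      obtain ⟨c, rfl⟩ : ∃ c, a = Finsupp.single i 1 + c := by
        refine ⟨a - Finsupp.single i 1, ?_⟩
        rw [add_comm, tsub_add_cancel_of_le]
        rw [Finsupp.single_le_iff]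
        omega
      have e1 : Finsupp.single l 1 + (Finsupp.single i 1 + c) - Finsupp.single i 1 =
          Finsupp.single l 1 + c := by
        rw [add_left_comm, add_tsub_cancel_left]
      rw [e1, monomial_single_add, monomial_single_add, ← der_apply, ← der_apply, hb]

theorem PolyDual.eq_zero_of_der {f : PolyDual k} {m : ℕ} (hf : f.HasDegree m) (hm : 0 < m)
    (h : ∀ i, der i f = 0) : f = 0 := by
  refine PolyDual.ext_monomial fun a => ?_
  induction a using expMul_induction with
  | h0 => rw [hf 0 (by simp; omega)]; rfl
  | hs i a _ => rw [monomial_single_add, ← der_apply, h]; rfl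

end Substitution

/-- Vanishing of `psi T` for all `|T| < t` on the invariant functionals in `t + 1` variables of
degrees `iterDeg m t s`. -/
def SmallVanish (t m : ℕ) : Prop :=
  ∀ s, 1 ≤ s → ∀ f ∈ invDual (t + 1) (iterDeg m t s), ∀ T : Finset (Fin (t + 1)),
    T.card < t → psi T f = 0

/-- The operator `psi` of the complement of `i`. -/
noncomputable def coPsi {t : ℕ} (i : Fin (t + 1)) : PolyDual (t + 1) →ₗ[ZMod 2] PolyDual (t + 1) :=
  psi (Finset.univ.erase i)

section CoPsi

variable {t m : ℕ}

theorem card_univ_erase (i : Fin (t + 1)) : (Finset.univ.erase i).card = t := by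
  rw [Finset.card_erase_of_mem (Finset.mem_univ i)]; simp

theorem coPsi_mem (hv : SmallVanish t m) (i : Fin (t + 1)) (d : ℕ) (f : PolyDual (t + 1))
    (hf : f ∈ invDual (t + 1) (iterDeg m t (d + 1))) :
    coPsi i f ∈ invDual (t + 1) (iterDeg m t d) := by
  refine psi_mem hf ?_ fun U hU => hv (d + 1) (by omega) f hf U ?_
  · intro e he
    rw [card_univ_erase, iterDeg] at he
    omega
  · have := Finset.card_lt_card hU
    rwa [card_univ_erase] at this

theorem psi_univ_eq_zero {d : ℕ} {f : PolyDual (t + 1)}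
    (hf : f ∈ invDual (t + 1) (iterDeg m t (d + 1))) : psi Finset.univ f = 0 := by
  refine (invDual_degree hf).psi_eq_zero fun e he => ?_
  rw [iterDeg, Finset.card_univ, Fintype.card_fin] at he
  omega

theorem sum_der_coPsi (hv : SmallVanish t m) {d : ℕ} {f : PolyDual (t + 1)}
    (hf : f ∈ invDual (t + 1) (iterDeg m t (d + 1))) : ∑ i, der i (coPsi i f) = 0 := by
  have hdeg : (∑ i, der i (coPsi i f)).HasDegree (iterDeg m t d - 1) :=
    PolyDual.HasDegree.sum fun i _ => (invDual_degree (coPsi_mem hv i d f hf)).der i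
  refine hdeg.eq_zero_of_sqTotal fun y => ?_
  have h1 := psi_star hf Finset.univ y
  rw [psi_univ_eq_zero hf, LinearMap.zero_apply,
    ← Finset.sum_subset (s₁ := Finset.univ.image fun i : Fin (t + 1) => {i})] at h1
  · rw [Finset.sum_image (fun i _ j _ h => Finset.singleton_injective h)] at h1
    rw [LinearMap.sum_apply]
    refine Eq.trans (Finset.sum_congr rfl fun i _ => ?_) h1
    rw [der_apply, coPsi, Finset.sdiff_singleton_eq_erase, varProd, Finset.prod_singleton]
  · intro U _; simp
  · intro U _ hU
    have h2 : U.card ≠ 1 := by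
      intro h
      obtain ⟨i, rfl⟩ := Finset.card_eq_one.mp h
      exact hU (Finset.mem_image_of_mem _ (Finset.mem_univ i))
    rcases Nat.eq_zero_or_pos U.card with h0 | h0
    · rw [Finset.card_eq_zero.mp h0, Finset.sdiff_empty, psi_univ_eq_zero hf]; rfl
    · rw [hv (d + 1) (by omega) f hf, LinearMap.zero_apply]
      have h3 := Finset.card_sdiff_add_card_eq_card (Finset.subset_univ U)
      simp only [Finset.card_univ, Fintype.card_fin] at h3
      omega

theorem coPsi_add_coPsi (hv : SmallVanish t m) {d : ℕ} {G : Fin (t + 1) → PolyDual (t + 1)}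
    (hG : ∀ i, G i ∈ invDual (t + 1) (iterDeg m t (d + 1))) (h : ∑ i, der i (G i) = 0)
    (j l : Fin (t + 1)) : coPsi l (G j) = coPsi j (G l) := by
  by_cases hjl : j = l
  · rw [hjl]
  rw [← sub_eq_zero, ZModModule.sub_eq_add]
  refine LinearMap.ext fun y => ?_
  set T := (Finset.univ.erase l).erase j with hT
  have hcard : T.card + 1 = t := by
    have := Finset.card_erase_add_one (s := Finset.univ.erase l) (a := j) (by simp [hjl])
    rwa [card_univ_erase] at this
  have hj : insert j T = Finset.univ.erase l := Finset.insert_erase (by simp [hjl])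
  have hl : insert l T = Finset.univ.erase j := by
    rw [hT, Finset.erase_right_comm, Finset.insert_erase (by simp [Ne.symm hjl])]
  have h1 := LinearMap.congr_fun h (varProd T * y ^ 2)
  rw [LinearMap.sum_apply, Finset.sum_eq_add j l hjl] at h1
  · rw [der_apply_varProd_of_notMem (by simp [hT]), der_apply_varProd_of_notMem (by simp [hT]),
      hj, hl] at h1
    exact h1
  · intro c _ hc
    have hcT : c ∈ T := by simp [hT, hc]
    rw [der_apply_varProd_of_mem hcT, hv (d + 1) (by omega) _ (hG c)]
    · simp
    · rw [Finset.card_erase_of_mem hcT]; omega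
  · simp
  · simp

theorem sum_der_coPsi_of_sum_der {G : Fin (t + 1) → PolyDual (t + 1)}
    (h : ∑ i, der i (G i) = 0) : ∑ i, der i (coPsi i (G i)) = 0 := by
  refine LinearMap.ext fun y => ?_
  have h1 := LinearMap.congr_fun h (varProd Finset.univ * y ^ 2)
  rw [LinearMap.sum_apply] at h1 ⊢
  refine Eq.trans (Finset.sum_congr rfl fun i _ => ?_) h1
  rw [der_apply_varProd_of_mem (Finset.mem_univ i), coPsi]

theorem coPsi_comm (hv : SmallVanish t m) (i j : Fin (t + 1)) (d : ℕ) (f : PolyDual (t + 1))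
    (hf : f ∈ invDual (t + 1) (iterDeg m t (d + 2))) :
    coPsi i (coPsi j f) = coPsi j (coPsi i f) :=
  coPsi_add_coPsi hv (fun i => coPsi_mem hv i (d + 1) f hf) (sum_der_coPsi hv hf) j i

theorem coPsi_cubic (hv : SmallVanish t m) (i j : Fin (t + 1)) (d : ℕ) (f : PolyDual (t + 1))
    (hf : f ∈ invDual (t + 1) (iterDeg m t (d + 3))) :
    coPsi i (coPsi i (coPsi j f)) = coPsi i (coPsi j (coPsi j f)) := by
  have h1 := coPsi_add_coPsi hv (G := fun i => coPsi i (coPsi i f))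
    (fun i => coPsi_mem hv i (d + 1) _ (coPsi_mem hv i (d + 2) f hf))
    (sum_der_coPsi_of_sum_der (sum_der_coPsi hv hf)) j i
  rw [h1, coPsi_comm hv i j (d + 1) f hf,
    coPsi_comm hv i j d _ (coPsi_mem hv i (d + 2) f hf)]

theorem sum_der_opWord_replicate (hv : SmallVanish t m) {d : ℕ} {f : PolyDual (t + 1)}
    (hf : f ∈ invDual (t + 1) (iterDeg m t (d + 1))) (s : ℕ) :
    ∑ i, der i (opWord coPsi (List.replicate (s + 1) i) f) = 0 := by
  induction s with
  | zero => exact sum_der_coPsi hv hf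
  | succ s ih => exact sum_der_coPsi_of_sum_der ih

theorem eq_zero_of_coPsi (hv : SmallVanish t m) {d : ℕ} {f : PolyDual (t + 1)}
    (hf : f ∈ invDual (t + 1) (iterDeg m t (d + 1))) (h : ∀ i, coPsi i f = 0) : f = 0 := by
  refine PolyDual.ext_psi fun T => ?_
  rw [map_zero]
  rcases lt_trichotomy T.card t with hT | hT | hT
  · exact hv (d + 1) (by omega) f hf T hT
  · have h1 : Tᶜ.card = 1 := by rw [Finset.card_compl, Fintype.card_fin]; omega
    obtain ⟨i, hi⟩ := Finset.card_eq_one.mp h1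
    have h2 : T = Finset.univ.erase i := by
      rw [← compl_compl T, hi, Finset.compl_singleton]
    rw [h2]; exact h i
  · have h1 : T = Finset.univ := by
      rw [← Finset.card_eq_iff_eq_univ, Fintype.card_fin]
      have := Finset.card_le_univ T
      rw [Fintype.card_fin] at this
      omega
    rw [h1]; exact psi_univ_eq_zero hf

theorem eq_zero_of_opWord_coPsi (hv : SmallVanish t m) (D : ℕ) : ∀ f : PolyDual (t + 1),
    f ∈ invDual (t + 1) (iterDeg m t D) →
    (∀ l : List (Fin (t + 1)), l.length = D → opWord coPsi l f = 0) → f = 0 := by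
  induction D with
  | zero => intro f _ h; exact h [] rfl
  | succ D ih =>
    intro f hf h
    refine eq_zero_of_coPsi hv hf fun i => ih _ (coPsi_mem hv i D f hf) fun l hl => ?_
    have := h (l ++ [i]) (by simp [hl])
    rwa [opWord_append] at this

/-- The family of length-`D` words of an invariant functional. -/
theorem exists_coPsi_family (hv : SmallVanish t m) {D : ℕ} (hD : 1 ≤ D) {f : PolyDual (t + 1)}
    (hf : f ∈ invDual (t + 1) (iterDeg m t D)) :
    ∃ a : Finset (Fin (t + 1)) → PolyDual (t + 1),
      (∀ l : List (Fin (t + 1)), l.length = D → opWord coPsi l f = a l.toFinset) ∧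
      (∀ S : Finset (Fin (t + 1)), D < S.card → a S = 0) ∧
      (∀ S, a S ∈ invDual (t + 1) m) ∧
      ∀ S : Finset (Fin (t + 1)), S.card + 1 ≤ D → ∑ i, der i (a (insert i S)) = 0 := by
  let K : ℕ → Submodule (ZMod 2) (PolyDual (t + 1)) := fun d => invDual (t + 1) (iterDeg m t d)
  have hmap : ∀ i d f, f ∈ K (d + 1) → coPsi i f ∈ K d := fun i d f hf => coPsi_mem hv i d f hf
  have hcomm : ∀ i j d f, f ∈ K (d + 2) → coPsi i (coPsi j f) = coPsi j (coPsi i f) :=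
    fun i j d f hf => coPsi_comm hv i j d f hf
  obtain ⟨a, ha1, ha2⟩ := exists_family (fun l => opWord coPsi l f) D
    (fun l l' hl hp => opWord_perm (K := K) hmap hcomm hp (e := 0) (by simpa [K, hl] using hf))
    (fun i j l hl => coPsi_cubic hv i j 0 _
      (opWord_mem (K := K) hmap l (by simpa [K, hl] using hf)))
  refine ⟨a, ha1, fun S hS => ha2 S ?_, fun S => ?_, fun S hS => ?_⟩
  · rintro l hl rfl
    have := l.toFinset_card_le
    omega
  · by_cases h : ∃ l : List (Fin (t + 1)), l.length = D ∧ l.toFinset = S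
    · obtain ⟨l, hl, rfl⟩ := h
      rw [← ha1 l hl]
      exact opWord_mem (K := K) hmap l (e := 0) (by simpa [K, hl] using hf)
    · push Not at h
      rw [ha2 S h]
      exact Submodule.zero_mem _
  · obtain ⟨D, rfl⟩ : ∃ D', D = D' + 1 := ⟨D - 1, by omega⟩
    rcases S.eq_empty_or_nonempty with rfl | hne
    · refine Eq.trans (Finset.sum_congr rfl fun i _ => ?_) (sum_der_opWord_replicate hv hf D)
      rw [ha1 _ (by simp)]
      congr 2
      ext y; simp
    · obtain ⟨l, hl, rfl⟩ := exists_list_toFinset hne (D := D) (by omega)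
      have h1 := sum_der_coPsi hv (d := 0)
        (opWord_mem (K := K) hmap l (e := 1) (f := f) (by simpa [K, hl] using hf))
      refine Eq.trans (Finset.sum_congr rfl fun i _ => ?_) h1
      rw [← opWord_cons, ha1 _ (by simp [hl])]
      simp

end CoPsi

section Closing

variable {k m : ℕ}

/-- A functional is invariant as soon as its derivatives are those of invariant functionals. -/
theorem mem_invDual_of_der (hm : 0 < m) {A : PolyDual k} (h1 : A 1 = 0) {e : Fin k → PolyDual k}
    (he : ∀ i, e i ∈ invDual k m) (h : ∀ i, der i A = der i (e i)) : A ∈ invDual k m := by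
  refine ⟨fun z => ?_, fun a => ?_⟩
  · have : A.comp (SqTotal k).toLinearMap = A := by
      refine PolyDual.ext_monomial fun a => ?_
      induction a using expMul_induction with
      | h0 => simp
      | hs i a _ =>
        rw [LinearMap.comp_apply, AlgHom.toLinearMap_apply, monomial_single_add,
          apply_sqTotal_X_mul, h, ← apply_sqTotal_X_mul, invDual_sq (he i), ← der_apply, ← h,
          der_apply]
    exact LinearMap.congr_fun this z
  · induction a using expMul_induction with
    | h0 => intro _; simpa using h1
    | hs i a _ =>
      intro ha
      rw [monomial_single_add, ← der_apply, h]
      refine (invDual_degree (he i)).der i a ?_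
      rw [map_add, Finsupp.degree_single] at ha
      omega

theorem sum_filter_superset_eq {V : Type*} [AddCommGroup V]
    {C : Finset (Fin k) → V} (h0 : ∀ S, S.card + 2 ≤ k → C S = 0) (h1 : C Finset.univ = 0)
    (v : Finset (Fin k)) :
    ∑ S ∈ Finset.univ.filter (v ⊆ ·), C S = ∑ l ∈ vᶜ, C (Finset.univ.erase l) := by
  classical
  rw [← Finset.sum_image (f := C) (g := fun l => Finset.univ.erase l)]
  · symm
    refine Finset.sum_subset ?_ ?_
    · intro S hS
      obtain ⟨l, hl, rfl⟩ := Finset.mem_image.mp hS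
      simp only [Finset.mem_filter, Finset.mem_univ, true_and]
      exact Finset.subset_erase.mpr ⟨Finset.subset_univ _, Finset.mem_compl.mp hl⟩
    · intro S hS hS'
      have hc := Finset.card_le_univ S
      rw [Fintype.card_fin] at hc
      by_cases h2 : S.card + 2 ≤ k
      · exact h0 S h2
      by_cases h3 : S.card = k
      · rw [(Finset.card_eq_iff_eq_univ S).mp (by rw [h3, Fintype.card_fin]), h1]
      exfalso
      have h4 : Sᶜ.card = 1 := by rw [Finset.card_compl, Fintype.card_fin]; omega
      obtain ⟨l, hl⟩ := Finset.card_eq_one.mp h4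
      refine hS' (Finset.mem_image.mpr ⟨l, ?_, ?_⟩)
      · rw [Finset.mem_compl]
        intro hlv
        simp only [Finset.mem_filter, Finset.mem_univ, true_and] at hS
        have := hS hlv
        have h5 : l ∈ Sᶜ := by rw [hl]; simp
        exact Finset.mem_compl.mp h5 this
      · rw [← Finset.compl_singleton, ← hl, compl_compl]
  · intro i _ j _ h
    by_contra hij
    have : j ∈ Finset.univ.erase i := by simp [Ne.symm hij]
    simp only at h
    rw [h] at this
    simp at this

theorem exists_closing (hm : 0 < m) (a : Finset (Fin k) → PolyDual k)
    (ha : ∀ S, a S ∈ invDual k m) (hu : a Finset.univ = 0)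
    (hC : ∀ S : Finset (Fin k), S.card + 2 ≤ k → ∑ i, der i (a (insert i S)) = 0) :
    ∃ A ∈ invDual k m, ∀ S : Finset (Fin k),
      ∑ i, der i (a (insert i S) + if insert i S = Finset.univ then A else 0) = 0 := by
  classical
  set C : Finset (Fin k) → PolyDual k := fun S => ∑ i, der i (a (insert i S)) with hCdef
  have hCu : C Finset.univ = 0 := by simp [hCdef, hu]
  have hmem : ∀ v, upSum a v ∈ invDual k m := fun v => Submodule.sum_mem _ fun S _ => ha S
  set b : Fin k → PolyDual k := fun l => C (Finset.univ.erase l) with hb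
  have hM : ∀ v : Finset (Fin k), ∑ i ∈ v, der i (upSum a v) = ∑ l ∈ vᶜ, b l := fun v => by
    rw [← sum_insert_superset a der v, ← sum_filter_superset_eq (C := C) hC hCu v]
  have hM0 : ∑ l, b l = 0 := by
    have := hM ∅
    simpa using this.symm
  have hM' : ∀ v : Finset (Fin k), ∑ i ∈ v, der i (upSum a v) = ∑ l ∈ v, b l := fun v => by
    rw [hM]
    have := Finset.sum_compl_add_sum v b
    rw [hM0, add_eq_zero_iff_eq_neg, ZModModule.neg_eq_self] at this
    exact this
  have hb1 : ∀ l, b l = der l (upSum a {l}) := fun l => by simpa using (hM' {l}).symm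
  have hcomp : ∀ j l, der j (b l) = der l (b j) := by
    intro j l
    by_cases hjl : j = l
    · rw [hjl]
    set e := upSum a {j, l} with he
    have h1 := hM' {j, l}
    rw [Finset.sum_pair hjl, Finset.sum_pair hjl, hb1, hb1, ← he] at h1
    have hp : der j (upSum a {j} + e) = der l (upSum a {l} + e) := by
      rw [map_add, map_add, ← sub_eq_zero, ZModModule.sub_eq_add]
      calc _ = (der j e + der l e) + (der j (upSum a {j}) + der l (upSum a {l})) := by abel
        _ = 0 := by rw [h1, ZModModule.add_self]
    have h2 := der_eq_of_der_eq (Submodule.add_mem _ (hmem {j}) (hmem _))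
      (Submodule.add_mem _ (hmem {l}) (hmem _)) hp
    rw [hb1, hb1, der_comm l j, ← sub_eq_zero, ZModModule.sub_eq_add]
    have h3 : der j (der l (upSum a {l} + e)) + der j (der l (upSum a {j} + e)) = 0 := by
      rw [← hp, h2, der_comm l j, ZModModule.add_self]
    rw [← h3]
    simp only [map_add]
    calc _ = der j (der l (upSum a {l})) + der j (der l (upSum a {j})) +
        (der j (der l e) + der j (der l e)) := by rw [ZModModule.add_self, add_zero]
      _ = _ := by abel
  obtain ⟨A, hA1, hA⟩ := exists_der_eq b hcomp
  refine ⟨A, mem_invDual_of_der hm hA1 (fun i => hmem {i}) fun i => by rw [hA, hb1], fun S => ?_⟩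
  simp only [map_add, Finset.sum_add_distrib]
  change C S + _ = 0
  by_cases h2 : S.card + 2 ≤ k
  · rw [show C S = 0 from hC S h2, zero_add]
    refine Finset.sum_eq_zero fun i _ => ?_
    rw [if_neg, map_zero]
    intro h
    have h3 := Finset.card_insert_le i S
    rw [h, Finset.card_univ, Fintype.card_fin] at h3
    omega
  have hc := Finset.card_le_univ S
  rw [Fintype.card_fin] at hc
  by_cases h3 : S.card = k
  · rw [(Finset.card_eq_iff_eq_univ S).mp (by rw [h3, Fintype.card_fin]), hCu, zero_add, ← hM0]
    simp [hA]
  have h4 : Sᶜ.card = 1 := by rw [Finset.card_compl, Fintype.card_fin]; omega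
  obtain ⟨l, hl⟩ := Finset.card_eq_one.mp h4
  have hS : S = Finset.univ.erase l := by rw [← Finset.compl_singleton, ← hl, compl_compl]
  rw [Finset.sum_eq_single l]
  · rw [hS, Finset.insert_erase (Finset.mem_univ l), if_pos rfl, hA]
    exact ZModModule.add_self _
  · intro i _ hi
    rw [if_neg, map_zero]
    rw [hS, Finset.insert_eq_of_mem (by simp [hi])]
    intro h
    have := Finset.mem_univ l
    rw [← h] at this
    simp at this
  · simp

end Closing

section ClosedFamily

variable {t m : ℕ}

theorem exists_closed_family (hv : SmallVanish t m) {D : ℕ}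
    (hDm : t + 1 ≤ D ∨ (D = t ∧ 0 < m)) (hD : 1 ≤ D) {f : PolyDual (t + 1)}
    (hf : f ∈ invDual (t + 1) (iterDeg m t D)) :
    ∃ a : Finset (Fin (t + 1)) → PolyDual (t + 1),
      (∀ l : List (Fin (t + 1)), l.length = D → opWord coPsi l f = a l.toFinset) ∧
      (∀ S, a S ∈ invDual (t + 1) m) ∧
      ∀ v : Finset (Fin (t + 1)), ∑ i ∈ v, der i (upSum a v) = 0 := by
  obtain ⟨a, ha1, ha2, ha3, ha4⟩ := exists_coPsi_family hv hD hf
  suffices h : ∃ a' : Finset (Fin (t + 1)) → PolyDual (t + 1),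
      (∀ l : List (Fin (t + 1)), l.length = D → a' l.toFinset = a l.toFinset) ∧
      (∀ S, a' S ∈ invDual (t + 1) m) ∧
      ∀ S : Finset (Fin (t + 1)), ∑ i, der i (a' (insert i S)) = 0 by
    obtain ⟨a', h1, h2, h3⟩ := h
    refine ⟨a', fun l hl => by rw [ha1 l hl, h1 l hl], h2, fun v => ?_⟩
    rw [← sum_insert_superset a' der v]
    exact Finset.sum_eq_zero fun S _ => h3 S
  rcases hDm with hDt | ⟨rfl, hm⟩
  · refine ⟨a, fun _ _ => rfl, ha3, ?_⟩
    have h0 : ∀ S : Finset (Fin (t + 1)), S ≠ Finset.univ →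
        ∑ i, der i (a (insert i S)) = 0 := by
      intro S hS
      refine ha4 S ?_
      have := Finset.card_lt_card (Finset.ssubset_univ_iff.mpr hS)
      rw [Finset.card_univ, Fintype.card_fin] at this
      omega
    intro S
    by_cases hS : S = Finset.univ
    · have h1 := sum_insert_superset a der ∅
      rw [Finset.sum_empty, Finset.sum_eq_single_of_mem Finset.univ (by simp)
        fun S _ hS => h0 S hS] at h1
      rw [hS, h1]
    · exact h0 S hS
  · obtain ⟨A, hA, h⟩ := exists_closing hm a ha3
      (ha2 _ (by simp)) fun S hS => ha4 S (by omega)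
    refine ⟨fun S => a S + if S = Finset.univ then A else 0, fun l hl => ?_, fun S => ?_, h⟩
    · have : l.toFinset ≠ Finset.univ := by
        intro h'
        have h2 := l.toFinset_card_le
        rw [h', Finset.card_univ, Fintype.card_fin] at h2
        omega
      simp [this]
    · dsimp only
      split_ifs
      · exact Submodule.add_mem _ (ha3 S) hA
      · simpa using ha3 S

end ClosedFamily

section WordDecomposition

variable {k t m : ℕ}

/-- The map `h ↦ (h ∘ κ ^ D) ∘ π` induced by a linear substitution `π`. -/
noncomputable def kamekoLift (m D : ℕ) (s : Fin k → Finset (Fin t)) :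
    invDual t m →ₗ[ZMod 2] invDual k (iterDeg m t D) :=
  LinearMap.codRestrict _
    ((LinearMap.lcomp (ZMod 2) (ZMod 2)
      ((kameko t ^ D).comp (linSub s).toLinearMap)).comp (invDual t m).subtype)
    fun h => comp_linSub_mem (kameko_pow_comp_mem h.2 D) s

theorem coe_kamekoLift (D : ℕ) (s : Fin k → Finset (Fin t)) (h : invDual t m) :
    (kamekoLift m D s h : PolyDual k) =
      ((h : PolyDual t).comp (kameko t ^ D)).comp (linSub s).toLinearMap := rfl

variable {I : Type*} [DecidableEq I]

theorem opWord_comp_kameko_pow {ψ : I → PolyDual k →ₗ[ZMod 2] PolyDual k}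
    {s : Fin k → Finset (Fin t)} {v : Finset I}
    (hψ : ∀ i (h : PolyDual t), ψ i ((h.comp (kameko t)).comp (linSub s).toLinearMap) =
      if i ∈ v then h.comp (linSub s).toLinearMap else 0) (h : PolyDual t) (l : List I) :
    opWord ψ l ((h.comp (kameko t ^ l.length)).comp (linSub s).toLinearMap) =
      if l.toFinset ⊆ v then h.comp (linSub s).toLinearMap else 0 := by
  induction l using List.reverseRecOn with
  | nil => simp [opWord_nil]; rfl
  | append_singleton l i ih =>
    rw [opWord_append, List.length_append, List.length_singleton, pow_succ]
    have h1 := hψ i (h.comp (kameko t ^ l.length))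
    have h2 : (h.comp (kameko t ^ l.length * kameko t)) =
      (h.comp (kameko t ^ l.length)).comp (kameko t) := rfl
    rw [h2, opWord_cons, opWord_nil, h1]
    by_cases hi : i ∈ v
    · rw [if_pos hi, ih]
      simp [hi, Finset.insert_subset_iff]
    · rw [if_neg hi, map_zero, if_neg]
      intro h'
      exact hi (h' (by simp))

/-- Counting invariant functionals through the words in a family of operators. -/
theorem finrank_invDual_of_words [Fintype I] (ψ : I → PolyDual k →ₗ[ZMod 2] PolyDual k) {D : ℕ}
    (hD : 1 ≤ D)
    (G : Finset (Finset I)) (s : Finset I → Fin k → Finset (Fin t))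
    (ι : Finset I → Fin t → Finset (Fin k))
    (hι : ∀ v ∈ G, ∀ j, linSub (s v) (linSub (ι v) (X j)) = X j)
    (hψ : ∀ v ∈ G, ∀ i (h : PolyDual t),
      ψ i ((h.comp (kameko t)).comp (linSub (s v)).toLinearMap) =
      if i ∈ v then h.comp (linSub (s v)).toLinearMap else 0)
    (hsurj : ∀ f ∈ invDual k (iterDeg m t D), ∃ c : Finset I → PolyDual k,
      (∀ l : List I, l.length = D → opWord ψ l f = upSum c l.toFinset) ∧
      (∀ v, v.Nonempty → v ∉ G → c v = 0) ∧ (∀ v ∈ G, c v ∈ invDual k m) ∧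
      ∀ v ∈ G, ∀ i w, c v (X i * w) = c v (linSub (ι v) (linSub (s v) (X i)) * w))
    (hinj : ∀ c : Finset I → PolyDual k, (∀ v ∉ G, c v = 0) →
      (∀ v ∈ G, ∃ g ∈ invDual t m, c v = g.comp (linSub (s v)).toLinearMap) →
      (∀ l : List I, l.length = D → upSum c l.toFinset = 0) → ∀ v, c v = 0)
    (W : Submodule (ZMod 2) (PolyDual k))
    (hW : ∀ f, f ∈ W ↔ f ∈ invDual k (iterDeg m t D) ∧
      ∀ l : List I, l.length = D → opWord ψ l f = 0) :
    Module.finrank (ZMod 2) (invDual k (iterDeg m t D)) =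
      G.card * Module.finrank (ZMod 2) (invDual t m) + Module.finrank (ZMod 2) W := by
  classical
  have hι' : ∀ v ∈ G, ∀ y, linSub (s v) (linSub (ι v) y) = y := by
    intro v hv y
    have : (linSub (s v)).comp (linSub (ι v)) = AlgHom.id _ _ := by
      refine algHom_ext fun j => ?_
      exact hι v hv j
    exact DFunLike.congr_fun this y
  have hle : W ≤ invDual k (iterDeg m t D) := fun f hf => ((hW f).mp hf).1
  let Θ : (G → invDual t m) →ₗ[ZMod 2] invDual k (iterDeg m t D) :=
    ∑ v : G, (kamekoLift m D (s v)).comp (LinearMap.proj v)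
  let Φ : ((G → invDual t m) × W) →ₗ[ZMod 2] invDual k (iterDeg m t D) :=
    Θ.coprod (Submodule.inclusion hle)
  let c : (G → invDual t m) → Finset I → PolyDual k := fun g v =>
    if h : v ∈ G then (g ⟨v, h⟩ : PolyDual t).comp (linSub (s v)).toLinearMap else 0
  have hΘ : ∀ g, (Θ g : PolyDual k) = ∑ v : G,
      ((g v : PolyDual t).comp (kameko t ^ D)).comp (linSub (s v)).toLinearMap := by
    intro g
    simp only [Θ, LinearMap.sum_apply, LinearMap.comp_apply, LinearMap.proj_apply,
      AddSubmonoidClass.coe_finsetSum, coe_kamekoLift]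
  have hword : ∀ g (l : List I), l.length = D →
      opWord ψ l (Θ g : PolyDual k) = upSum (c g) l.toFinset := by
    rintro g l rfl
    rw [hΘ, map_sum, upSum, Finset.sum_filter]
    simp_rw [fun v : G => opWord_comp_kameko_pow (hψ v v.2) (g v : PolyDual t) l]
    rw [← Finset.sum_subset (Finset.subset_univ G), ← Finset.sum_coe_sort G]
    · refine Finset.sum_congr rfl fun v _ => ?_
      simp only [c, dif_pos v.2]
    · intro v _ hv
      simp [c, hv]
  have hbij : Function.Bijective Φ := by
    constructor
    · rw [injective_iff_map_eq_zero]
      rintro ⟨g, w⟩ h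
      have h1 : (Θ g : PolyDual k) + (w : PolyDual k) = 0 := congrArg Subtype.val h
      have h2 : ∀ v, c g v = 0 := by
        refine hinj (c g) (fun v hv => by simp [c, hv])
          (fun v hv => ⟨g ⟨v, hv⟩, (g ⟨v, hv⟩).2, by simp [c, hv]⟩) fun l hl => ?_
        rw [← hword g l hl]
        have := congrArg (opWord ψ l) h1
        rwa [map_add, ((hW _).mp w.2).2 l hl, add_zero, map_zero] at this
      have hg : g = 0 := by
        funext v
        refine Subtype.ext (LinearMap.ext fun y => ?_)
        have h3 := LinearMap.congr_fun (h2 v) (linSub (ι v) y)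
        simp only [c, dif_pos v.2, LinearMap.comp_apply, AlgHom.toLinearMap_apply] at h3
        rwa [hι' v v.2] at h3
      subst hg
      rw [map_zero, Submodule.coe_zero, zero_add] at h1
      rw [Prod.mk_eq_zero]
      exact ⟨rfl, Subtype.ext h1⟩
    · intro f
      obtain ⟨a, ha1, ha2, ha3, ha4⟩ := hsurj f f.2
      let g : G → invDual t m := fun v =>
        ⟨(a v).comp (linSub (ι v)).toLinearMap, comp_linSub_mem (ha3 v v.2) _⟩
      have hc : ∀ v, v.Nonempty → c g v = a v := by
        intro v hne
        by_cases hv : v ∈ G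
        · simp only [c, dif_pos hv, g]
          refine LinearMap.ext fun z => ?_
          exact (factor_of_mul (linSub (s v)) (linSub (ι v)) (ha4 v hv) z).symm
        · rw [ha2 v hne hv]
          simp [c, hv]
      have hmem : (f : PolyDual k) + (Θ g : PolyDual k) ∈ W := by
        refine (hW _).mpr ⟨Submodule.add_mem _ f.2 (Θ g).2, fun l hl => ?_⟩
        rw [map_add, ha1 l hl, hword g l hl]
        have : upSum (c g) l.toFinset = upSum a l.toFinset := by
          refine Finset.sum_congr rfl fun v hv => hc v ?_
          rcases l with _ | ⟨x, l⟩
          · simp at hl; omega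
          · exact ⟨x, (Finset.mem_filter.mp hv).2 (by simp)⟩
        rw [this, ZModModule.add_self]
      refine ⟨⟨g, ⟨_, hmem⟩⟩, Subtype.ext ?_⟩
      change (Θ g : PolyDual k) + ((f : PolyDual k) + (Θ g : PolyDual k)) = f
      rw [add_left_comm, ZModModule.add_self, add_zero]
  have : IsNoetherian (ZMod 2) (invDual k (iterDeg m t D)) :=
    isNoetherian_of_isNoetherianRing_of_finite _ _
  have : Module.Finite (ZMod 2) W :=
    Module.Finite.of_injective _ (Submodule.inclusion_injective hle)
  have : Module.Free (ZMod 2) W := Module.Free.of_divisionRing _ _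
  have : Module.Free (ZMod 2) (invDual t m) := Module.Free.of_divisionRing _ _
  rw [← (LinearEquiv.ofBijective Φ hbij).finrank_eq, Module.finrank_prod, Module.finrank_pi_fintype]
  simp

end WordDecomposition

section Hyperplane

variable {t : ℕ}

/-- The substitution eliminating `x_p` through `∑ i ∈ v, x_i = 0`, where `p ∈ v`. -/
def planeSub (v : Finset (Fin (t + 1))) (p : Fin (t + 1)) (i : Fin (t + 1)) : Finset (Fin t) :=
  Finset.univ.filter fun j => p.succAbove j = i ∨ (i = p ∧ p.succAbove j ∈ v)

theorem linSub_planeSub_succAbove (v : Finset (Fin (t + 1))) (p : Fin (t + 1)) (j : Fin t) :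
    linSub (planeSub v p) (X (p.succAbove j)) = X j := by
  rw [linSub_X, show planeSub v p (p.succAbove j) = {j} from ?_, Finset.sum_singleton]
  ext l
  simp [planeSub, Fin.succAbove_ne]

theorem linSub_planeSub_self (v : Finset (Fin (t + 1))) (p : Fin (t + 1)) :
    linSub (planeSub v p) (X p) = ∑ j ∈ Finset.univ.filter fun j => p.succAbove j ∈ v, X j := by
  rw [linSub_X]
  refine Finset.sum_congr ?_ fun _ _ => rfl
  ext l
  simp [planeSub, Fin.succAbove_ne]

theorem sum_filter_succAbove {V : Type*} [AddCommMonoid V] {v : Finset (Fin (t + 1))}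
    {p : Fin (t + 1)} (hp : p ∈ v) (F : Fin (t + 1) → V) :
    F p + ∑ j ∈ Finset.univ.filter (fun j => p.succAbove j ∈ v), F (p.succAbove j) =
      ∑ i ∈ v, F i := by
  rw [← Finset.add_sum_erase v F hp]
  congr 1
  refine (Finset.sum_map (Finset.univ.filter fun j => p.succAbove j ∈ v) p.succAboveEmb
    F).symm.trans
    (Finset.sum_congr ?_ fun _ _ => rfl)
  ext i
  simp only [Finset.mem_map, Finset.mem_filter, Finset.mem_univ, true_and, Finset.mem_erase,
    Fin.coe_succAboveEmb]
  constructor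
  · rintro ⟨j, hj, rfl⟩
    exact ⟨Fin.succAbove_ne p j, hj⟩
  · rintro ⟨hi, hiv⟩
    obtain ⟨j, rfl⟩ := Fin.exists_succAbove_eq hi
    exact ⟨j, hiv, rfl⟩

theorem sum_linSub_planeSub {v : Finset (Fin (t + 1))} {p : Fin (t + 1)} (hp : p ∈ v) :
    ∑ i ∈ v, linSub (planeSub v p) (X i) = 0 := by
  rw [← sum_filter_succAbove hp, linSub_planeSub_self]
  simp_rw [linSub_planeSub_succAbove]
  exact ZModModule.add_self _

theorem factor_planeSub {v : Finset (Fin (t + 1))} {p : Fin (t + 1)} (hp : p ∈ v)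
    {c : PolyDual (t + 1)} (hc : ∑ i ∈ v, der i c = 0) (i : Fin (t + 1))
    (w : MvPolynomial (Fin (t + 1)) (ZMod 2)) :
    c (X i * w) = c (linSub (fun j => {p.succAbove j}) (linSub (planeSub v p) (X i)) * w) := by
  by_cases hi : i = p
  · subst hi
    have h1 := LinearMap.congr_fun hc w
    rw [← sum_filter_succAbove hp, LinearMap.add_apply, LinearMap.sum_apply, LinearMap.zero_apply,
      CharTwo.add_eq_zero, der_apply] at h1
    rw [linSub_planeSub_self, map_sum, Finset.sum_mul, map_sum, h1]
    refine Finset.sum_congr rfl fun j _ => ?_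
    rw [der_apply, linSub_X, Finset.sum_singleton]
  · obtain ⟨j, rfl⟩ := Fin.exists_succAbove_eq hi
    rw [linSub_planeSub_succAbove, linSub_X, Finset.sum_singleton]

theorem kameko_varProd_erase_mul_X (j l : Fin t) :
    kameko t (varProd (Finset.univ.erase j) * X l) = if l = j then 1 else 0 := by
  split_ifs with h
  · subst h
    have h1 := kameko_varProd_mul_sq (k := t) (T := Finset.univ) (y := 1)
    rw [if_pos rfl, one_pow, mul_one] at h1
    rw [mul_comm, varProd_insert (by simp), Finset.insert_erase (Finset.mem_univ l), h1]
  · have h1 : l ∈ Finset.univ.erase j := by simp [h]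
    rw [mul_comm, X_mul_varProd_of_mem h1, kameko_varProd_mul_sq, if_neg]
    intro h'
    have := Finset.mem_univ l
    rw [← h'] at this
    simp at this

theorem kameko_linSub_planeSub {v : Finset (Fin (t + 1))} {p : Fin (t + 1)} (hp : p ∈ v)
    (i : Fin (t + 1)) :
    kameko t (linSub (planeSub v p) (varProd (Finset.univ.erase i))) =
      if i ∈ v then 1 else 0 := by
  have himg : Finset.univ.erase p = Finset.univ.map p.succAboveEmb := by
    ext i
    simp only [Finset.mem_erase, Finset.mem_univ, and_true, Finset.mem_map, true_and]
    constructor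
    · intro h; exact Fin.exists_succAbove_eq h
    · rintro ⟨j, rfl⟩; exact Fin.succAbove_ne p j
  by_cases hi : i = p
  · subst hi
    rw [if_pos hp, varProd, himg, Finset.prod_map, map_prod]
    have h1 := kameko_varProd_mul_sq (k := t) (T := Finset.univ) (y := 1)
    rw [if_pos rfl, one_pow, mul_one] at h1
    rw [← h1, varProd]
    congr 1
    exact Finset.prod_congr rfl fun j _ => linSub_planeSub_succAbove v i j
  · obtain ⟨j, rfl⟩ := Fin.exists_succAbove_eq hi
    have h2 : linSub (planeSub v p) (varProd (Finset.univ.erase (p.succAbove j))) =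
        varProd (Finset.univ.erase j) *
          ∑ l ∈ Finset.univ.filter fun l => p.succAbove l ∈ v, X l := by
      have h3 : (Finset.univ.erase (p.succAbove j)).erase p =
          (Finset.univ.erase j).map p.succAboveEmb := by
        rw [Finset.erase_right_comm, himg, Finset.map_erase]
        rfl
      rw [← linSub_planeSub_self, mul_comm, varProd, ← Finset.mul_prod_erase _ _ (a := p), map_mul,
        h3, Finset.prod_map, map_prod]
      · congr 1
        exact Finset.prod_congr rfl fun l _ => linSub_planeSub_succAbove v p l
      · simp [Ne.symm hi]
    rw [h2, Finset.mul_sum, map_sum]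
    simp_rw [kameko_varProd_erase_mul_X]
    rw [Finset.sum_ite_eq']
    simp

end Hyperplane

section SmallVanishing

variable {t m : ℕ}

theorem finrank_invDual_of_smallVanish (hv : SmallVanish t m) {D : ℕ}
    (hDm : t + 1 ≤ D ∨ (D = t ∧ 0 < m)) (hD : 1 ≤ D) :
    Module.finrank (ZMod 2) (invDual (t + 1) (iterDeg m t D)) =
      (2 ^ (t + 1) - 1) * Module.finrank (ZMod 2) (invDual t m) := by
  classical
  let p : Finset (Fin (t + 1)) → Fin (t + 1) := fun v => if h : v.Nonempty then h.choose else 0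
  have hp : ∀ v : Finset (Fin (t + 1)), v.Nonempty → p v ∈ v := fun v hne => by
    simp only [p, dif_pos hne]; exact hne.choose_spec
  have hG : ∀ v : Finset (Fin (t + 1)), v ∈ Finset.univ.erase ∅ ↔ v.Nonempty := fun v => by
    simp [Finset.nonempty_iff_ne_empty]
  have key := finrank_invDual_of_words (k := t + 1) (t := t) (m := m) coPsi hD
    (Finset.univ.erase ∅) (fun v => planeSub v (p v)) (fun v j => {(p v).succAbove j})
    (fun v _ j => by
      rw [linSub_X, Finset.sum_singleton, linSub_planeSub_succAbove])
    (fun v hv' i h => psi_comp_kameko_linSub _ h _ _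
      (kameko_linSub_planeSub (hp v ((hG v).mp hv')) i))
    (fun f hf => by
      obtain ⟨a, ha1, ha2, ha3⟩ := exists_closed_family hv hDm hD hf
      refine ⟨upSum a, fun l hl => by rw [upSum_upSum, ha1 l hl],
        fun v hne hv' => absurd ((hG v).mpr hne) hv',
        fun v _ => Submodule.sum_mem _ fun S _ => ha2 S,
        fun v hv' => factor_planeSub (hp v ((hG v).mp hv')) (ha3 v)⟩)
    (fun c h0 hg hl => by
      have hS : ∀ S : Finset (Fin (t + 1)), S.Nonempty → S.card ≤ D → upSum c S = 0 := by
        intro S hne hS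
        obtain ⟨l, hl1, rfl⟩ := exists_list_toFinset hne hS
        exact hl l hl1
      intro v
      by_cases hne : v.Nonempty
      swap
      · exact h0 v fun h => hne ((hG v).mp h)
      rcases hDm with hDt | ⟨rfl, hm⟩
      · rw [← upSum_upSum c v]
        refine Finset.sum_eq_zero fun S h => hS S ?_ ?_
        · exact hne.mono (Finset.mem_filter.mp h).2
        · have := Finset.card_le_univ S
          rw [Fintype.card_fin] at this
          omega
      · have h1 : ∀ v : Finset (Fin (D + 1)), v.Nonempty → c v = upSum c Finset.univ := by
          intro v hne
          rw [← upSum_upSum c v]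
          refine Finset.sum_eq_single_of_mem Finset.univ (by simp) fun S h h' => hS S ?_ ?_
          · exact hne.mono (Finset.mem_filter.mp h).2
          · have := Finset.card_lt_card (Finset.ssubset_univ_iff.mpr h')
            rw [Finset.card_univ, Fintype.card_fin] at this
            omega
        rw [h1 v hne]
        obtain ⟨g, hg1, hg2⟩ := hg v ((hG v).mpr hne)
        rw [h1 v hne] at hg2
        refine PolyDual.eq_zero_of_der (m := m) ?_ hm fun i => ?_
        · rw [hg2]; exact invDual_degree (comp_linSub_mem hg1 _)
        · obtain ⟨g, _, hg2⟩ := hg {i} ((hG {i}).mpr (Finset.singleton_nonempty i))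
          rw [h1 {i} (Finset.singleton_nonempty i)] at hg2
          have h2 := sum_linSub_planeSub (hp {i} (Finset.singleton_nonempty i))
          rw [Finset.sum_singleton] at h2
          refine LinearMap.ext fun y => ?_
          rw [hg2, der_apply, LinearMap.comp_apply, AlgHom.toLinearMap_apply, map_mul, h2,
            zero_mul, map_zero]
          rfl)
    ⊥ (fun f => by
      rw [Submodule.mem_bot]
      constructor
      · rintro rfl
        exact ⟨Submodule.zero_mem _, fun l _ => map_zero _⟩
      · rintro ⟨hf, h⟩
        exact eq_zero_of_opWord_coPsi hv D f hf h)
  rw [key, finrank_bot, add_zero, Finset.card_erase_of_mem (Finset.mem_univ _)]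
  simp

end SmallVanishing

section Pure

variable {k : ℕ}

theorem sum_der_psi_erase {n : ℕ} {f : PolyDual k} (hf : f ∈ invDual k n) {T : Finset (Fin k)}
    (hT : ∀ U ⊆ T, U.card + 1 ≠ T.card → psi U f = 0) :
    ∑ i ∈ T, der i (psi (T.erase i) f) = 0 := by
  rcases T.eq_empty_or_nonempty with rfl | ⟨i₀, hi₀⟩
  · simp
  have hcard : ∀ i ∈ T, (T.erase i).card + 1 = T.card := fun i hi => Finset.card_erase_add_one hi
  have hdeg : (∑ i ∈ T, der i (psi (T.erase i) f)).HasDegree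
      ((n - (T.card - 1)) / 2 - 1) := by
    refine PolyDual.HasDegree.sum fun i hi => ((invDual_degree hf).psi fun e he => ?_).der i
    have := hcard i hi
    omega
  refine hdeg.eq_zero_of_sqTotal fun y => ?_
  have h1 := psi_star hf T y
  rw [hT T subset_rfl (by omega), LinearMap.zero_apply,
    ← Finset.sum_subset (s₁ := T.image fun i : Fin k => {i})] at h1
  · rw [Finset.sum_image (fun i _ j _ h => Finset.singleton_injective h)] at h1
    rw [LinearMap.sum_apply]
    refine Eq.trans (Finset.sum_congr rfl fun i _ => ?_) h1
    rw [der_apply, Finset.sdiff_singleton_eq_erase, varProd, Finset.prod_singleton]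
  · intro U hU
    obtain ⟨i, hi, rfl⟩ := Finset.mem_image.mp hU
    simpa using hi
  · intro U hUT hU
    rw [Finset.mem_powerset] at hUT
    have h3 := Finset.card_sdiff_add_card_eq_card hUT
    rw [hT _ Finset.sdiff_subset, LinearMap.zero_apply]
    intro h
    obtain ⟨i, rfl⟩ := Finset.card_eq_one.mp (show U.card = 1 by omega)
    exact hU (Finset.mem_image_of_mem _ (hUT (Finset.mem_singleton_self i)))

theorem finrank_map_kameko (k n : ℕ) :
    Module.finrank (ZMod 2) ((invDual k n).map
      (LinearMap.lcomp (ZMod 2) (ZMod 2) (kameko k) : PolyDual k →ₗ[ZMod 2] PolyDual k)) =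
      Module.finrank (ZMod 2) (invDual k n) := by
  refine (Submodule.equivMapOfInjective _ ?_ _).finrank_eq.symm
  rw [injective_iff_map_eq_zero]
  intro h hh
  refine LinearMap.ext fun y => ?_
  have := LinearMap.congr_fun hh (varProd Finset.univ * y ^ 2)
  rw [LinearMap.lcomp_apply, kameko_varProd_mul_sq, if_pos rfl] at this
  exact this

theorem mem_map_kameko_iff {I : Type*} (P : I → Finset (Fin k)) (hP : ∀ i, P i ≠ Finset.univ)
    {n n' D : ℕ} (hD : 1 ≤ D) (hn : n = 2 * n' + k)
    (h : ∀ f ∈ invDual k n, (∀ l : List I, l.length = D → opWord (fun i => psi (P i)) l f = 0) →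
      ∀ T ≠ Finset.univ, psi T f = 0) (f : PolyDual k) :
    f ∈ (invDual k n').map
      (LinearMap.lcomp (ZMod 2) (ZMod 2) (kameko k) : PolyDual k →ₗ[ZMod 2] PolyDual k) ↔
      f ∈ invDual k n ∧ ∀ l : List I, l.length = D → opWord (fun i => psi (P i)) l f = 0 := by
  constructor
  · rintro ⟨g, hg, rfl⟩
    refine ⟨hn ▸ comp_kameko_mem hg, fun l hl => ?_⟩
    rcases List.eq_nil_or_concat l with rfl | ⟨l', i, rfl⟩
    · simp at hl; omega
    · have h1 : psi (P i) (LinearMap.lcomp (ZMod 2) (ZMod 2) (kameko k) g) = 0 :=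
        (psi_comp_kameko (P i) g).trans (if_neg (hP i))
      rw [List.concat_eq_append, opWord_append, opWord_cons, opWord_nil]
      rw [h1, map_zero]
  · rintro ⟨hf, hl⟩
    have h1 := h f hf hl
    refine ⟨psi Finset.univ f, psi_mem hf (fun e he => ?_) fun U hU => h1 U hU.ne,
      (eq_comp_kameko h1).symm⟩
    rw [Finset.card_univ, Fintype.card_fin] at he
    omega

end Pure

section ThreeVariables

theorem psi_eq_zero_of_even_card {d : ℕ} {f : PolyDual 3}
    (hf : f ∈ invDual 3 (iterDeg 0 1 (d + 1))) {T : Finset (Fin 3)} (hT : Even T.card) :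
    psi T f = 0 := by
  refine (invDual_degree hf).psi_eq_zero fun e he => ?_
  rw [iterDeg] at he
  obtain ⟨c, hc⟩ := hT
  omega

theorem psi_singleton_mem (i : Fin 3) (d : ℕ) (f : PolyDual 3)
    (hf : f ∈ invDual 3 (iterDeg 0 1 (d + 1))) : psi {i} f ∈ invDual 3 (iterDeg 0 1 d) := by
  refine psi_mem hf (fun e he => ?_) fun U hU => psi_eq_zero_of_even_card hf ?_
  · rw [iterDeg, Finset.card_singleton] at he
    omega
  · rw [Finset.ssubset_singleton_iff.mp hU]; simp

theorem der_psi_singleton {d : ℕ} {f : PolyDual 3} (hf : f ∈ invDual 3 (iterDeg 0 1 (d + 1)))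
    (j l : Fin 3) : der l (psi {j} f) = der j (psi {l} f) := by
  by_cases hjl : j = l
  · rw [hjl]
  have h1 := sum_der_psi_erase hf (T := {j, l}) fun U hU hc => psi_eq_zero_of_even_card hf ?_
  · rw [Finset.sum_pair hjl] at h1
    have e1 : ({j, l} : Finset (Fin 3)).erase j = {l} := by
      rw [Finset.erase_insert]; simpa using hjl
    have e2 : ({j, l} : Finset (Fin 3)).erase l = {j} := by
      rw [Finset.pair_comm, Finset.erase_insert]; simpa using Ne.symm hjl
    rw [e1, e2, add_eq_zero_iff_eq_neg, ZModModule.neg_eq_self] at h1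
    exact h1.symm
  · have h2 := Finset.card_le_card hU
    rw [Finset.card_pair hjl] at h2 hc
    have : U.card = 0 ∨ U.card = 2 := by omega
    rcases this with h | h <;> simp [h]

theorem psi_singleton_comm (i j : Fin 3) (d : ℕ) (f : PolyDual 3)
    (hf : f ∈ invDual 3 (iterDeg 0 1 (d + 1))) : psi {i} (psi {j} f) = psi {j} (psi {i} f) := by
  refine LinearMap.ext fun y => ?_
  have h1 := LinearMap.congr_fun (der_psi_singleton hf j i) (varProd ∅ * y ^ 2)
  rwa [der_apply_varProd_of_notMem (by simp), der_apply_varProd_of_notMem (by simp)] at h1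

theorem psi_singleton_cubic (i j : Fin 3) (d : ℕ) (f : PolyDual 3)
    (hf : f ∈ invDual 3 (iterDeg 0 1 (d + 2))) :
    psi {i} (psi {i} (psi {j} f)) = psi {i} (psi {j} (psi {j} f)) := by
  by_cases hij : i = j
  · rw [hij]
  have h1 : der i (psi {j} (psi {j} f)) = der j (psi {i} (psi {i} f)) := by
    refine LinearMap.ext fun y => ?_
    have h1 := LinearMap.congr_fun (der_psi_singleton hf j i) (varProd {i, j} * y ^ 2)
    rw [der_apply_varProd_of_mem (by simp), der_apply_varProd_of_mem (by simp)] at h1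
    have e1 : ({i, j} : Finset (Fin 3)).erase i = {j} := by
      rw [Finset.erase_insert]; simpa using hij
    have e2 : ({i, j} : Finset (Fin 3)).erase j = {i} := by
      rw [Finset.pair_comm, Finset.erase_insert]; simpa using Ne.symm hij
    rwa [e1, e2] at h1
  rw [psi_singleton_comm i j _ f hf, psi_singleton_comm i j _ _ (psi_singleton_mem i _ f hf)]
  refine LinearMap.ext fun y => ?_
  have h2 := LinearMap.congr_fun h1 (varProd ∅ * y ^ 2)
  rw [der_apply_varProd_of_notMem (by simp), der_apply_varProd_of_notMem (by simp)] at h2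
  exact h2.symm

theorem psi_singleton_eq_zero (d : ℕ) : ∀ f ∈ invDual 3 (iterDeg 0 1 (d + 1)),
    (∀ l : List (Fin 3), l.length = d + 1 → opWord (fun i => psi {i}) l f = 0) →
    ∀ i, psi {i} f = 0 := by
  induction d with
  | zero => intro f _ h i; exact h [i] rfl
  | succ d ih =>
    intro f hf h j
    have h1 : ∀ i j, psi {i} (psi {j} f) = 0 := fun i j =>
      ih _ (psi_singleton_mem j _ f hf) (fun l hl => by
        have := h (l ++ [j]) (by simp [hl])
        rwa [opWord_append] at this) i
    refine PolyDual.ext_psi fun T => ?_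
    rw [map_zero]
    rcases Nat.even_or_odd T.card with hT | hT
    · exact psi_eq_zero_of_even_card (psi_singleton_mem j _ f hf) hT
    have hle := Finset.card_le_univ T
    rw [Fintype.card_fin] at hle
    have : T.card = 1 ∨ T.card = 3 := by
      obtain ⟨c, hc⟩ := hT
      omega
    rcases this with hT | hT
    · obtain ⟨i, rfl⟩ := Finset.card_eq_one.mp hT
      exact h1 i j
    · rw [(Finset.card_eq_iff_eq_univ T).mp (by rw [hT, Fintype.card_fin])]
      refine LinearMap.ext fun y => ?_
      obtain ⟨i, e, hij, hej, hU, he⟩ : ∃ i e : Fin 3, i ≠ j ∧ e ≠ j ∧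
          Finset.univ.erase i = {j, e} ∧ ({j, e} : Finset (Fin 3)).erase j = {e} := by
        revert j; decide
      have h2 := LinearMap.congr_fun (der_psi_singleton hf j i) (varProd {j, e} * y ^ 2)
      rw [der_apply_varProd_of_notMem (by rw [← hU]; simp), der_apply_varProd_of_mem (by simp),
        he, h1, ← hU, Finset.insert_erase (Finset.mem_univ i)] at h2
      rw [h2, map_zero]

theorem der_eq_zero_of_mem_invDual_zero {k : ℕ} {c : PolyDual k} (hc : c ∈ invDual k 0)
    (i : Fin k) : der i c = 0 := by
  refine PolyDual.ext_monomial fun a => ?_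
  rw [der_apply, ← monomial_single_add]
  exact invDual_degree hc _ (by rw [map_add, Finsupp.degree_single]; omega)

theorem kameko_X_zero : kameko 1 (X 0) = 1 := by
  have h1 := kameko_varProd_mul_sq (k := 1) (T := Finset.univ) (y := 1)
  rw [if_pos rfl, one_pow, mul_one] at h1
  rw [← h1, varProd]
  simp

theorem finrank_invDual_three {D n : ℕ} (hD : 3 ≤ D) (hn : iterDeg 0 1 D = 2 * n + 3) :
    Module.finrank (ZMod 2) (invDual 3 (iterDeg 0 1 D)) =
      7 * Module.finrank (ZMod 2) (invDual 1 0) + Module.finrank (ZMod 2) (invDual 3 n) := by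
  classical
  let p : Finset (Fin 3) → Fin 3 := fun v => if h : v.Nonempty then h.choose else 0
  have hp : ∀ v : Finset (Fin 3), v.Nonempty → p v ∈ v := fun v hne => by
    simp only [p, dif_pos hne]; exact hne.choose_spec
  have hG : ∀ v : Finset (Fin 3), v ∈ Finset.univ.erase ∅ ↔ v.Nonempty := fun v => by
    simp [Finset.nonempty_iff_ne_empty]
  let K : ℕ → Submodule (ZMod 2) (PolyDual 3) := fun d => invDual 3 (iterDeg 0 1 d)
  let s : Finset (Fin 3) → Fin 3 → Finset (Fin 1) := fun v i => if i ∈ v then {0} else ∅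
  have hs : ∀ v i, linSub (s v) (X i) = if i ∈ v then X 0 else 0 := fun v i => by
    rw [linSub_X]
    by_cases h : i ∈ v <;> simp [s, h]
  have key := finrank_invDual_of_words (k := 3) (t := 1) (m := 0) (fun i : Fin 3 => psi {i})
    (D := D) (by omega) (Finset.univ.erase ∅) s (fun v _ => {p v})
    (fun v hv j => by
      rw [linSub_X, Finset.sum_singleton, hs, if_pos (hp v ((hG v).mp hv)),
        Subsingleton.elim j 0])
    (fun v _ i h => psi_comp_kameko_linSub _ h _ _ (by
      rw [varProd, Finset.prod_singleton, hs]
      split_ifs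
      · exact kameko_X_zero
      · exact map_zero _))
    (fun f hf => by
      have hmap : ∀ i d f, f ∈ K (d + 1) → psi {i} f ∈ K d := psi_singleton_mem
      have hcomm : ∀ i j d f, f ∈ K (d + 2) → psi {i} (psi {j} f) = psi {j} (psi {i} f) :=
        fun i j d f hf => psi_singleton_comm i j (d + 1) f hf
      obtain ⟨a, ha1, ha2⟩ := exists_family (fun l => opWord (fun i : Fin 3 => psi {i}) l f) D
        (fun l l' hl hp => opWord_perm (K := K) hmap hcomm hp (e := 0)
          (by simpa [K, hl] using hf))
        (fun i j l hl => psi_singleton_cubic i j 1 _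
          (opWord_mem (K := K) hmap l (e := 3) (by simpa [K, hl] using hf)))
      have ha3 : ∀ S, a S ∈ invDual 3 0 := by
        intro S
        by_cases h : ∃ l : List (Fin 3), l.length = D ∧ l.toFinset = S
        · obtain ⟨l, hl, rfl⟩ := h
          rw [← ha1 l hl]
          exact opWord_mem (K := K) hmap l (e := 0) (by simpa [K, hl] using hf)
        · push Not at h
          rw [ha2 S h]
          exact Submodule.zero_mem _
      have hmem : ∀ v, upSum a v ∈ invDual 3 0 := fun v => Submodule.sum_mem _ fun S _ => ha3 S
      refine ⟨upSum a, fun l hl => by rw [upSum_upSum, ← ha1 l hl],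
        fun v hne hv' => absurd ((hG v).mpr hne) hv', fun v _ => hmem v, fun v _ i w => ?_⟩
      rw [← der_apply, der_eq_zero_of_mem_invDual_zero (hmem v), hs]
      split_ifs
      · rw [linSub_X, Finset.sum_singleton, ← der_apply,
          der_eq_zero_of_mem_invDual_zero (hmem v)]
      · simp)
    (fun c h0 _ hl v => by
      by_cases hne : v.Nonempty
      swap
      · exact h0 v fun h => hne ((hG v).mp h)
      rw [← upSum_upSum c v]
      refine Finset.sum_eq_zero fun S h => ?_
      have hc := Finset.card_le_univ S
      rw [Fintype.card_fin] at hc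
      obtain ⟨l, hl1, rfl⟩ := exists_list_toFinset (hne.mono (Finset.mem_filter.mp h).2)
        (hc.trans hD)
      exact hl l hl1)
    _ (mem_map_kameko_iff (n' := n) (fun i : Fin 3 => {i}) (fun i => by revert i; decide)
      (by omega) hn (fun f hf hl T hT => by
        obtain ⟨D, rfl⟩ : ∃ D', D = D' + 1 := ⟨D - 1, by omega⟩
        have h1 := psi_singleton_eq_zero D f hf hl
        rcases Nat.even_or_odd T.card with h | h
        · exact psi_eq_zero_of_even_card hf h
        · have hlt := Finset.card_lt_card (Finset.ssubset_univ_iff.mpr hT)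
          rw [Finset.card_univ, Fintype.card_fin] at hlt
          obtain ⟨i, rfl⟩ := Finset.card_eq_one.mp (show T.card = 1 by
            obtain ⟨c, hc⟩ := h
            omega)
          exact h1 i))
  rw [key, finrank_map_kameko, Finset.card_erase_of_mem (Finset.mem_univ _)]
  rfl

end ThreeVariables

section FourVariables

variable {m : ℕ}

theorem psi_eq_zero_of_card_four {d : ℕ} {f : PolyDual 4}
    (hf : f ∈ invDual 4 (iterDeg m 2 (d + 1))) {T : Finset (Fin 4)} (h2 : T.card ≠ 2)
    (h4 : T.card ≠ 4) : psi T f = 0 := by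
  have hle := Finset.card_le_univ T
  rw [Fintype.card_fin] at hle
  rcases Nat.even_or_odd T.card with ⟨c, hc⟩ | ⟨c, hc⟩
  · have h0 : T.card = 0 := by omega
    refine psi_eq_zero_of_binaryWeight hf T (Or.inl ?_)
    rw [h0]
    refine binaryWeight_pos ?_
    rw [iterDeg]; omega
  · refine (invDual_degree hf).psi_eq_zero fun e he => ?_
    rw [iterDeg] at he
    omega

theorem psi_pair_mem {a b : Fin 4} (hab : a ≠ b) (d : ℕ) (f : PolyDual 4)
    (hf : f ∈ invDual 4 (iterDeg m 2 (d + 1))) : psi {a, b} f ∈ invDual 4 (iterDeg m 2 d) := by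
  refine psi_mem hf (fun e he => ?_) fun U hU => ?_
  · rw [iterDeg, Finset.card_pair hab] at he
    omega
  · have := Finset.card_lt_card hU
    rw [Finset.card_pair hab] at this
    exact psi_eq_zero_of_card_four hf (by omega) (by omega)

variable {a b c e : Fin 4}

theorem erase_triple (hab : a ≠ b) (hac : a ≠ c) (hbc : b ≠ c) :
    ({a, b, c} : Finset (Fin 4)).erase a = {b, c} ∧
    ({a, b, c} : Finset (Fin 4)).erase b = {a, c} ∧
    ({a, b, c} : Finset (Fin 4)).erase c = {a, b} := by
  revert a b c; decide

theorem insert_triple (hab : a ≠ b) (hac : a ≠ c) (hbc : b ≠ c) (hae : a ≠ e) (hbe : b ≠ e)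
    (hce : c ≠ e) : insert c ({a, b, e} : Finset (Fin 4)) = Finset.univ := by
  revert a b c e; decide

theorem sum_der_psi_pair {d : ℕ} {f : PolyDual 4} (hf : f ∈ invDual 4 (iterDeg m 2 (d + 1)))
    (hab : a ≠ b) (hac : a ≠ c) (hbc : b ≠ c) :
    der a (psi {b, c} f) + der b (psi {a, c} f) + der c (psi {a, b} f) = 0 := by
  obtain ⟨e1, e2, e3⟩ := erase_triple hab hac hbc
  have hcard : ({a, b, c} : Finset (Fin 4)).card = 3 := Finset.card_eq_three.mpr
    ⟨a, b, c, hab, hac, hbc, rfl⟩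
  have h := sum_der_psi_erase hf (T := {a, b, c}) fun U hU hc => by
    have := Finset.card_le_card hU
    rw [hcard] at hc this
    exact psi_eq_zero_of_card_four hf (by omega) (by omega)
  rw [Finset.sum_insert (by simp [hab, hac]), Finset.sum_pair hbc, e1, e2, e3] at h
  rw [add_assoc]; exact h

theorem eq_of_add_three_eq_zero {V : Type*} [AddCommGroup V] [Module (ZMod 2) V] {x y z : V}
    (h : x + y + z = 0) : z = x + y := by
  rw [add_eq_zero_iff_eq_neg, ZModModule.neg_eq_self] at h
  exact h.symm

section Relation

variable {d : ℕ} {A B C : PolyDual 4}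

theorem psi_pair_eq_of_sum_der (hA : A ∈ invDual 4 (iterDeg m 2 (d + 1)))
    (h : der a A + der b B + der c C = 0) (hab : a ≠ b) (hac : a ≠ c) :
    psi {a, b} B = psi {a, c} C := by
  refine LinearMap.ext fun y => ?_
  have h1 := LinearMap.congr_fun h (varProd {a} * y ^ 2)
  rw [LinearMap.add_apply, LinearMap.add_apply, der_apply_varProd_of_mem (by simp),
    der_apply_varProd_of_notMem (by simpa using hab.symm),
    der_apply_varProd_of_notMem (by simpa using hac.symm), Finset.erase_singleton,
    psi_eq_zero_of_card_four hA (by simp) (by simp), map_zero, LinearMap.zero_apply, zero_add,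
    LinearMap.zero_apply, CharTwo.add_eq_zero, Finset.pair_comm b, Finset.pair_comm c] at h1
  exact h1

theorem sum_psi_pair_of_sum_der (h : der a A + der b B + der c C = 0)
    (hae : a ≠ e) (hbe : b ≠ e) (hce : c ≠ e) :
    psi {a, e} A + psi {b, e} B + psi {c, e} C = 0 := by
  refine LinearMap.ext fun y => ?_
  have h1 := LinearMap.congr_fun h (varProd {e} * y ^ 2)
  rw [LinearMap.add_apply, LinearMap.add_apply, der_apply_varProd_of_notMem (by simpa using hae),
    der_apply_varProd_of_notMem (by simpa using hbe),
    der_apply_varProd_of_notMem (by simpa using hce)] at h1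
  exact h1

theorem sum_der_psi_pair_of_sum_der (h : der a A + der b B + der c C = 0)
    (hab : a ≠ b) (hac : a ≠ c) (hbc : b ≠ c) :
    der a (psi {b, c} A) + der b (psi {a, c} B) + der c (psi {a, b} C) = 0 := by
  obtain ⟨e1, e2, e3⟩ := erase_triple hab hac hbc
  refine LinearMap.ext fun y => ?_
  have h1 := LinearMap.congr_fun h (varProd {a, b, c} * y ^ 2)
  rw [LinearMap.add_apply, LinearMap.add_apply, der_apply_varProd_of_mem (by simp),
    der_apply_varProd_of_mem (by simp), der_apply_varProd_of_mem (by simp), e1, e2, e3] at h1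
  exact h1

theorem psi_univ_of_sum_der (h : der a A + der b B + der c C = 0)
    (hab : a ≠ b) (hac : a ≠ c) (hbc : b ≠ c) (hae : a ≠ e)
    (hbe : b ≠ e) (hce : c ≠ e) :
    psi Finset.univ C = der a (psi {b, e} A) + der b (psi {a, e} B) := by
  obtain ⟨e1, e2, e3⟩ := erase_triple hab hae hbe
  refine eq_of_add_three_eq_zero (LinearMap.ext fun y => ?_)
  have h1 := LinearMap.congr_fun h (varProd {a, b, e} * y ^ 2)
  rw [LinearMap.add_apply, LinearMap.add_apply, der_apply_varProd_of_mem (by simp),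
    der_apply_varProd_of_mem (by simp),
    der_apply_varProd_of_notMem (by simp [hac.symm, hbc.symm, hce]), e1, e2,
    insert_triple hab hac hbc hae hbe hce] at h1
  exact h1

end Relation

section Quadratic

variable {d : ℕ} {f : PolyDual 4}

theorem psi_pair_comm_of_inter (hf : f ∈ invDual 4 (iterDeg m 2 (d + 2)))
    (hab : a ≠ b) (hac : a ≠ c) :
    psi {a, b} (psi {a, c} f) = psi {a, c} (psi {a, b} f) := by
  by_cases hbc : b = c
  · rw [hbc]
  exact psi_pair_eq_of_sum_der (psi_pair_mem hbc _ _ hf) (sum_der_psi_pair hf hab hac hbc)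
    hab hac

theorem psi_pair_plucker (hf : f ∈ invDual 4 (iterDeg m 2 (d + 1)))
    (hab : a ≠ b) (hac : a ≠ c) (hbc : b ≠ c) (hae : a ≠ e) (hbe : b ≠ e) (hce : c ≠ e) :
    psi {a, e} (psi {b, c} f) + psi {b, e} (psi {a, c} f) + psi {c, e} (psi {a, b} f) = 0 :=
  sum_psi_pair_of_sum_der (sum_der_psi_pair hf hab hac hbc) hae hbe hce

theorem psi_pair_sq_inter (hf : f ∈ invDual 4 (iterDeg m 2 (d + 3)))
    (hab : a ≠ b) (hac : a ≠ c) :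
    psi {a, b} (psi {a, c} (psi {a, c} f)) = psi {a, c} (psi {a, b} (psi {a, b} f)) := by
  by_cases hbc : b = c
  · rw [hbc]
  exact psi_pair_eq_of_sum_der (psi_pair_mem hbc _ _ (psi_pair_mem hbc _ _ hf))
    (sum_der_psi_pair_of_sum_der (sum_der_psi_pair hf hab hac hbc) hab hac hbc) hab hac

theorem psi_pair_sq_plucker (hf : f ∈ invDual 4 (iterDeg m 2 (d + 1)))
    (hab : a ≠ b) (hac : a ≠ c) (hbc : b ≠ c) (hae : a ≠ e) (hbe : b ≠ e) (hce : c ≠ e) :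
    psi {a, e} (psi {b, c} (psi {b, c} f)) + psi {b, e} (psi {a, c} (psi {a, c} f)) +
      psi {c, e} (psi {a, b} (psi {a, b} f)) = 0 :=
  sum_psi_pair_of_sum_der
    (sum_der_psi_pair_of_sum_der (sum_der_psi_pair hf hab hac hbc) hab hac hbc) hae hbe hce

theorem psi_univ_psi_pair (hf : f ∈ invDual 4 (iterDeg m 2 (d + 1)))
    (hab : a ≠ b) (hac : a ≠ c) (hbc : b ≠ c) (hae : a ≠ e) (hbe : b ≠ e) (hce : c ≠ e) :
    psi Finset.univ (psi {a, b} f) =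
      der a (psi {b, e} (psi {b, c} f)) + der b (psi {a, e} (psi {a, c} f)) :=
  psi_univ_of_sum_der (sum_der_psi_pair hf hab hac hbc) hab hac hbc hae hbe hce

theorem sum_psi_psi_compl (hf : f ∈ invDual 4 (iterDeg m 2 (d + 2))) :
    ∑ U ∈ Finset.powersetCard 2 Finset.univ, psi U (psi Uᶜ f) = 0 := by
  have hdeg : (∑ U ∈ Finset.powersetCard 2 Finset.univ, psi U (psi Uᶜ f) :
      PolyDual 4).HasDegree (iterDeg m 2 d) := by
    refine PolyDual.HasDegree.sum fun U hU => ?_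
    have hU' := (Finset.mem_powersetCard.mp hU).2
    have h1 : Uᶜ.card = 2 := by rw [Finset.card_compl, Fintype.card_fin, hU']
    refine ((invDual_degree hf).psi (m := iterDeg m 2 (d + 1)) fun e he => ?_).psi fun e he => ?_
    · rw [h1, iterDeg] at he; omega
    · rw [hU', iterDeg] at he; omega
  have hpsi : ∀ U : Finset (Fin 4), ∀ g : PolyDual 4, ∀ y : MvPolynomial (Fin 4) (ZMod 2),
      g (varProd U * SqTotal 4 (y ^ 2)) = psi U g (SqTotal 4 y) := by
    intro U g y
    rw [psi_apply, map_pow]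
  refine hdeg.eq_zero_of_sqTotal fun y => ?_
  have h1 := psi_star hf Finset.univ (y ^ 2)
  have hβ : psi ∅ (psi Finset.univ f) = 0 := by
    have h2 : (psi Finset.univ f).HasDegree (iterDeg m 2 (d + 1) - 1) :=
      (invDual_degree hf).psi fun e he => by
        rw [Finset.card_univ, Fintype.card_fin, iterDeg] at he
        omega
    refine h2.psi_eq_zero fun e he => ?_
    rw [iterDeg, Finset.card_empty] at he
    omega
  have h3 : psi Finset.univ f (y ^ 2) = 0 := by
    have := LinearMap.congr_fun hβ y
    rw [psi_apply, varProd, Finset.prod_empty, one_mul] at this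
    exact this
  rw [h3, ← Finset.sum_subset (s₁ := Finset.powersetCard 2 Finset.univ)] at h1
  · rw [LinearMap.sum_apply]
    refine Eq.trans (Finset.sum_congr rfl fun U _ => ?_) h1
    rw [hpsi, Finset.compl_eq_univ_sdiff]
  · intro U _; simp
  · intro U _ hU
    rw [Finset.mem_powersetCard_univ] at hU
    have h4 := Finset.card_sdiff_add_card_eq_card (Finset.subset_univ U)
    rw [Finset.card_univ, Fintype.card_fin] at h4
    rw [hpsi]
    by_cases h5 : U.card = 0
    · rw [Finset.card_eq_zero.mp h5, Finset.sdiff_empty, hβ]; rfl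
    · rw [psi_eq_zero_of_card_four hf (by omega) (by omega), map_zero]; rfl

theorem psi_pair_comm_of_disjoint (hf : f ∈ invDual 4 (iterDeg m 2 (d + 2)))
    (hab : a ≠ b) (hac : a ≠ c) (hbc : b ≠ c) (hae : a ≠ e) (hbe : b ≠ e) (hce : c ≠ e) :
    psi {a, b} (psi {c, e} f) = psi {c, e} (psi {a, b} f) := by
  have h1 := psi_pair_plucker hf hab hac hbc hae hbe hce
  have h2 := psi_pair_plucker hf hab hae hbe hac hbc hce.symm
  have h3 := psi_pair_plucker hf hac hae hce hab hbc.symm hbe.symm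
  have h4 := psi_pair_plucker hf hbc hbe hce hab.symm hac.symm hae.symm
  have h5 := sum_psi_psi_compl hf
  have hU : Finset.powersetCard 2 (Finset.univ : Finset (Fin 4)) =
      {{a, b}, {a, c}, {a, e}, {b, c}, {b, e}, {c, e}} := by
    clear h1 h2 h3 h4 h5
    revert a b c e; decide
  have hc1 : ({a, b} : Finset (Fin 4))ᶜ = {c, e} ∧ ({a, c} : Finset (Fin 4))ᶜ = {b, e} ∧
      ({a, e} : Finset (Fin 4))ᶜ = {b, c} ∧ ({b, c} : Finset (Fin 4))ᶜ = {a, e} ∧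
      ({b, e} : Finset (Fin 4))ᶜ = {a, c} ∧ ({c, e} : Finset (Fin 4))ᶜ = {a, b} := by
    clear h1 h2 h3 h4 h5 hU
    revert a b c e; decide
  have hn : ({a, b} : Finset (Fin 4)) ∉ ({{a, c}, {a, e}, {b, c}, {b, e}, {c, e}} :
        Finset (Finset (Fin 4))) ∧
      ({a, c} : Finset (Fin 4)) ∉ ({{a, e}, {b, c}, {b, e}, {c, e}} : Finset (Finset (Fin 4))) ∧
      ({a, e} : Finset (Fin 4)) ∉ ({{b, c}, {b, e}, {c, e}} : Finset (Finset (Fin 4))) ∧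
      ({b, c} : Finset (Fin 4)) ∉ ({{b, e}, {c, e}} : Finset (Finset (Fin 4))) ∧
      ({b, e} : Finset (Fin 4)) ≠ {c, e} := by
    clear h1 h2 h3 h4 h5 hU hc1
    revert a b c e; decide
  obtain ⟨n1, n2, n3, n4, n5⟩ := hn
  obtain ⟨c1, c2, c3, c4, c5, c6⟩ := hc1
  rw [hU, Finset.sum_insert n1, Finset.sum_insert n2, Finset.sum_insert n3, Finset.sum_insert n4,
    Finset.sum_pair n5, c1, c2, c3, c4, c5, c6] at h5
  rw [Finset.pair_comm e c] at h2
  rw [Finset.pair_comm c b, Finset.pair_comm e b] at h3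
  rw [Finset.pair_comm b a, Finset.pair_comm c a, Finset.pair_comm e a] at h4
  refine LinearMap.ext fun y => ?_
  replace h1 := LinearMap.congr_fun h1 y
  replace h2 := LinearMap.congr_fun h2 y
  replace h3 := LinearMap.congr_fun h3 y
  replace h4 := LinearMap.congr_fun h4 y
  replace h5 := LinearMap.congr_fun h5 y
  simp only [LinearMap.add_apply, LinearMap.zero_apply] at h1 h2 h3 h4 h5
  grind

end Quadratic

end FourVariables

/-- The six pairs of indices of four variables; `Fin.rev` takes a pair to its complement. -/
def pairSet : Fin 6 → Finset (Fin 4) := ![{0, 1}, {0, 2}, {0, 3}, {1, 2}, {1, 3}, {2, 3}]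

section PairOperators

variable {m : ℕ}

theorem psi_pair_sq_couple {a b c e : Fin 4} {d : ℕ} {f : PolyDual 4}
    (hf : f ∈ invDual 4 (iterDeg m 2 (d + 1)))
    (hab : a ≠ b) (hac : a ≠ c) (hbc : b ≠ c) (hae : a ≠ e) (hbe : b ≠ e) (hce : c ≠ e) :
    psi {b, e} (psi {a, c} (psi {a, c} f)) + psi {a, c} (psi {b, e} (psi {b, e} f)) =
      psi {a, e} (psi {b, c} (psi {b, c} f)) + psi {b, c} (psi {a, e} (psi {a, e} f)) := by
  have h1 := psi_pair_sq_plucker hf hab hac hbc hae hbe hce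
  have h2 := psi_pair_sq_plucker hf hab hae hbe hac hbc hce.symm
  rw [Finset.pair_comm e c] at h2
  refine LinearMap.ext fun y => ?_
  replace h1 := LinearMap.congr_fun h1 y
  replace h2 := LinearMap.congr_fun h2 y
  simp only [LinearMap.add_apply, LinearMap.zero_apply] at h1 h2 ⊢
  grind

theorem psi_pair_comp_couple {a b c e : Fin 4} {d : ℕ} {f : PolyDual 4}
    (hf : f ∈ invDual 4 (iterDeg m 2 (d + 4)))
    (hab : a ≠ b) (hac : a ≠ c) (hbc : b ≠ c) (hae : a ≠ e) (hbe : b ≠ e) (hce : c ≠ e) :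
    psi {a, b} (psi {b, e} (psi {a, c} (psi {a, c} f))) =
      psi {a, b} (psi {a, c} (psi {b, e} (psi {b, e} f))) := by
  have hf1 := psi_pair_mem hac (d + 3) f hf
  have hf2 := psi_pair_mem hac (d + 2) _ hf1
  have hf3 := psi_pair_mem hbe (d + 3) f hf
  have hf4 := psi_pair_mem hbe (d + 2) _ hf3
  have hf5 := psi_pair_mem hab (d + 3) f hf
  have hf6 := psi_pair_mem hab (d + 2) _ hf5
  rw [psi_pair_comm_of_inter hf4 hab hac, Finset.pair_comm a b,
    psi_pair_comm_of_inter hf2 hab.symm hbe, psi_pair_sq_inter (d := d + 1) hf hab.symm hbe,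
    Finset.pair_comm b a, psi_pair_sq_inter (d := d + 1) hf hab hac,
    psi_pair_comm_of_disjoint hf6 hac hab hbc.symm hae hce hbe]

theorem pairSet_eq_pair (I : Fin 6) : ∃ a b, a ≠ b ∧ pairSet I = {a, b} := by
  revert I; decide

theorem psi_pairSet_mem (I : Fin 6) (d : ℕ) (f : PolyDual 4)
    (hf : f ∈ invDual 4 (iterDeg m 2 (d + 1))) :
    psi (pairSet I) f ∈ invDual 4 (iterDeg m 2 d) := by
  obtain ⟨a, b, hab, h⟩ := pairSet_eq_pair I
  rw [h]
  exact psi_pair_mem hab d f hf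

theorem pairSet_inter_or_disjoint (I J : Fin 6) :
    (∃ a b c, a ≠ b ∧ a ≠ c ∧ pairSet I = {a, b} ∧ pairSet J = {a, c}) ∨
    ∃ a b c e, a ≠ b ∧ a ≠ c ∧ b ≠ c ∧ a ≠ e ∧ b ≠ e ∧ c ≠ e ∧ pairSet I = {a, b} ∧
      pairSet J = {c, e} := by
  revert I J; decide +kernel

theorem psi_pairSet_comm (I J : Fin 6) (d : ℕ) (f : PolyDual 4)
    (hf : f ∈ invDual 4 (iterDeg m 2 (d + 2))) :
    psi (pairSet I) (psi (pairSet J) f) = psi (pairSet J) (psi (pairSet I) f) := by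
  rcases pairSet_inter_or_disjoint I J with
    ⟨a, b, c, hab, hac, h1, h2⟩ | ⟨a, b, c, e, hab, hac, hbc, hae, hbe, hce, h1, h2⟩
  · rw [h1, h2]
    exact psi_pair_comm_of_inter hf hab hac
  · rw [h1, h2]
    exact psi_pair_comm_of_disjoint hf hab hac hbc hae hbe hce

set_option synthInstance.maxSize 100000 in
theorem pairSet_triple (R I J : Fin 6) :
    (∃ a b c, a ≠ b ∧ a ≠ c ∧ pairSet I = {a, b} ∧ pairSet J = {a, c}) ∨
    ∃ a b c e, (a ≠ b ∧ a ≠ c ∧ b ≠ c ∧ a ≠ e ∧ b ≠ e ∧ c ≠ e) ∧ pairSet R = {a, b} ∧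
      (pairSet I = {a, c} ∧ pairSet J = {b, e} ∨ pairSet I = {a, b} ∧ pairSet J = {c, e} ∨
        pairSet I = {c, e} ∧ pairSet J = {a, b}) := by
  revert R I J; decide +kernel

theorem psi_pairSet_cubic (R I J : Fin 6) (d : ℕ) (f : PolyDual 4)
    (hf : f ∈ invDual 4 (iterDeg m 2 (d + 4))) :
    psi (pairSet R) (psi (pairSet I) (psi (pairSet I) (psi (pairSet J) f))) =
      psi (pairSet R) (psi (pairSet I) (psi (pairSet J) (psi (pairSet J) f))) := by
  rw [psi_pairSet_comm I J (d + 2) f hf,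
    psi_pairSet_comm I J (d + 1) _ (psi_pairSet_mem I _ f hf)]
  rcases pairSet_triple R I J with
    ⟨a, b, c, hab, hac, h1, h2⟩ | ⟨a, b, c, e, ⟨hab, hac, hbc, hae, hbe, hce⟩, h, h3⟩
  · rw [h1, h2, psi_pair_sq_inter (d := d + 1) hf hac hab]
  · have h4 := psi_pair_sq_couple (d := d + 3) hf hac hab hbc.symm hae hce hbe
    have h5 := psi_pair_comp_couple hf hab hac hbc hae hbe hce
    rw [Finset.pair_comm c b, ← psi_pair_sq_couple (d := d + 3) hf hab hac hbc hae hbe hce] at h4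
    have h6 := congrArg (psi {a, b}) h4
    rw [map_add, map_add, h5, ZModModule.add_self, add_eq_zero_iff_eq_neg,
      ZModModule.neg_eq_self] at h6
    rw [h]
    rcases h3 with ⟨h1, h2⟩ | ⟨h1, h2⟩ | ⟨h1, h2⟩ <;> rw [h1, h2]
    · exact h5
    · exact h6
    · exact h6.symm

theorem psi_pairSet_eq_zero (d : ℕ) : ∀ f ∈ invDual 4 (iterDeg m 2 (d + 1)),
    (∀ l : List (Fin 6), l.length = d + 1 → opWord (fun I => psi (pairSet I)) l f = 0) →
    ∀ I, psi (pairSet I) f = 0 := by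
  induction d with
  | zero => intro f _ h I; exact h [I] rfl
  | succ d ih =>
    intro f hf h J
    have h1 : ∀ I J, psi (pairSet I) (psi (pairSet J) f) = 0 := fun I J =>
      ih _ (psi_pairSet_mem J _ f hf) (fun l hl => by
        have := h (l ++ [J]) (by simp [hl])
        rwa [opWord_append] at this) I
    have h2 : ∀ a b a' b', a ≠ b → a' ≠ b' → psi {a', b'} (psi {a, b} f) = 0 := by
      have hs : ∀ a b : Fin 4, a ≠ b → ∃ I, pairSet I = {a, b} := by decide
      intro a b a' b' hab hab'
      obtain ⟨I, hI⟩ := hs a b hab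
      obtain ⟨I', hI'⟩ := hs a' b' hab'
      rw [← hI, ← hI']
      exact h1 I' I
    obtain ⟨a, b, c, e, ⟨hab, hac, hbc, hae, hbe, hce⟩, hJ⟩ : ∃ a b c e,
        (a ≠ b ∧ a ≠ c ∧ b ≠ c ∧ a ≠ e ∧ b ≠ e ∧ c ≠ e) ∧ pairSet J = {a, b} := by
      revert J; decide +kernel
    rw [hJ]
    refine PolyDual.ext_psi fun T => ?_
    rw [map_zero]
    by_cases h3 : T.card = 2
    · obtain ⟨x, y, hxy, rfl⟩ := Finset.card_eq_two.mp h3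
      exact h2 a b x y hab hxy
    by_cases h4 : T.card = 4
    · rw [(Finset.card_eq_iff_eq_univ T).mp (by rw [h4, Fintype.card_fin]),
        psi_univ_psi_pair hf hab hac hbc hae hbe hce, h2 _ _ _ _ hbc hbe, h2 _ _ _ _ hac hae,
        map_zero, map_zero, add_zero]
    · exact psi_eq_zero_of_card_four (psi_pair_mem hab _ f hf) h3 h4

end PairOperators

section FamilyRelations

variable {V : Type*} [AddCommGroup V] [Module (ZMod 2) V]

theorem sum_apply_union_eq_zero {I : Type*} [DecidableEq I] (a : Finset I → V) {x : I}
    {U : Finset I} (hx : x ∈ U) {F : Finset (Finset I)}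
    (hF : ∀ T ∈ F, T.erase x ∈ F ∧ insert x T ∈ F) : ∑ T ∈ F, a (U ∪ T) = 0 := by
  refine Finset.sum_involution (fun S _ => if x ∈ S then S.erase x else insert x S) ?_ ?_ ?_ ?_
  · intro S _
    have h1 : ∀ T, U ∪ insert x T = U ∪ T := fun T => by
      rw [Finset.union_insert, ← Finset.insert_union, Finset.insert_eq_of_mem hx]
    split_ifs with h
    · rw [← h1 (S.erase x), Finset.insert_erase h, ZModModule.add_self]
    · rw [h1, ZModModule.add_self]
  · intro S _ _
    split_ifs with h
    · intro h'; rw [← h'] at h; simp at h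
    · intro h'; apply h; rw [← h']; simp
  · intro S hS
    split_ifs with h
    · exact (hF S hS).1
    · exact (hF S hS).2
  · intro S _
    by_cases h : x ∈ S <;> simp [h]

theorem sum_superset_union {I : Type*} [DecidableEq I] [Fintype I] (a : Finset I → V)
    (U v : Finset I) :
    ∑ T ∈ Finset.univ.filter (v ⊆ ·), a (U ∪ T) = if U ⊆ v then upSum a v else 0 := by
  split_ifs with h
  · refine Finset.sum_congr rfl fun T hT => ?_
    rw [Finset.union_eq_right.mpr (h.trans (Finset.mem_filter.mp hT).2)]
  · obtain ⟨x, hx, hxv⟩ := Finset.not_subset.mp h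
    refine sum_apply_union_eq_zero a hx fun T hT => ?_
    simp only [Finset.mem_filter, Finset.mem_univ, true_and] at hT ⊢
    exact ⟨Finset.subset_erase.mpr ⟨hT, hxv⟩, hT.trans (Finset.subset_insert _ _)⟩

/-- The three couples of complementary pairs. -/
def couples : Finset (Finset (Fin 6)) := {{0, 5}, {1, 4}, {2, 3}}

theorem sum_couples_eq_zero {a : Finset (Fin 6) → V} (h0 : a Finset.univ = 0)
    (h : ∀ S : Finset (Fin 6), S.Nonempty → S.card ≤ 3 → ∑ U ∈ couples, a (U ∪ S) = 0)
    (n : ℕ) : ∀ S : Finset (Fin 6), S.card = n → S.Nonempty → ∑ U ∈ couples, a (U ∪ S) = 0 := by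
  induction n using Nat.strong_induction_on with
  | _ n ih =>
  intro S hn hS
  by_cases hc : S.card ≤ 3
  · exact h S hS hc
  by_cases hA : ∃ A ∈ S, ∀ U ∈ couples, ∃ x ∈ U, x ∈ S ∧ x ≠ A
  · obtain ⟨A, hAS, hA⟩ := hA
    have h1 : ∑ T ∈ S.powerset.filter (A ∈ ·), ∑ U ∈ couples, a (U ∪ T) = 0 := by
      rw [Finset.sum_comm]
      refine Finset.sum_eq_zero fun U hU => ?_
      obtain ⟨x, hxU, hxS, hxA⟩ := hA U hU
      refine sum_apply_union_eq_zero a hxU fun T hT => ?_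
      simp only [Finset.mem_filter, Finset.mem_powerset] at hT ⊢
      exact ⟨⟨(Finset.erase_subset _ _).trans hT.1, Finset.mem_erase.mpr ⟨hxA.symm, hT.2⟩⟩,
        Finset.insert_subset hxS hT.1, Finset.mem_insert_of_mem hT.2⟩
    rwa [Finset.sum_eq_single_of_mem S (by simp [hAS])] at h1
    intro T hT hne
    simp only [Finset.mem_filter, Finset.mem_powerset] at hT
    exact ih T.card (hn ▸ Finset.card_lt_card (hT.1.ssubset_of_ne hne)) T rfl ⟨A, hT.2⟩
  · have h2 : ∀ S : Finset (Fin 6), ¬ S.card ≤ 3 →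
        (¬ ∃ A ∈ S, ∀ U ∈ couples, ∃ x ∈ U, x ∈ S ∧ x ≠ A) →
        ∃ U ∈ couples, U ∪ S = Finset.univ ∧ ∀ U' ∈ couples.erase U, U' ∪ S = S := by
      decide +kernel
    obtain ⟨U, hU, hUS, hU'⟩ := h2 S hc hA
    have h3 : ∀ U ∈ couples, (couples.erase U).card = 2 := by decide
    rw [← Finset.add_sum_erase _ _ hU, hUS, h0, zero_add,
      Finset.sum_congr rfl fun U' hU'' => by rw [hU' U' hU''], Finset.sum_const, h3 U hU,
      two_nsmul, ZModModule.add_self]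

theorem exists_union_eq_add_of_card_five {a : Finset (Fin 6) → V}
    (h : ∀ S : Finset (Fin 6), S.Nonempty → ∑ U ∈ couples, a (U ∪ S) = 0)
    {S : Finset (Fin 6)} (hS : S.card = 5) :
    ∃ R R' : Finset (Fin 6), R.Nonempty ∧ R'.Nonempty ∧ R.card ≤ 4 ∧ R'.card ≤ 4 ∧
      ∀ T, a (T ∪ S) = a (T ∪ R) + a (T ∪ R') := by
  have h1 : ∀ S : Finset (Fin 6), S.card = 5 → ∃ R' ∈ S.powersetCard 3, ∃ U₁ ∈ couples,
      ∃ U₂ ∈ couples, ∃ U₃ ∈ couples, couples = {U₁, U₂, U₃} ∧ U₁ ∉ ({U₂, U₃} : Finset _) ∧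
        U₂ ≠ U₃ ∧ (U₁ ∪ R').card = 4 ∧ U₂ ∪ R' = R' ∧ U₃ ∪ R' = S := by
    decide +kernel
  obtain ⟨R', hR', U₁, _, U₂, _, U₃, _, hc, h12, h23, hU₁, hU₂, hU₃⟩ := h1 S hS
  have hR'3 := (Finset.mem_powersetCard.mp hR').2
  have hne : R'.Nonempty := Finset.card_pos.mp (by omega)
  refine ⟨U₁ ∪ R', R', hne.mono Finset.subset_union_right, hne, by omega, by omega, fun T => ?_⟩
  have h2 := h (T ∪ R') (hne.mono Finset.subset_union_right)
  rw [hc, Finset.sum_insert h12, Finset.sum_pair h23, ← add_assoc, Finset.union_left_comm U₁,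
    Finset.union_left_comm U₂, Finset.union_left_comm U₃, hU₂, hU₃] at h2
  exact eq_of_add_three_eq_zero h2

theorem triangle_relation {a : Finset (Fin 6) → V} (h0 : a Finset.univ = 0)
    (h : ∀ S : Finset (Fin 6), S.Nonempty → ∑ U ∈ couples, a (U ∪ S) = 0)
    {x y z : Fin 6} (Dx Dy Dz : V →ₗ[ZMod 2] V)
    (hD : ∀ S : Finset (Fin 6), S.Nonempty → S.card ≤ 4 →
      Dx (a ({x} ∪ S)) + Dy (a ({y} ∪ S)) + Dz (a ({z} ∪ S)) = 0)
    {S : Finset (Fin 6)} (hS : S.Nonempty) :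
    Dx (a ({x} ∪ S)) + Dy (a ({y} ∪ S)) + Dz (a ({z} ∪ S)) = 0 := by
  by_cases h4 : S.card ≤ 4
  · exact hD S hS h4
  by_cases h5 : S.card = 5
  · obtain ⟨R, R', hR, hR', hc, hc', he⟩ := exists_union_eq_add_of_card_five h h5
    have h1 := hD R hR hc
    have h2 := hD R' hR' hc'
    rw [he, he, he, map_add, map_add, map_add]
    calc _ = _ := by abel
      _ = _ := congrArg₂ (· + ·) h1 h2
      _ = 0 := add_zero 0
  · have h6 := Finset.card_le_univ S
    rw [Fintype.card_fin] at h6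
    have h7 : S = Finset.univ := (Finset.card_eq_iff_eq_univ S).mp (by rw [Fintype.card_fin]; omega)
    simp only [h7, Finset.union_eq_right.mpr (Finset.subset_univ _), h0, map_zero, add_zero]

end FamilyRelations

/-- The two elements of `pairSet I`. -/
def pairElem (I : Fin 6) : Fin 2 → Fin 4 :=
  ![(![0, 0, 0, 1, 1, 2] : Fin 6 → Fin 4) I, (![1, 2, 3, 2, 3, 3] : Fin 6 → Fin 4) I]

/-- The coordinates of the `i`-th variable on the plane with Plücker support `v`, with respect to
the pair `P ∈ v`. -/
def planeCoord (v : Finset (Fin 6)) (P : Fin 6) (i : Fin 4) : Finset (Fin 2) :=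
  Finset.univ.filter fun j => {i, pairElem P (j + 1)} ∈ v.image pairSet

/-- The Plücker supports of the planes in a four-dimensional space over the field with two
elements. -/
def pluckerSupports : Finset (Finset (Fin 6)) :=
  Finset.univ.filter fun v => v.Nonempty ∧ Even (couples.filter (· ⊆ v)).card

theorem card_pluckerSupports : pluckerSupports.card = 35 := by decide +kernel

theorem planeCoord_pairElem {v : Finset (Fin 6)} {P : Fin 6} (hP : P ∈ v) (j : Fin 2) :
    planeCoord v P (pairElem P j) = {j} := by
  have h : ∀ v : Finset (Fin 6), ∀ P ∈ v, ∀ j, planeCoord v P (pairElem P j) = {j} := by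
    decide +kernel
  exact h v P hP j

theorem pairSet_eq_pairElem (I : Fin 6) :
    pairElem I 0 ≠ pairElem I 1 ∧ pairSet I = {pairElem I 0, pairElem I 1} := by
  revert I; decide

theorem sum_planeCoord {v : Finset (Fin 6)} (hv : v ∈ pluckerSupports) {P : Fin 6} (hP : P ∈ v)
    (I : Fin 6) : (∑ j ∈ planeCoord v P (pairElem I 0), ∑ l ∈ planeCoord v P (pairElem I 1),
      if j = l then (0 : ZMod 2) else 1) = if I ∈ v then 1 else 0 := by
  have h : ∀ v ∈ pluckerSupports, ∀ P ∈ v, ∀ I, (∑ j ∈ planeCoord v P (pairElem I 0),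
      ∑ l ∈ planeCoord v P (pairElem I 1), if j = l then (0 : ZMod 2) else 1) =
        if I ∈ v then 1 else 0 := by
    decide +kernel
  exact h v hv P hP I

theorem kameko_X_mul_X (j l : Fin 2) : kameko 2 (X j * X l) = if j = l then 0 else 1 := by
  have h1 : (Finset.univ.erase (j + 1) : Finset (Fin 2)) = {j} := by revert j; decide
  have h2 := kameko_varProd_erase_mul_X (j + 1) l
  rw [h1, varProd, Finset.prod_singleton] at h2
  rw [h2]
  have h3 : ∀ j l : Fin 2, l = j + 1 ↔ ¬ j = l := by decide
  by_cases h : j = l <;> simp [h3, h]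

theorem kameko_linSub_planeCoord {v : Finset (Fin 6)} (hv : v ∈ pluckerSupports) {P : Fin 6}
    (hP : P ∈ v) (I : Fin 6) :
    kameko 2 (linSub (planeCoord v P) (varProd (pairSet I))) = if I ∈ v then 1 else 0 := by
  obtain ⟨h1, h2⟩ := pairSet_eq_pairElem I
  rw [h2, varProd, Finset.prod_pair h1, map_mul, linSub_X, linSub_X, Finset.sum_mul_sum, map_sum]
  simp_rw [map_sum, kameko_X_mul_X]
  have h3 := congrArg (C (σ := Fin 2)) (sum_planeCoord hv hP I)
  simpa [map_sum, apply_ite] using h3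

theorem exists_pair_family {m D : ℕ} (hD : 5 ≤ D) {f : PolyDual 4}
    (hf : f ∈ invDual 4 (iterDeg m 2 D)) :
    ∃ a : Finset (Fin 6) → PolyDual 4,
      (∀ l, l.length = D → opWord (fun I => psi (pairSet I)) l f = a l.toFinset) ∧
      (∀ S, a S ∈ invDual 4 m) ∧
      (∀ S : Finset (Fin 6), S.Nonempty → ∑ U ∈ couples, a (U ∪ S) = 0) ∧
      ∀ x y z : Fin 6, ∀ i p q : Fin 4, i ≠ p → i ≠ q → p ≠ q → pairSet x = {p, q} →
        pairSet y = {i, q} → pairSet z = {i, p} → ∀ S : Finset (Fin 6), S.Nonempty →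
        der i (a ({x} ∪ S)) + der p (a ({y} ∪ S)) + der q (a ({z} ∪ S)) = 0 := by
  let K : ℕ → Submodule (ZMod 2) (PolyDual 4) := fun d => invDual 4 (iterDeg m 2 d)
  have hmap : ∀ I d f, f ∈ K (d + 1) → psi (pairSet I) f ∈ K d := psi_pairSet_mem
  have hcomm : ∀ I J d f, f ∈ K (d + 2) →
      psi (pairSet I) (psi (pairSet J) f) = psi (pairSet J) (psi (pairSet I) f) :=
    psi_pairSet_comm
  have hperm : ∀ l l' : List (Fin 6), l.length = D → l.Perm l' →
      opWord (fun I => psi (pairSet I)) l f = opWord (fun I => psi (pairSet I)) l' f :=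
    fun l l' hl hp => opWord_perm (K := K) hmap hcomm hp (e := 0) (by simpa [K, hl] using hf)
  obtain ⟨a, ha1, ha2⟩ := exists_family (fun l => opWord (fun I => psi (pairSet I)) l f) D
    hperm (fun I J l hl => by
      rcases l with _ | ⟨R, l⟩
      · simp at hl; omega
      have hp : ∀ x y z : Fin 6,
          (x :: y :: z :: R :: l).Perm (R :: x :: y :: z :: l) := fun x y z =>
        ((((List.Perm.swap R z l).cons y).trans (List.Perm.swap R y _)).cons x).trans
          (List.Perm.swap R x _)
      rw [hperm _ _ (by simpa using hl) (hp I I J), hperm _ _ (by simpa using hl) (hp I J J)]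
      exact psi_pairSet_cubic R I J 0 _ (opWord_mem (K := K) hmap l (e := 4) (by
        rw [show l.length + 4 = D by simpa using hl]; exact hf)))
  have hmem : ∀ S, a S ∈ invDual 4 m := fun S => by
    by_cases h : ∃ l : List (Fin 6), l.length = D ∧ l.toFinset = S
    · obtain ⟨l, hl, rfl⟩ := h
      rw [← ha1 l hl]
      exact opWord_mem (K := K) hmap l (e := 0) (by simpa [K, hl] using hf)
    · push Not at h
      rw [ha2 S h]
      exact Submodule.zero_mem _
  have hword : ∀ (e : ℕ) (S : Finset (Fin 6)), S.Nonempty → S.card + e ≤ D →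
      ∃ g ∈ K e, ∀ l : List (Fin 6), l.length = e →
        opWord (fun I => psi (pairSet I)) l g = a (l.toFinset ∪ S) := fun e S hS hc => by
    obtain ⟨l, hl, rfl⟩ := exists_list_toFinset hS (D := D - e) (by omega)
    refine ⟨opWord (fun I => psi (pairSet I)) l f, opWord_mem (K := K) hmap l (e := e) ?_,
      fun l' hl' => ?_⟩
    · rw [hl, Nat.sub_add_cancel (by omega)]; exact hf
    · rw [← opWord_append, ha1 _ (by rw [List.length_append]; omega), List.toFinset_append]
  have hPl : ∀ S : Finset (Fin 6), S.Nonempty → S.card + 2 ≤ D →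
      ∑ U ∈ couples, a (U ∪ S) = 0 := fun S hS hc => by
    obtain ⟨g, hg, hl⟩ := hword 2 S hS hc
    have h1 := psi_pair_plucker (a := 0) (b := 1) (c := 2) (e := 3) (d := 1) hg (by decide)
      (by decide) (by decide) (by decide) (by decide) (by decide)
    have h2 : couples = {[2, 3].toFinset, [4, 1].toFinset, [5, 0].toFinset} := by decide
    rw [h2, Finset.sum_insert (by decide), Finset.sum_pair (by decide), ← hl _ rfl, ← hl _ rfl,
      ← hl _ rfl, ← add_assoc]
    exact h1
  have h0 : a Finset.univ = 0 := by
    by_cases hD6 : D = 5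
    · refine ha2 _ fun l hl h => ?_
      have h1 := l.toFinset_card_le
      rw [h, Finset.card_univ, Fintype.card_fin] at h1
      omega
    · have h1 := hPl {1, 2, 3, 4} ⟨1, by decide⟩ (by
        rw [show ({1, 2, 3, 4} : Finset (Fin 6)).card = 4 by decide]; omega)
      rw [couples, Finset.sum_insert (by decide), Finset.sum_pair (by decide),
        show ({0, 5} ∪ {1, 2, 3, 4} : Finset (Fin 6)) = Finset.univ by decide,
        show ({1, 4} ∪ {1, 2, 3, 4} : Finset (Fin 6)) = {1, 2, 3, 4} by decide,
        show ({2, 3} ∪ {1, 2, 3, 4} : Finset (Fin 6)) = {1, 2, 3, 4} by decide,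
        ZModModule.add_self, add_zero] at h1
      exact h1
  have hPl' : ∀ S : Finset (Fin 6), S.Nonempty → ∑ U ∈ couples, a (U ∪ S) = 0 := fun S hS =>
    sum_couples_eq_zero h0 (fun S hS hc => hPl S hS (by omega)) S.card S rfl hS
  refine ⟨a, ha1, hmem, hPl', fun x y z i p q hip hiq hpq hx hy hz S hS =>
    triangle_relation h0 hPl' (der i) (der p) (der q) (fun S hS hc => ?_) hS⟩
  obtain ⟨g, hg, hl⟩ := hword 1 S hS (by omega)
  have h1 : ∀ x : Fin 6, a ({x} ∪ S) = psi (pairSet x) g := fun x => (hl [x] rfl).symm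
  rw [h1, h1, h1, hx, hy, hz]
  exact sum_der_psi_pair (d := 0) hg hip hiq hpq

theorem upSum_pair_family {V : Type*} [AddCommGroup V] [Module (ZMod 2) V]
    {a : Finset (Fin 6) → V}
    (h : ∀ S : Finset (Fin 6), S.Nonempty → ∑ U ∈ couples, a (U ∪ S) = 0)
    {v : Finset (Fin 6)} (hv : v.Nonempty) (hG : v ∉ pluckerSupports) : upSum a v = 0 := by
  have h1 : ∑ T ∈ Finset.univ.filter (v ⊆ ·), ∑ U ∈ couples, a (U ∪ T) = 0 :=
    Finset.sum_eq_zero fun T hT => h T (hv.mono (Finset.mem_filter.mp hT).2)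
  rw [Finset.sum_comm] at h1
  simp_rw [sum_superset_union] at h1
  rw [← Finset.sum_filter, Finset.sum_const] at h1
  have h2 : ¬ Even (couples.filter (· ⊆ v)).card := fun h' => hG (by simp [pluckerSupports, hv, h'])
  obtain ⟨c, hc⟩ := Nat.not_even_iff_odd.mp h2
  rw [hc, add_nsmul, one_nsmul, mul_comm, mul_nsmul, two_nsmul, ZModModule.add_self,
    zero_add] at h1
  exact h1

theorem mem_image_pairSet {v : Finset (Fin 6)} {x : Fin 6} {i q : Fin 4}
    (hx : pairSet x = {i, q}) : {i, q} ∈ v.image pairSet ↔ x ∈ v := by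
  have hinj : Function.Injective pairSet := by decide
  rw [← hx, hinj.mem_finset_image]

theorem der_upSum_pair_family {a : Finset (Fin 6) → PolyDual 4}
    (h : ∀ x y z : Fin 6, ∀ i p q : Fin 4, i ≠ p → i ≠ q → p ≠ q → pairSet x = {p, q} →
      pairSet y = {i, q} → pairSet z = {i, p} → ∀ S : Finset (Fin 6), S.Nonempty →
      der i (a ({x} ∪ S)) + der p (a ({y} ∪ S)) + der q (a ({z} ∪ S)) = 0)
    {v : Finset (Fin 6)} {P : Fin 6} (hP : P ∈ v) (i : Fin 4) :
    der i (upSum a v) = ∑ j ∈ planeCoord v P i, der (pairElem P j) (upSum a v) := by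
  by_cases hi : ∃ j, i = pairElem P j
  · obtain ⟨j, rfl⟩ := hi
    rw [planeCoord_pairElem hP, Finset.sum_singleton]
  push Not at hi
  obtain ⟨hpq, hx⟩ := pairSet_eq_pairElem P
  obtain ⟨y, z, hy, hz⟩ : ∃ y z, pairSet y = {i, pairElem P 1} ∧ pairSet z = {i, pairElem P 0} := by
    clear h hP
    revert i P; decide +kernel
  have h1 : ∑ T ∈ Finset.univ.filter (v ⊆ ·), (der i (a ({P} ∪ T)) +
      der (pairElem P 0) (a ({y} ∪ T)) + der (pairElem P 1) (a ({z} ∪ T))) = 0 :=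
    Finset.sum_eq_zero fun T hT => h P y z i _ _ (hi 0) (hi 1) hpq hx hy hz T
      ⟨P, (Finset.mem_filter.mp hT).2 hP⟩
  simp_rw [Finset.sum_add_distrib, ← map_sum, sum_superset_union, Finset.singleton_subset_iff]
    at h1
  rw [if_pos hP, add_assoc, add_eq_zero_iff_eq_neg, ZModModule.neg_eq_self] at h1
  rw [h1, planeCoord, Finset.sum_filter, Fin.sum_univ_two]
  simp only [zero_add, show (1 + 1 : Fin 2) = 0 from rfl, mem_image_pairSet hy,
    mem_image_pairSet hz]
  by_cases hy' : y ∈ v <;> by_cases hz' : z ∈ v <;> simp [hy', hz']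

theorem finrank_invDual_four {m D n : ℕ} (hD : 5 ≤ D) (hn : iterDeg m 2 D = 2 * n + 4) :
    Module.finrank (ZMod 2) (invDual 4 (iterDeg m 2 D)) =
      35 * Module.finrank (ZMod 2) (invDual 2 m) + Module.finrank (ZMod 2) (invDual 4 n) := by
  classical
  let p : Finset (Fin 6) → Fin 6 := fun v => if h : v.Nonempty then h.choose else 0
  have hp : ∀ v ∈ pluckerSupports, p v ∈ v := fun v hv => by
    have hne : v.Nonempty := (Finset.mem_filter.mp hv).2.1
    simp only [p, dif_pos hne]; exact hne.choose_spec
  have key := finrank_invDual_of_words (k := 4) (t := 2) (m := m)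
    (fun I : Fin 6 => psi (pairSet I)) (D := D) (by omega) pluckerSupports
    (fun v => planeCoord v (p v)) (fun v j => {pairElem (p v) j})
    (fun v hv j => by
      rw [linSub_X, Finset.sum_singleton, linSub_X, planeCoord_pairElem (hp v hv),
        Finset.sum_singleton])
    (fun v hv I h => psi_comp_kameko_linSub _ h _ _ (kameko_linSub_planeCoord hv (hp v hv) I))
    (fun f hf => by
      obtain ⟨a, ha1, ha2, ha3, ha4⟩ := exists_pair_family hD hf
      refine ⟨upSum a, fun l hl => by rw [upSum_upSum, ← ha1 l hl],
        fun v hne hv => upSum_pair_family ha3 hne hv,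
        fun v _ => Submodule.sum_mem _ fun S _ => ha2 S, fun v hv i w => ?_⟩
      have h1 := LinearMap.congr_fun (der_upSum_pair_family ha4 (hp v hv) i) w
      rw [der_apply, LinearMap.sum_apply] at h1
      rw [h1, linSub_X, map_sum, Finset.sum_mul, map_sum]
      refine Finset.sum_congr rfl fun j _ => ?_
      rw [der_apply, linSub_X, Finset.sum_singleton])
    (fun c h0 _ hl v => by
      by_cases hv : v ∈ pluckerSupports
      swap
      · exact h0 v hv
      rw [← upSum_upSum c v]
      refine Finset.sum_eq_zero fun S h => ?_
      by_cases hS : S = Finset.univ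
      · rw [hS, upSum, Finset.sum_eq_single_of_mem Finset.univ (by simp) fun T hT hT' =>
          absurd (Finset.univ_subset_iff.mp (Finset.mem_filter.mp hT).2) hT']
        exact h0 _ (by decide +kernel)
      · have hc := Finset.card_lt_card (Finset.ssubset_univ_iff.mpr hS)
        rw [Finset.card_univ, Fintype.card_fin] at hc
        obtain ⟨l, hl1, rfl⟩ := exists_list_toFinset (D := D)
          (Finset.Nonempty.mono (Finset.mem_filter.mp h).2 ⟨_, hp v hv⟩) (by omega)
        exact hl l hl1)
    _ (mem_map_kameko_iff (n' := n) pairSet (fun i => by revert i; decide)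
      (by omega) hn (fun f hf hl T hT => by
        obtain ⟨D, rfl⟩ : ∃ D', D = D' + 1 := ⟨D - 1, by omega⟩
        have h1 := psi_pairSet_eq_zero D f hf hl
        have hlt := Finset.card_lt_card (Finset.ssubset_univ_iff.mpr hT)
        rw [Finset.card_univ, Fintype.card_fin] at hlt
        by_cases h2 : T.card = 2
        · obtain ⟨I, rfl⟩ : ∃ I, pairSet I = T := by
            revert T; decide +kernel
          exact h1 I
        · exact psi_eq_zero_of_card_four hf h2 (by omega)))
  rw [key, finrank_map_kameko, card_pluckerSupports]

theorem sqTotal_constantCoeff {k : ℕ} (z : MvPolynomial (Fin k) (ZMod 2)) :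
    constantCoeff (SqTotal k z) = constantCoeff z := by
  have h : (constantCoeff (R := ZMod 2) (σ := Fin k)).comp (SqTotal k).toRingHom =
      constantCoeff := by
    refine ringHom_ext (fun r => ?_) fun i => ?_
    · simp [SqTotal]
    · simp [SqTotal]
  exact DFunLike.congr_fun h z

theorem finrank_invDual_zero (k : ℕ) : Module.finrank (ZMod 2) (invDual k 0) = 1 := by
  let ε : PolyDual k := lcoeff (ZMod 2) 0
  have hε : ε ∈ invDual k 0 := by
    refine ⟨fun z => sqTotal_constantCoeff z, fun a ha => ?_⟩
    change coeff 0 (monomial a (1 : ZMod 2)) = 0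
    rw [coeff_monomial, if_neg]
    rintro rfl
    exact ha (by simp)
  refine finrank_eq_one (⟨ε, hε⟩ : invDual k 0) ?_ fun f => ⟨(f : PolyDual k) 1, ?_⟩
  · intro h
    have h1 := LinearMap.congr_fun (congrArg Subtype.val h) 1
    change coeff 0 (1 : MvPolynomial (Fin k) (ZMod 2)) = 0 at h1
    simp at h1
  · refine Subtype.ext (PolyDual.ext_monomial fun a => ?_)
    change (f : PolyDual k) 1 * coeff 0 (monomial a (1 : ZMod 2)) = (f : PolyDual k) (monomial a 1)
    by_cases ha : a = 0
    · subst ha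
      simp
    · rw [coeff_monomial, if_neg ha, mul_zero, invDual_degree f.2 a]
      exact (Finsupp.degree_eq_zero_iff a).not.mpr ha

theorem finrank_invDual_two_pow_sub_one {D n : ℕ} (hD : 2 ≤ D) (hn : n + 1 = 2 ^ D) :
    Module.finrank (ZMod 2) (invDual 2 n) = 3 := by
  have h1 := iterDeg_add 0 1 D
  have h2 : n = iterDeg 0 1 D := by omega
  rw [h2, finrank_invDual_of_smallVanish (t := 1) (m := 0)
    (fun s hs f hf T hT => psi_eq_zero_of_iterDeg_one hs hf T hT) (Or.inl hD) (by omega),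
    finrank_invDual_zero]
  norm_num

theorem finrank_invDual_three_two_pow_sub_one {D n : ℕ} (hD : 5 ≤ D) (hn : n + 1 = 2 ^ D) :
    Module.finrank (ZMod 2) (invDual 3 n) = 14 := by
  obtain ⟨E, rfl⟩ : ∃ E, D = E + 2 := ⟨D - 2, by omega⟩
  have h1 := iterDeg_add 0 1 (E + 2)
  have h2 : n = iterDeg 0 1 (E + 2) := by omega
  have h3 := iterDeg_add 0 2 E
  rw [h2, finrank_invDual_three (n := iterDeg 0 2 E) (by omega) (by rw [pow_add] at h1; omega),
    finrank_invDual_of_smallVanish (t := 2) (m := 0)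
      (fun s hs f hf T hT => psi_eq_zero_of_sum_two_pow hs ∅ (by simp) (by simp) (by simp) hf T hT)
      (Or.inl (by omega)) (by omega), finrank_invDual_zero, finrank_invDual_zero]
  norm_num

theorem finrank_invDual_four_two_pow {e₁ e₂ n : ℕ} (h₂ : 5 ≤ e₂) (h₁ : e₂ + 4 ≤ e₁)
    (hn : n + 2 = 2 ^ e₁ + 2 ^ e₂) : Module.finrank (ZMod 2) (invDual 4 n) = 315 := by
  obtain ⟨E, rfl⟩ : ∃ E, e₂ = E + 2 := ⟨e₂ - 2, by omega⟩
  obtain ⟨u, rfl⟩ : ∃ u, e₁ = E + 2 + u := ⟨e₁ - (E + 2), by omega⟩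
  obtain ⟨m, hm⟩ : ∃ m, m + 1 = 2 ^ u := ⟨2 ^ u - 1, Nat.sub_add_cancel Nat.one_le_two_pow⟩
  have h3 := iterDeg_add m 2 (E + 2)
  have h4 := iterDeg_add (2 * m + 1) 3 E
  have h5 : n = iterDeg m 2 (E + 2) := by
    have : m + 2 = 2 ^ u + 1 := by omega
    rw [this, mul_add, ← pow_add] at h3
    omega
  have h6 : iterDeg m 2 (E + 2) = 2 * iterDeg (2 * m + 1) 3 E + 4 := by
    have h7 : 2 ^ (E + 2) * (m + 2) = 2 * (2 ^ E * (2 * m + 1 + 3)) := by ring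
    omega
  rw [h5, finrank_invDual_four (by omega) h6, finrank_invDual_two_pow_sub_one (by omega) hm,
    finrank_invDual_of_smallVanish (t := 3) (m := 2 * m + 1)
      (fun s hs f hf T hT => psi_eq_zero_of_sum_two_pow hs {u + 1} (fun e he => by
        rw [Finset.mem_singleton.mp he]
        exact ⟨by omega, (by norm_num : 3 ≤ 2 ^ 2).trans
          (Nat.pow_le_pow_right (by omega) (by omega))⟩)
        (by simp) (by rw [Finset.sum_singleton, pow_succ]; omega) hf T hT)
      (by omega) (by omega),
    finrank_invDual_three_two_pow_sub_one (D := u + 1) (by omega) (by rw [pow_succ]; omega)]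
  norm_num

theorem sum_two_pow_sub_one_add_card {I : Type*} (s : Finset I) (e : I → ℕ) :
    ∑ i ∈ s, (2 ^ e i - 1) + s.card = ∑ i ∈ s, 2 ^ e i := by
  rw [Finset.card_eq_sum_ones, ← Finset.sum_add_distrib]
  exact Finset.sum_congr rfl fun i _ => Nat.sub_add_cancel Nat.one_le_two_pow

theorem eq_prod_add_sum_of_recurrence {k : ℕ} (A κ : ℕ → ℕ) (h4 : A 4 = 315)
    (hA : ∀ r, 4 ≤ r → r + 1 ≤ k → A (r + 1) = (2 ^ (r + 1) - 1) * A r + κ (r + 1))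
    (r : ℕ) (hr : 4 ≤ r) : r ≤ k → A r = (∏ i ∈ Finset.Icc 1 r, (2 ^ i - 1)) +
      ∑ s ∈ Finset.Icc 5 r, (∏ i ∈ Finset.Icc (s + 1) r, (2 ^ i - 1)) * κ s := by
  induction r, hr using Nat.le_induction with
  | base =>
    intro _
    rw [h4, Finset.Icc_eq_empty (a := 5) (b := 4) (by omega), Finset.sum_empty, add_zero]
    decide
  | succ r hr ih =>
    intro hrk
    rw [hA r hr hrk, ih (by omega), Finset.prod_Icc_succ_top (by omega),
      Finset.sum_Icc_succ_top (by omega), Finset.Icc_eq_empty (a := r + 1 + 1) (by omega),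
      Finset.prod_empty, one_mul, mul_add, mul_comm, Finset.mul_sum, add_assoc]
    congr 2
    refine Finset.sum_congr rfl fun s hs => ?_
    rw [Finset.mem_Icc] at hs
    rw [Finset.prod_Icc_succ_top (by omega)]
    ring

theorem add_four_le_of_gaps {k : ℕ} {d : ℕ → ℕ} (h12 : d 2 + 4 ≤ d 1)
    (hgap : ∀ i, 4 ≤ i → i ≤ k → d (i - 1) + i ≤ d (i - 2)) (i j : ℕ) (hi : 1 ≤ i)
    (hij : i + 1 ≤ j) : j + 1 ≤ k → d j + 4 ≤ d i := by
  have hstep : ∀ j, 1 ≤ j → j + 2 ≤ k → d (j + 1) + 4 ≤ d j := by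
    intro j hj hjk
    by_cases h1 : j = 1
    · rw [h1]; exact h12
    · have := hgap (j + 2) (by omega) hjk
      rw [show j + 2 - 1 = j + 1 by omega, show j + 2 - 2 = j by omega] at this
      omega
  induction j, hij using Nat.le_induction with
  | base => exact hstep i hi
  | succ j hij ih =>
    intro hjk
    have h1 := ih (by omega)
    have h2 := hstep j (by omega) hjk
    omega

theorem finrank_invDual_gap_step {k : ℕ} {d : ℕ → ℕ} (h12 : d 2 + 4 ≤ d 1)
    (hgap : ∀ i, 4 ≤ i → i ≤ k → d (i - 1) + i ≤ d (i - 2)) {r : ℕ} (hr : 4 ≤ r)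
    (hrk : r + 1 ≤ k) :
    Module.finrank (ZMod 2) (invDual (r + 1)
      ((∑ i ∈ Finset.Icc 1 (r + 1 - 2), (2 ^ (d i - d (r + 1 - 1)) - 1)) - 1)) =
      (2 ^ (r + 1) - 1) * Module.finrank (ZMod 2) (invDual r
        (∑ i ∈ Finset.Icc 1 (r - 2), (2 ^ (d i - d (r - 1) + 1) - 1))) := by
  obtain ⟨q, rfl⟩ : ∃ q, r = q + 2 := ⟨r - 2, by omega⟩
  have hdec := add_four_le_of_gaps h12 hgap
  have hg1 : d (q + 1) + (q + 2) ≤ d q := hgap (q + 2) hr (by omega)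
  have hg2 : d (q + 2) + (q + 3) ≤ d (q + 1) := hgap (q + 3) (by omega) hrk
  change Module.finrank (ZMod 2) (invDual (q + 2 + 1)
      ((∑ i ∈ Finset.Icc 1 (q + 1), (2 ^ (d i - d (q + 2)) - 1)) - 1)) =
    (2 ^ (q + 2 + 1) - 1) * Module.finrank (ZMod 2) (invDual (q + 2)
      (∑ i ∈ Finset.Icc 1 q, (2 ^ (d i - d (q + 1) + 1) - 1)))
  have hle : ∀ i ∈ Finset.Icc 1 q, d (q + 1) + (q + 2) ≤ d i := fun i hi => by
    rw [Finset.mem_Icc] at hi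
    by_cases h : i = q
    · rw [h]; exact hg1
    · have := hdec i q hi.1 (by omega) (by omega)
      omega
  set m := ∑ i ∈ Finset.Icc 1 q, (2 ^ (d i - d (q + 1) + 1) - 1) with hm
  have hm1 := sum_two_pow_sub_one_add_card (Finset.Icc 1 q) fun i => d i - d (q + 1) + 1
  have hn1 := sum_two_pow_sub_one_add_card (Finset.Icc 1 (q + 1)) fun i => d i - d (q + 2)
  rw [← hm, Nat.card_Icc] at hm1
  rw [Nat.card_Icc] at hn1
  obtain ⟨D, hD⟩ : ∃ D, d (q + 1) = d (q + 2) + D + 1 := ⟨d (q + 1) - d (q + 2) - 1, by omega⟩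
  have h1 := iterDeg_add m (q + 2) D
  have h2 : 2 ^ D * (m + (q + 2)) = ∑ i ∈ Finset.Icc 1 (q + 1), 2 ^ (d i - d (q + 2)) := by
    rw [show m + (q + 2) = ∑ i ∈ Finset.Icc 1 q, 2 ^ (d i - d (q + 1) + 1) + 2 by omega, mul_add,
      Finset.mul_sum, Finset.sum_Icc_succ_top (by omega)]
    congr 1
    · refine Finset.sum_congr rfl fun i hi => ?_
      have := hle i hi
      rw [← pow_add]
      congr 1
      omega
    · rw [← pow_succ]
      congr 1
      omega
  have h3 : (∑ i ∈ Finset.Icc 1 (q + 1), (2 ^ (d i - d (q + 2)) - 1)) - 1 =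
      iterDeg m (q + 2) D := by omega
  have hmpos : 0 < m := by
    rw [hm]
    refine Finset.sum_pos (fun i _ => ?_) ⟨1, by rw [Finset.mem_Icc]; omega⟩
    have : 2 ^ (d i - d (q + 1) + 1) = 2 ^ (d i - d (q + 1)) * 2 := pow_succ _ _
    have := Nat.one_le_two_pow (n := d i - d (q + 1))
    omega
  have hinj : Set.InjOn (fun i => d i - d (q + 1) + 1) (Finset.Icc 1 q : Finset ℕ) := by
    intro i hi j hj hij
    have hi' := hle i hi
    have hj' := hle j hj
    rw [Finset.mem_coe, Finset.mem_Icc] at hi hj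
    simp only at hij
    rcases lt_trichotomy i j with h | h | h
    · have := hdec i j hi.1 h (by omega); omega
    · exact h
    · have := hdec j i hj.1 h (by omega); omega
  rw [h3, finrank_invDual_of_smallVanish (t := q + 2) (m := m) (fun s hs f hf T hT => ?_)
    (by omega) (by omega)]
  refine psi_eq_zero_of_sum_two_pow hs ((Finset.Icc 1 q).image fun i => d i - d (q + 1) + 1)
    (fun e he => ?_) ?_ ?_ hf T hT
  · obtain ⟨i, hi, rfl⟩ := Finset.mem_image.mp he
    have := hle i hi
    refine ⟨by omega, le_trans ?_ (Nat.lt_two_pow_self).le⟩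
    omega
  · rw [Finset.card_image_of_injOn hinj, Nat.card_Icc]; omega
  · rw [Finset.sum_image hinj]; omega

theorem two_mul_sum_sub_one_add {r : ℕ} (hr : 3 ≤ r) (e : ℕ → ℕ)
    (he : ∀ i ∈ Finset.Icc 1 (r - 2), 1 ≤ e i) :
    2 * ((∑ i ∈ Finset.Icc 1 (r - 2), (2 ^ e i - 1)) - 1) + r =
      ∑ i ∈ Finset.Icc 1 (r - 2), (2 ^ (e i + 1) - 1) := by
  have h1 := sum_two_pow_sub_one_add_card (Finset.Icc 1 (r - 2)) e
  have h2 := sum_two_pow_sub_one_add_card (Finset.Icc 1 (r - 2)) fun i => e i + 1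
  simp_rw [pow_succ] at h2 ⊢
  rw [← Finset.sum_mul, Nat.card_Icc] at h2
  rw [Nat.card_Icc] at h1
  have h3 : 0 < ∑ i ∈ Finset.Icc 1 (r - 2), (2 ^ e i - 1) := by
    refine Finset.sum_pos (fun i hi => ?_) ⟨1, by rw [Finset.mem_Icc]; omega⟩
    have : 2 ^ 1 ≤ 2 ^ e i := Nat.pow_le_pow_right (by omega) (he i hi)
    omega
  omega

/-- Corollary 1.6: for `k ≥ 5` and positive integers `d_1, …, d_{k-2}` with
`d_1 - d_2 ≥ 4`, `d_{i-2} - d_{i-1} ≥ i` for `4 ≤ i ≤ k`, and `d_{k-1} = 1`,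
setting `n = Σ_{i=1}^{k-2} (2^{d_i} - 1)` and, for `5 ≤ r ≤ k`,
`n_r = Σ_{i=1}^{r-2} (2^{d_i - d_{r-1}} - 1) - 1`, one has
`dim (QP_k)_n = Π_{i=1}^{k} (2^i - 1)
  + Σ_{r=5}^{k} (Π_{i=r+1}^{k} (2^i - 1)) · dim Ker((Sq̃^0_*)_{n_r})`,
where `(Sq̃^0_*)_{n_r} : (QP_r)_{2 n_r + r} → (QP_r)_{n_r}` is Kameko's homomorphism,
here taken to be any family of linear maps `L r` compatible with `Sq̃`. -/
theorem stmt7 (k : ℕ) (hk : 5 ≤ k) (d : ℕ → ℕ)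
    (hpos : ∀ i, 1 ≤ i → i ≤ k - 2 → 0 < d i)
    (h12 : d 2 + 4 ≤ d 1)
    (hgap : ∀ i, 4 ≤ i → i ≤ k → d (i - 1) + i ≤ d (i - 2))
    (hdk : d (k - 1) = 1)
    (L : ∀ r : ℕ,
        QP r (2 * ((∑ i ∈ Finset.Icc 1 (r - 2), (2 ^ (d i - d (r - 1)) - 1)) - 1) + r)
          →ₗ[ZMod 2]
        QP r ((∑ i ∈ Finset.Icc 1 (r - 2), (2 ^ (d i - d (r - 1)) - 1)) - 1))
    (hL : ∀ r, 5 ≤ r → r ≤ k →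
        ∀ (f : homogeneousSubmodule (Fin r) (ZMod 2)
              (2 * ((∑ i ∈ Finset.Icc 1 (r - 2), (2 ^ (d i - d (r - 1)) - 1)) - 1) + r))
          (g : homogeneousSubmodule (Fin r) (ZMod 2)
              ((∑ i ∈ Finset.Icc 1 (r - 2), (2 ^ (d i - d (r - 1)) - 1)) - 1)),
          (g : MvPolynomial (Fin r) (ZMod 2)) =
              kamekoFun r (f : MvPolynomial (Fin r) (ZMod 2)) →
          L r (Submodule.Quotient.mk f) = Submodule.Quotient.mk g) :
    Module.finrank (ZMod 2) (QP k (∑ i ∈ Finset.Icc 1 (k - 2), (2 ^ d i - 1))) =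
      (∏ i ∈ Finset.Icc 1 k, (2 ^ i - 1)) +
        ∑ r ∈ Finset.Icc 5 k,
          (∏ i ∈ Finset.Icc (r + 1) k, (2 ^ i - 1)) *
            Module.finrank (ZMod 2) (LinearMap.ker (L r)) := by
  have hdec := add_four_le_of_gaps h12 hgap
  rw [finrank_QP]
  have key := eq_prod_add_sum_of_recurrence (k := k)
    (fun r => Module.finrank (ZMod 2) (invDual r
      (∑ i ∈ Finset.Icc 1 (r - 2), (2 ^ (d i - d (r - 1) + 1) - 1))))
    (fun r => Module.finrank (ZMod 2) (LinearMap.ker (L r))) ?_ ?_ k (by omega) le_rfl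
  · refine Eq.trans ?_ key
    refine congrArg (fun n => Module.finrank (ZMod 2) (invDual k n))
      (Finset.sum_congr rfl fun i hi => ?_)
    rw [Finset.mem_Icc] at hi
    have := hpos i hi.1 hi.2
    rw [hdk, Nat.sub_add_cancel this]
  · have h3 : d 3 + 4 ≤ d 2 := hgap 4 le_rfl (by omega)
    refine finrank_invDual_four_two_pow (e₁ := d 1 - d 3 + 1) (e₂ := d 2 - d 3 + 1) (by omega)
      (by omega) ?_
    have h1 := sum_two_pow_sub_one_add_card (Finset.Icc 1 2) fun i => d i - d 3 + 1
    have h2 : Finset.Icc 1 2 = {1, 2} := by decide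
    rw [Nat.card_Icc] at h1
    refine h1.trans ?_
    rw [h2, Finset.sum_pair (by decide)]
  · intro r hr hrk
    have h1 := finrank_invDual_kameko (r + 1) _ (L (r + 1)) (hL (r + 1) (by omega) hrk)
    rw [finrank_invDual_gap_step h12 hgap hr hrk] at h1
    have h2 := two_mul_sum_sub_one_add (r := r + 1) (by omega)
      (fun i => d i - d (r + 1 - 1)) fun i hi => by
        rw [Finset.mem_Icc] at hi
        have := hdec i (r + 1 - 1) hi.1 (by omega) (by omega)
        omega
    exact (congrArg (fun n => Module.finrank (ZMod 2) (invDual (r + 1) n)) h2.symm).trans h1
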